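/- Suppose λ_n = n·p_n → ∞ as n→∞. Then the conditional law of (H_n − log n)/√(log n) (given that the two uniformly chosen vertices are connected) converges weakly to the standard normal distribution if and only if λ_n/√(log n) → ∞; that is, in the central limit theorem (H_n − β_n·log n)/√(log n) ⇒ N(0,1) with β_n = λ_n/(λ_n−1), the centering constant β_n·log n can be replaced by log n precisely when λ_n/√(log n) → ∞. -/

import Mathlib

/-!
First passage percolation on the Erdős–Rényi random graph `G_n(p_n)` with i.i.d. rate-1
exponential edge weights.  CLT for the hopcount between two uniformly chosen vertices
(by exchangeability, vertices `0` and `1`), conditioned on the two vertices being connected: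
if `n pₙ → λ > 1` and `β = λ/(λ-1)` then `(Hₙ - β log n)/√(β log n) ⇒ N(0,1)`.
(The graph on `n` vertices is indexed here as `Fin (n+2)` so that the two chosen vertices
always exist; the limit `n → ∞` is unaffected.)
-/

open MeasureTheory ProbabilityTheory Filter Real
open scoped ENNReal NNReal

noncomputable section

/-- The exponential distribution with rate 1 on `ℝ`. -/
def expDist : Measure ℝ :=
  volume.withDensity (fun x => if 0 ≤ x then ENNReal.ofReal (Real.exp (-x)) else 0)

/-- The Bernoulli distribution on `Bool` with success probability `p`. -/
def bernoulliDist (p : ℝ) : Measure Bool :=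
  ENNReal.ofReal p • Measure.dirac true + ENNReal.ofReal (1 - p) • Measure.dirac false

/-- The (random) Erdős–Rényi graph determined by the edge indicators: the first component of
`Z e` tells whether the edge `e` is present. -/
def theGraph {n : ℕ} (Z : Sym2 (Fin n) → Bool × ℝ) : SimpleGraph (Fin n) where
  Adj a b := a ≠ b ∧ (Z s(a, b)).1 = true
  symm := by
    constructor
    intro a b h
    refine ⟨h.1.symm, ?_⟩
    rw [Sym2.eq_swap]
    exact h.2
  loopless := by constructor; intro a h; exact h.1 rfl

/-- Effective edge weights: the exponential weight on present edges, `∞` on absent ones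
(and on loops). -/
def effWeight {n : ℕ} (Z : Sym2 (Fin n) → Bool × ℝ) (a b : Fin n) : ℝ≥0∞ :=
  if a ≠ b ∧ (Z s(a, b)).1 = true then ENNReal.ofReal (Z s(a, b)).2 else ⊤

/-- Total weight of a walk `q` with `k` steps. -/
def walkWeight {n : ℕ} (w : Fin n → Fin n → ℝ≥0∞) {k : ℕ} (q : Fin (k + 1) → Fin n) : ℝ≥0∞ :=
  ∑ t : Fin k, w (q t.castSucc) (q t.succ)

/-- The minimal total weight over all paths (walks) from `i` to `j`; `∞` iff `i`, `j` are
not connected in the graph of finite-weight edges. -/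
def minWeight {n : ℕ} (w : Fin n → Fin n → ℝ≥0∞) (i j : Fin n) : ℝ≥0∞ :=
  ⨅ (k : ℕ) (q : Fin (k + 1) → Fin n) (_ : q 0 = i ∧ q (Fin.last k) = j), walkWeight w q

/-- The hopcount: the number of edges of the minimal-weight path from `i` to `j`
(the minimal number of edges among weight-minimizing walks; almost surely the minimal-weight
path is unique, and then this is its number of edges). -/
def hopCount {n : ℕ} (w : Fin n → Fin n → ℝ≥0∞) (i j : Fin n) : ℕ :=
  sInf {k : ℕ | ∃ q : Fin (k + 1) → Fin n,
    q 0 = i ∧ q (Fin.last k) = j ∧ walkWeight w q = minWeight w i j}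

section
set_option linter.unusedSectionVars false
set_option linter.style.haveILetI false
open ENNReal (ofReal)
namespace FPP

variable {V : Type} [Fintype V] [DecidableEq V]

def DD (o : V) (w : V → V → ℝ≥0∞) : ℕ → V → ℝ≥0∞
  | 0, v => if v = o then 0 else ⊤
  | (k+1), v => ⨅ v', DD o w k v' + w v' v

def TT (o : V) (w : V → V → ℝ≥0∞) (v : V) : ℝ≥0∞ := ⨅ k, DD o w k v

def hop (o : V) (w : V → V → ℝ≥0∞) (v : V) : ℕ := sInf {k | DD o w k v = TT o w v}

def wr (A : Finset V) (w : V → V → ℝ≥0∞) (a b : V) : ℝ≥0∞ := if a ∈ A ∧ b ∈ A then w a b else ⊤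

lemma TT_le (o : V) (w) (k : ℕ) (v : V) : TT o w v ≤ DD o w k v := iInf_le _ _

@[simp] lemma TT_root (o : V) (w) : TT o w o = 0 := by
  have := TT_le o w 0 o
  simpa [DD] using this

lemma TT_bellman (o : V) (w) {u : V} (hu : u ≠ o) : TT o w u = ⨅ v, TT o w v + w v u := by
  unfold TT
  rw [← inf_iInf_nat_succ]
  simp only [DD, if_neg hu, top_inf_eq, ENNReal.iInf_add]
  rw [iInf_comm]

lemma TT_step (o : V) (w) (v u : V) : TT o w u ≤ TT o w v + w v u := by
  by_cases hu : u = o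
  · subst hu; simp
  · rw [TT_bellman o w hu]; exact iInf_le _ v

lemma exists_min [Nonempty V] (f : V → ℝ≥0∞) : ∃ v, f v = ⨅ v, f v := by
  obtain ⟨v, hv⟩ := exists_eq_ciInf_of_finite (f := f)
  exact ⟨v, hv⟩

lemma DD_attain (o : V) (w) (k : ℕ) (v : V) : ∃ v', DD o w k v' + w v' v = DD o w (k+1) v := by
  haveI : Nonempty V := ⟨v⟩
  exact exists_min _

lemma DD_succ_le (o : V) (w) (k : ℕ) (v v' : V) : DD o w (k+1) v ≤ DD o w k v' + w v' v :=
  iInf_le _ v'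

lemma TT_attain (o : V) (w) {u : V} (hu : u ≠ o) : ∃ v, TT o w v + w v u = TT o w u := by
  haveI : Nonempty V := ⟨u⟩
  rw [TT_bellman o w hu]
  exact exists_min _

lemma DD_mono (o : V) {w w' : V → V → ℝ≥0∞} (h : ∀ a b, w a b ≤ w' a b) (k v) :
    DD o w k v ≤ DD o w' k v := by
  induction k generalizing v with
  | zero => exact le_rfl
  | succ k ih =>
    exact iInf_mono fun v' => add_le_add (ih v') (h _ _)

lemma TT_mono (o : V) {w w' : V → V → ℝ≥0∞} (h : ∀ a b, w a b ≤ w' a b) (v) :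
    TT o w v ≤ TT o w' v := iInf_mono fun k => DD_mono o h k v

lemma le_wr (A : Finset V) (w : V → V → ℝ≥0∞) (a b) : w a b ≤ wr A w a b := by
  unfold wr; split_ifs <;> simp

lemma TT_le_wr (o : V) (A : Finset V) (w) (v) : TT o w v ≤ TT o (wr A w) v :=
  TT_mono o (le_wr A w) v

lemma lt_add_pos {a b : ℝ≥0∞} (ha : a ≠ ⊤) (hb : 0 < b) : a < a + b :=
  ENNReal.lt_add_right ha hb.ne'

lemma TT_wr_notMem (o : V) (A : Finset V) (w) {v : V} (hv : v ∉ A) (hvo : v ≠ o) :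
    TT o (wr A w) v = ⊤ := by
  rw [TT_bellman _ _ hvo]
  simp [wr, hv]

lemma DD_cav (o : V) (w) (A : Finset V) (hw : ∀ a b, 0 < w a b) (u : V)
    (k : ℕ) (v : V) (hv : v ∈ A.erase u) (h : DD o (wr A w) k v ≤ TT o (wr A w) u) :
    DD o (wr (A.erase u) w) k v ≤ DD o (wr A w) k v := by
  induction k generalizing v with
  | zero => exact le_rfl
  | succ k ih =>
    by_cases htop : DD o (wr A w) (k+1) v = ⊤
    · rw [htop]; exact le_top
    obtain ⟨v', hv'⟩ := DD_attain o (wr A w) k v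
    rw [← hv'] at h htop ⊢
    have hmem : v' ∈ A := by
      by_contra hc; apply htop; simp [wr, hc]
    have h1 : DD o (wr A w) k v' ≠ ⊤ := fun hc => htop (by simp [hc])
    by_cases hvu : v' = u
    · exfalso
      subst hvu
      have h2 : 0 < wr A w v' v := lt_of_lt_of_le (hw _ _) (le_wr _ _ _ _)
      have h3 := TT_le o (wr A w) k v'
      exact absurd (h.trans h3) (not_le.2 (lt_add_pos h1 h2))
    · have hvA : v' ∈ A.erase u := Finset.mem_erase.2 ⟨hvu, hmem⟩
      refine (DD_succ_le o _ k v v').trans ?_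
      refine add_le_add (ih v' hvA (le_trans le_self_add h)) ?_
      have := Finset.mem_of_mem_erase hv
      simp [wr, hvA, hv, hmem, this]

lemma wr_anti {A B : Finset V} (hAB : A ⊆ B) (w : V → V → ℝ≥0∞) (a b) : wr B w a b ≤ wr A w a b := by
  unfold wr
  split_ifs with h1 h2 h2
  · exact le_rfl
  · exact le_top
  · exact absurd ⟨hAB h2.1, hAB h2.2⟩ h1
  · exact le_rfl

lemma TT_DD_attain (o : V) (w) (hw : ∀ a b, 0 < w a b) (v : V) (h : TT o w v ≠ ⊤) :
    ∃ k, DD o w k v = TT o w v := by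
  induction hn : (Finset.univ.filter fun j => TT o w j < TT o w v).card using Nat.strong_induction_on
    generalizing v with
  | _ n ih =>
  by_cases hv : v = o
  · subst hv; exact ⟨0, by simp [DD]⟩
  obtain ⟨v', hv'⟩ := TT_attain o w hv
  have h1 : TT o w v' ≠ ⊤ := fun hc => h (by rw [← hv', hc]; simp)
  have hlt : TT o w v' < TT o w v := by rw [← hv']; exact lt_add_pos h1 (hw _ _)
  obtain ⟨k, hk⟩ := ih _ (by
    rw [← hn]
    apply Finset.card_lt_card
    refine Finset.ssubset_iff_of_subset ?_ |>.2 ⟨v', by simp [hlt], by simp⟩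
    intro j hj
    simp only [Finset.mem_filter, Finset.mem_univ, true_and] at hj ⊢
    exact hj.trans hlt) v' h1 rfl
  refine ⟨k+1, le_antisymm ?_ (TT_le _ _ _ _)⟩
  rw [← hv', ← hk]
  exact DD_succ_le _ _ _ _ _

lemma cav1 (o : V) (w) (A : Finset V) (hw : ∀ a b, 0 < w a b) {u v : V} (hvu : v ≠ u) (hv : v ∈ A)
    (h : TT o (wr A w) v ≤ TT o (wr A w) u) :
    TT o (wr (A.erase u) w) v = TT o (wr A w) v := by
  refine le_antisymm ?_ (TT_mono o (wr_anti (Finset.erase_subset _ _) w) v)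
  by_cases ht : TT o (wr A w) v = ⊤
  · rw [ht]; exact le_top
  obtain ⟨k, hk⟩ := TT_DD_attain o (wr A w) (fun a b => lt_of_lt_of_le (hw a b) (le_wr _ _ _ _)) v ht
  rw [← hk]
  exact (TT_le _ _ k v).trans (DD_cav o w A hw u k v (Finset.mem_erase.2 ⟨hvu, hv⟩) (hk ▸ h))

lemma cav3 (o : V) (w) (A : Finset V) (hw : ∀ a b, 0 < w a b) {u : V} (hu : u ≠ o) (huA : u ∈ A)
    (hoA : o ∈ A) :
    TT o (wr A w) u = ⨅ v, TT o (wr (A.erase u) w) v + w v u := by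
  apply le_antisymm
  · refine le_iInf fun v => ?_
    by_cases hvu : v = u
    · subst hvu; rw [TT_wr_notMem o (A.erase v) w (by simp) hu]; simp
    by_cases hv : v ∈ A
    · refine (TT_step o (wr A w) v u).trans (add_le_add (TT_mono o (wr_anti (Finset.erase_subset _ _) w) v) ?_)
      simp [wr, hv, huA]
    · by_cases hvo : v = o
      · exact absurd (hvo ▸ hoA) hv
      · rw [TT_wr_notMem o (A.erase u) w (by simp [hv]) hvo]; simp
  · obtain ⟨v, hv⟩ := TT_attain o (wr A w) hu
    by_cases ht : TT o (wr A w) u = ⊤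
    · rw [ht]; exact le_top
    have h1 : TT o (wr A w) v ≠ ⊤ := fun hc => ht (by rw [← hv, hc]; simp)
    have hlt : TT o (wr A w) v < TT o (wr A w) u := by
      rw [← hv]; exact lt_add_pos h1 (lt_of_lt_of_le (hw _ _) (le_wr _ _ _ _))
    have hvu : v ≠ u := by rintro rfl; exact lt_irrefl _ hlt
    have hvA : v ∈ A := by
      by_contra hc; apply ht; rw [← hv]; simp [wr, hc]
    refine (iInf_le _ v).trans ?_
    rw [cav1 o w A hw hvu hvA hlt.le, ← hv]
    exact add_le_add le_rfl (le_wr _ _ _ _)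

@[simp] lemma wr_univ (w : V → V → ℝ≥0∞) : wr Finset.univ w = w := by
  funext a b; simp [wr]

abbrev cv (u : V) (w : V → V → ℝ≥0∞) : V → V → ℝ≥0∞ := wr (Finset.univ.erase u) w

lemma cv_root (o u : V) (w) (hu : u ≠ o) : TT o (cv u w) u = ⊤ :=
  TT_wr_notMem o (Finset.univ.erase u) w (by simp) hu

lemma cv_inf (o : V) (w) (hw : ∀ a b, 0 < w a b) {u : V} (hu : u ≠ o) :
    TT o w u = ⨅ v, TT o (cv u w) v + w v u := by
  have := cav3 o w Finset.univ hw hu (Finset.mem_univ _) (Finset.mem_univ _)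
  simpa using this

lemma cv_eq (o : V) (w) (hw : ∀ a b, 0 < w a b) {u v : V} (hvu : v ≠ u)
    (h : TT o w v ≤ TT o w u) : TT o (cv u w) v = TT o w v := by
  have := cav1 o w Finset.univ hw hvu (Finset.mem_univ _) (by simpa using h)
  simpa using this

lemma cv_lt_iff (o : V) (w) (hw : ∀ a b, 0 < w a b) {u v : V} (hu : u ≠ o) :
    TT o (cv u w) v < TT o w u ↔ TT o w v < TT o w u := by
  constructor
  · exact fun h => lt_of_le_of_lt (TT_le_wr _ _ _ _) h
  · intro h
    have hvu : v ≠ u := by rintro rfl; exact lt_irrefl _ h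
    rwa [cv_eq o w hw hvu h.le]

lemma cv_hop (o : V) (w) (hw : ∀ a b, 0 < w a b) {u v : V}
    (h : TT o w v < TT o w u) : hop o (cv u w) v = hop o w v := by
  have hvu : v ≠ u := by rintro rfl; exact lt_irrefl _ h
  have he := cv_eq o w hw hvu h.le
  unfold hop
  congr 1
  ext k
  simp only [Set.mem_setOf_eq, he]
  constructor
  · intro h1
    refine le_antisymm ?_ (TT_le _ _ _ _)
    rw [← h1]; exact DD_mono o (le_wr _ _) k v
  · intro h1
    refine le_antisymm ?_ (he ▸ TT_le _ _ _ _)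
    have := DD_cav o w Finset.univ hw u k v (by simp [hvu]) (by simpa [h1] using h.le)
    simpa [h1] using this

lemma hop_succ (o : V) (w) (hw : ∀ a b, 0 < w a b) {u v : V} (hu : u ≠ o)
    (hT : TT o w u ≠ ⊤) (hv : TT o w v + w v u = TT o w u)
    (huniq : ∀ v', TT o w v' + w v' u = TT o w u → v' = v) :
    hop o w u = hop o w v + 1 := by
  have hvT : TT o w v ≠ ⊤ := fun hc => hT (by rw [← hv, hc]; simp)
  have hwT : w v u ≠ ⊤ := fun hc => hT (by rw [← hv, hc]; simp)
  have key : ∀ k, DD o w (k+1) u = TT o w u ↔ DD o w k v = TT o w v := by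
    intro k
    constructor
    · intro h
      obtain ⟨v', hv'⟩ := DD_attain o w k u
      rw [h] at hv'
      have h1 : TT o w v' + w v' u = TT o w u :=
        le_antisymm ((add_le_add (TT_le o w k v') le_rfl).trans hv'.le) (TT_step o w v' u)
      have := huniq v' h1
      subst this
      rw [← hv] at hv'
      exact (ENNReal.add_left_inj hwT).1 hv'
    · intro h
      refine le_antisymm ?_ (TT_le _ _ _ _)
      rw [← hv, ← h]; exact DD_succ_le _ _ _ _ _
  have h0 : DD o w 0 u ≠ TT o w u := by simp [DD, hu]; exact hT.symm
  obtain ⟨k0, hk0⟩ := TT_DD_attain o w hw v hvT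
  unfold hop
  apply le_antisymm
  · apply Nat.sInf_le
    exact (key _).2 (Nat.sInf_mem (s := {k | DD o w k v = TT o w v}) ⟨k0, hk0⟩)
  · have hm := Nat.sInf_mem (s := {k | DD o w k u = TT o w u}) ⟨k0+1, (key _).2 hk0⟩
    rcases hk : sInf {k | DD o w k u = TT o w u} with _ | k
    · rw [hk] at hm; exact absurd hm h0
    · rw [hk] at hm
      exact Nat.succ_le_succ (Nat.sInf_le ((key _).1 hm))

@[simp] lemma hop_root (o : V) (w) : hop o w o = 0 := by
  apply Nat.sInf_eq_zero.2; left; simp [DD]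

lemma ball_aux (o : V) (w) (S : Finset V) (t : ℝ≥0∞)
    (hS : ∀ v ∈ S, ∀ u ∉ S, t < TT o (wr S w) v + w v u) (ho : o ∈ S) (ht : t ≠ ⊤) (k : ℕ) (v : V)
    (h : DD o w k v ≤ t) : v ∈ S ∧ DD o (wr S w) k v ≤ DD o w k v := by
  induction k generalizing v with
  | zero =>
    have : v = o := by
      by_contra hc; simp [DD, hc] at h; exact ht h
    exact ⟨this ▸ ho, le_rfl⟩
  | succ k ih =>
    obtain ⟨v', hv'⟩ := DD_attain o w k v
    obtain ⟨h1, h2⟩ := ih v' (by rw [← hv'] at h; exact le_trans le_self_add h)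
    have hvS : v ∈ S := by
      by_contra hc
      have := hS v' h1 v hc
      have h3 : TT o (wr S w) v' + w v' v ≤ DD o w k v' + w v' v :=
        add_le_add ((TT_le _ _ k _).trans h2) le_rfl
      rw [hv'] at h3
      exact absurd (lt_of_lt_of_le this h3) (not_lt.2 h)
    refine ⟨hvS, (DD_succ_le _ _ k v v').trans ?_⟩
    rw [← hv']
    exact add_le_add h2 (by simp [wr, h1, hvS])

lemma ball_aux2 (o : V) (w) (S : Finset V) (t : ℝ≥0∞)
    (hS : ∀ v, TT o w v ≤ t ↔ v ∈ S) (k : ℕ) (v : V)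
    (h : DD o w k v ≤ t) : DD o (wr S w) k v ≤ DD o w k v := by
  induction k generalizing v with
  | zero => exact le_rfl
  | succ k ih =>
    obtain ⟨v', hv'⟩ := DD_attain o w k v
    have h1 : DD o w k v' ≤ t := by rw [← hv'] at h; exact le_trans le_self_add h
    refine (DD_succ_le _ _ k v v').trans ?_
    rw [← hv']
    have hv'S := (hS v').1 ((TT_le _ _ _ _).trans h1)
    have hvS := (hS v).1 ((TT_le _ _ _ _).trans h)
    exact add_le_add (ih v' h1) (by simp [wr, hv'S, hvS])

lemma ball_iff (o : V) (w) (hw : ∀ a b, 0 < w a b) (S : Finset V) (ho : o ∈ S) (t : ℝ≥0∞) (ht : t ≠ ⊤) :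
    (∀ v, TT o w v ≤ t ↔ v ∈ S) ↔ ((∀ v ∈ S, TT o (wr S w) v ≤ t) ∧
      (∀ v ∈ S, ∀ u ∉ S, t < TT o (wr S w) v + w v u)) := by
  constructor
  · intro hS
    have h1 : ∀ v ∈ S, TT o (wr S w) v ≤ TT o w v := by
      intro v hv
      have h2 := (hS v).2 hv
      obtain ⟨k, hk⟩ := TT_DD_attain o w hw v (ne_top_of_le_ne_top ht h2)
      rw [← hk]
      exact (TT_le _ _ k v).trans (ball_aux2 o w S t hS k v (hk ▸ h2))
    refine ⟨fun v hv => (h1 v hv).trans ((hS v).2 hv), fun v hv u hu => ?_⟩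
    have h3 : t < TT o w u := not_le.1 (fun hc => hu ((hS u).1 hc))
    exact lt_of_lt_of_le h3 ((TT_step o w v u).trans (add_le_add (TT_le_wr _ _ _ _) le_rfl))
  · rintro ⟨h1, h2⟩ v
    constructor
    · intro h
      obtain ⟨k, hk⟩ := TT_DD_attain o w hw v (ne_top_of_le_ne_top ht h)
      exact (ball_aux o w S t h2 ho ht k v (hk ▸ h)).1
    · intro h
      exact (TT_le_wr _ _ _ _).trans (h1 v h)

lemma ball_eq (o : V) (w) (hw : ∀ a b, 0 < w a b) (S : Finset V) (t : ℝ≥0∞) (ht : t ≠ ⊤)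
    (hS : ∀ v, TT o w v ≤ t ↔ v ∈ S) (v : V) (hv : v ∈ S) : TT o (wr S w) v = TT o w v := by
  refine le_antisymm ?_ (TT_le_wr _ _ _ _)
  have h2 := (hS v).2 hv
  obtain ⟨k, hk⟩ := TT_DD_attain o w hw v (ne_top_of_le_ne_top ht h2)
  rw [← hk]
  exact (TT_le _ _ k v).trans (ball_aux2 o w S t hS k v (hk ▸ h2))

end FPP

namespace FPP

lemma walk_succ {n k : ℕ} (w : Fin n → Fin n → ℝ≥0∞) (q : Fin (k + 1 + 1) → Fin n) :
    walkWeight w q = walkWeight w (fun i : Fin (k+1) => q i.castSucc) +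
      w (q (Fin.last k).castSucc) (q (Fin.last (k+1))) := by
  unfold walkWeight
  rw [Fin.sum_univ_castSucc]
  rfl

lemma DD_le_walk {n : ℕ} (o : Fin n) (w) (k : ℕ) (q : Fin (k+1) → Fin n) (h0 : q 0 = o) :
    DD o w k (q (Fin.last k)) ≤ walkWeight w q := by
  induction k with
  | zero =>
    have : q (Fin.last 0) = o := h0
    simp [DD, h0]
  | succ k ih =>
    rw [walk_succ]
    exact (DD_succ_le _ _ _ _ _).trans (add_le_add (ih (fun i : Fin (k+1) => q i.castSucc) h0) le_rfl)

lemma exists_walk {n : ℕ} (o : Fin n) (w) (k : ℕ) (v : Fin n) (h : DD o w k v ≠ ⊤) :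
    ∃ q : Fin (k+1) → Fin n, q 0 = o ∧ q (Fin.last k) = v ∧ walkWeight w q = DD o w k v := by
  induction k generalizing v with
  | zero =>
    have : v = o := by by_contra hc; simp [DD, hc] at h
    exact ⟨fun _ => o, rfl, this.symm, by simp [walkWeight, DD, this]⟩
  | succ k ih =>
    obtain ⟨v', hv'⟩ := DD_attain o w k v
    obtain ⟨q, h1, h2, h3⟩ := ih v' (fun hc => h (by rw [← hv', hc]; simp))
    refine ⟨Fin.snoc (α := fun _ => Fin n) q v, ?_, ?_, ?_⟩
    · have : (0 : Fin (k+1+1)) = (0 : Fin (k+1)).castSucc := rfl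
      rw [this, Fin.snoc_castSucc, h1]
    · rw [Fin.snoc_last]
    · rw [walk_succ]
      simp only [Fin.snoc_castSucc, Fin.snoc_last]
      rw [h3, h2, hv']

lemma minWeight_eq {n : ℕ} (o v : Fin n) (w) : minWeight w o v = TT o w v := by
  unfold minWeight TT
  apply le_antisymm
  · refine le_iInf fun k => ?_
    by_cases h : DD o w k v = ⊤
    · rw [h]; exact le_top
    obtain ⟨q, h1, h2, h3⟩ := exists_walk o w k v h
    rw [← h3]
    exact iInf_le_of_le k (iInf_le_of_le q (iInf_le _ ⟨h1, h2⟩))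
  · refine le_iInf fun k => le_iInf fun q => le_iInf fun hq => ?_
    refine iInf_le_of_le k ?_
    rw [← hq.2]
    exact DD_le_walk o w k q hq.1

lemma hopCount_eq {n : ℕ} (o v : Fin n) (w) (hT : TT o w v ≠ ⊤) : hopCount w o v = hop o w v := by
  unfold hopCount hop
  congr 1
  ext k
  rw [minWeight_eq]
  constructor
  · rintro ⟨q, h1, h2, h3⟩
    refine le_antisymm ?_ (TT_le _ _ _ _)
    rw [← h3, ← h2]
    exact DD_le_walk o w k q h1
  · intro h
    have h : DD o w k v = TT o w v := h
    obtain ⟨q, h1, h2, h3⟩ := exists_walk o w k v (h ▸ hT)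
    exact ⟨q, h1, h2, h3.trans h⟩

lemma DD_reach {n : ℕ} (z : Sym2 (Fin n) → Bool × ℝ) (o : Fin n) (k v)
    (h : DD o (effWeight z) k v ≠ ⊤) : (theGraph z).Reachable o v := by
  induction k generalizing v with
  | zero =>
    have : v = o := by by_contra hc; simp [DD, hc] at h
    rw [this]
  | succ k ih =>
    obtain ⟨v', hv'⟩ := DD_attain o (effWeight z) k v
    have h1 := ih v' (fun hc => h (by rw [← hv', hc]; simp))
    have h2 : effWeight z v' v ≠ ⊤ := (fun hc => h (by rw [← hv', hc]; simp))
    refine h1.trans (SimpleGraph.Adj.reachable ?_)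
    by_contra hc
    exact h2 (if_neg hc)

lemma TT_reach {n : ℕ} (z : Sym2 (Fin n) → Bool × ℝ) (o v : Fin n)
    (h : TT o (effWeight z) v ≠ ⊤) : (theGraph z).Reachable o v := by
  have : ∃ k, DD o (effWeight z) k v ≠ ⊤ := by
    by_contra hc
    push Not at hc
    exact h (by simp [TT, hc])
  obtain ⟨k, hk⟩ := this
  exact DD_reach z o k v hk

end FPP

namespace FPP

abbrev Cf (N : ℕ) : Type := Sym2 (Fin N) → Bool × ℝ
abbrev St (N : ℕ) : Type := Fin N → Bool × ℝ

def nu (p : ℝ) : Measure (Bool × ℝ) := (bernoulliDist p).prod expDist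

lemma lint_exp (f : ℝ → ℝ≥0∞) (hf : Measurable f) :
    ∫⁻ x, f x ∂expDist = ∫⁻ x in Set.Ioi 0, ofReal (exp (-x)) * f x := by
  unfold expDist
  rw [lintegral_withDensity_eq_lintegral_mul _ _ hf]
  · rw [← lintegral_indicator measurableSet_Ioi]
    apply lintegral_congr_ae
    have : ∀ᵐ x : ℝ, x ≠ 0 := by simp [ae_iff]
    filter_upwards [this] with x hx
    rcases lt_or_gt_of_ne hx with h | h
    · simp [not_le.2 h, not_lt.2 h.le]
    · simp [h.le, h]
  · refine Measurable.ite measurableSet_Ici ?_ measurable_const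
    exact (Real.measurable_exp.comp measurable_neg).ennreal_ofReal

lemma lint_exp_Ioi (a : ℝ) : ∫⁻ x in Set.Ioi a, ofReal (exp (-x)) = ofReal (exp (-a)) := by
  rw [← ofReal_integral_eq_lintegral_ofReal]
  · rw [integral_exp_neg_Ioi]
  · exact integrableOn_exp_neg_Ioi a
  · exact ae_of_all _ fun x => (Real.exp_pos _).le

instance : IsProbabilityMeasure expDist := by
  constructor
  have := lint_exp (fun _ => 1) measurable_const
  simp only [lintegral_const, one_mul, mul_one] at this
  rw [this, lint_exp_Ioi]; simp

variable (p : ℝ) [hp : Fact (0 ≤ p ∧ p ≤ 1)]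

instance : IsProbabilityMeasure (bernoulliDist p) := by
  constructor
  unfold bernoulliDist
  simp
  rw [← ENNReal.ofReal_add hp.out.1 (by linarith [hp.out.2])]
  simp

instance : IsProbabilityMeasure (nu p) := by unfold nu; infer_instance

def PP (N : ℕ) (p : ℝ) : Measure (Cf N) := Measure.pi fun _ => nu p
def QQ (N : ℕ) (p : ℝ) : Measure (St N) := Measure.pi fun _ => nu p

instance (N : ℕ) : IsProbabilityMeasure (PP N p) := by unfold PP; infer_instance
instance (N : ℕ) : IsProbabilityMeasure (QQ N p) := by unfold QQ; infer_instance

def ew (b : Bool × ℝ) : ℝ≥0∞ := if b.1 = true then ofReal b.2 else ⊤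

lemma measurable_ew : Measurable ew := by
  unfold ew
  refine Measurable.ite ?_ measurable_snd.ennreal_ofReal measurable_const
  exact measurable_fst (MeasurableSet.singleton true)

lemma effWeight_eq {N : ℕ} (z : Cf N) (a b : Fin N) :
    effWeight z a b = if a = b then ⊤ else ew (z s(a,b)) := by
  unfold effWeight ew
  by_cases h : a = b <;> simp [h]

lemma measurable_effWeight {N : ℕ} (a b : Fin N) : Measurable fun z : Cf N => effWeight z a b := by
  simp only [effWeight_eq]
  split_ifs
  · exact measurable_const
  · exact measurable_ew.comp (measurable_pi_apply _)

lemma measurable_DD {N : ℕ} (o : Fin N) (k : ℕ) (v : Fin N) :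
    Measurable fun z : Cf N => DD o (effWeight z) k v := by
  induction k generalizing v with
  | zero => simp only [DD]; exact measurable_const
  | succ k ih =>
    simp only [DD]
    exact Measurable.iInf fun v' => (ih v').add (measurable_effWeight v' v)

lemma measurable_TT {N : ℕ} (o v : Fin N) :
    Measurable fun z : Cf N => TT o (effWeight z) v := by
  unfold TT
  exact Measurable.iInf fun k => measurable_DD o k v

lemma measurable_sInf_nat {α : Type*} [MeasurableSpace α] (Q : ℕ → α → Prop)
    (hQ : ∀ k, MeasurableSet {z | Q k z}) : Measurable fun z => sInf {k | Q k z} := by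
  have key : ∀ z m, sInf {k | Q k z} = m ↔ (Q m z ∧ ∀ j < m, ¬ Q j z) ∨ (m = 0 ∧ ∀ j, ¬ Q j z) := by
    intro z m
    constructor
    · rintro rfl
      by_cases h : ∃ k, Q k z
      · left
        exact ⟨Nat.sInf_mem (s := {k | Q k z}) h, fun j hj => Nat.notMem_of_lt_sInf hj⟩
      · right
        push Not at h
        refine ⟨?_, h⟩
        simp [h]
    · rintro (⟨h1, h2⟩ | ⟨rfl, h⟩)
      · refine le_antisymm (Nat.sInf_le h1) ?_
        by_contra hc
        exact h2 _ (not_le.1 hc) (Nat.sInf_mem (s := {k | Q k z}) ⟨m, h1⟩)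
      · simp [h]
  refine measurable_to_countable' fun m => ?_
  have : (fun z => sInf {k | Q k z}) ⁻¹' {m} =
      ({z | Q m z} ∩ ⋂ j, ⋂ (_ : j < m), {z | Q j z}ᶜ) ∪ ({z | m = 0} ∩ ⋂ j, {z | Q j z}ᶜ) := by
    ext z
    have := key z m
    simpa using this
  rw [this]
  refine ((hQ m).inter (MeasurableSet.iInter fun j => MeasurableSet.iInter fun _ => (hQ j).compl)).union
    ((MeasurableSet.const _).inter (MeasurableSet.iInter fun j => (hQ j).compl))

lemma measurable_hop {N : ℕ} (o v : Fin N) :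
    Measurable fun z : Cf N => hop o (effWeight z) v :=
  measurable_sInf_nat _ fun k => measurableSet_eq_fun (measurable_DD o k v) (measurable_TT o v)

def mask {N : ℕ} (J : Set (Sym2 (Fin N))) [DecidablePred (· ∈ J)] (z : Cf N) : Cf N :=
  fun e => if e ∈ J then z e else (false, 0)

lemma measurable_mask {N : ℕ} (J : Set (Sym2 (Fin N))) [DecidablePred (· ∈ J)] :
    Measurable (mask J) := by
  refine measurable_pi_lambda _ fun e => ?_
  unfold mask
  split_ifs
  · exact measurable_pi_apply e
  · exact measurable_const

lemma iIndep_coord (N : ℕ) : iIndepFun (fun (e : Sym2 (Fin N)) (z : Cf N) => z e) (PP N p) :=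
  iIndepFun_pi (μ := fun _ => nu p) (X := fun _ b => b) (fun _ => aemeasurable_id)

lemma map_coord (N : ℕ) (e : Sym2 (Fin N)) : (PP N p).map (fun z => z e) = nu p :=
  (measurePreserving_eval (fun _ : Sym2 (Fin N) => nu p) e).map_eq

def cavz {N : ℕ} (u : Fin N) (z : Cf N) : Cf N := mask {e | u ∉ e} z
def star {N : ℕ} (u : Fin N) (z : Cf N) : St N := fun v => z s(v, u)

lemma measurable_cavz {N : ℕ} (u : Fin N) : Measurable (cavz u) := measurable_mask _
lemma measurable_star {N : ℕ} (u : Fin N) : Measurable (star u) :=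
  measurable_pi_lambda _ fun _ => measurable_pi_apply _

lemma eff_cavz {N : ℕ} (u : Fin N) (z : Cf N) : effWeight (cavz u z) = cv u (effWeight z) := by
  funext a b
  simp only [effWeight_eq, wr, cavz, mask, Set.mem_ofPred_eq, Sym2.mem_iff, ew]
  simp only [Finset.mem_erase, Finset.mem_univ, and_true, ne_eq, not_or, eq_comm (a := u)]
  by_cases h1 : a = b <;> by_cases h2 : a = u <;> by_cases h3 : b = u <;> simp [h1, h2, h3]

lemma eff_mask {N : ℕ} (A : Finset (Fin N)) (z : Cf N) :
    effWeight (mask {e | ∀ v ∈ e, v ∈ A} z) = wr A (effWeight z) := by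
  funext a b
  simp only [effWeight_eq, wr, mask, Set.mem_ofPred_eq, Sym2.mem_iff, ew]
  by_cases h1 : a = b <;> by_cases h2 : a ∈ A <;> by_cases h3 : b ∈ A <;> simp_all

lemma indep_gen {N : ℕ} {β γ : Type*} [MeasurableSpace β] [MeasurableSpace γ]
    (J K : Finset (Sym2 (Fin N))) (hJK : Disjoint J K)
    (f : Cf N → β) (g : Cf N → γ) (f' : (J → Bool × ℝ) → β) (g' : (K → Bool × ℝ) → γ)
    (hf' : Measurable f') (hg' : Measurable g')
    (hf : ∀ z, f z = f' (fun e => z e)) (hg : ∀ z, g z = g' (fun e => z e)) :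
    IndepFun f g (PP N p) := by
  have := ((iIndep_coord p N).indepFun_finset J K hJK (fun e => measurable_pi_apply e)).comp hf' hg'
  have e1 : f = f' ∘ (fun z (e : J) => z e) := funext hf
  have e2 : g = g' ∘ (fun z (e : K) => z e) := funext hg
  rw [e1, e2]; exact this

def unm {N : ℕ} (J : Finset (Sym2 (Fin N))) (x : J → Bool × ℝ) : Cf N :=
  fun e => if h : e ∈ J then x ⟨e, h⟩ else (false, 0)

lemma measurable_unm {N : ℕ} (J : Finset (Sym2 (Fin N))) : Measurable (unm J) := by
  refine measurable_pi_lambda _ fun e => ?_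
  unfold unm
  split_ifs
  · exact measurable_pi_apply _
  · exact measurable_const

lemma mask_unm {N : ℕ} (J : Set (Sym2 (Fin N))) [DecidablePred (· ∈ J)] (z : Cf N) :
    mask J z = unm (Finset.univ.filter (· ∈ J)) (fun e => z e) := by
  funext e
  by_cases h : e ∈ J <;> simp [mask, unm, h]

lemma indep_mask {N : ℕ} (J K : Set (Sym2 (Fin N))) [DecidablePred (· ∈ J)] [DecidablePred (· ∈ K)]
    (h : Disjoint J K) : IndepFun (mask J) (mask K) (PP N p) := by
  refine indep_gen p (Finset.univ.filter (· ∈ J)) (Finset.univ.filter (· ∈ K)) ?_ _ _ _ _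
    (measurable_unm _) (measurable_unm _) (mask_unm J) (mask_unm K)
  rw [Finset.disjoint_left]
  intro e he he'
  exact Set.disjoint_left.1 h (by simpa using he) (by simpa using he')

lemma star_mask {N : ℕ} (u : Fin N) (z : Cf N) : star u z = star u (mask {e | u ∈ e} z) := by
  funext v
  simp [star, mask]

lemma indep_star {N : ℕ} (u : Fin N) : IndepFun (cavz u) (star u) (PP N p) := by
  have h := (indep_mask p {e : Sym2 (Fin N) | u ∉ e} {e | u ∈ e}
    (by rw [Set.disjoint_left]; intro e h1 h2; exact h1 h2)).comp measurable_id (measurable_star u)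
  have e1 : star u = star u ∘ mask {e | u ∈ e} := funext fun z => star_mask u z
  rw [e1]; exact h

lemma map_star {N : ℕ} (u : Fin N) : (PP N p).map (star u) = QQ N p := by
  have hinj : Function.Injective (fun v : Fin N => s(v, u)) := by
    intro a b h
    have h' : a = b ∨ a = u ∧ u = b := by simpa using h
    rcases h' with h' | ⟨h1, h2⟩
    · exact h'
    · exact h1.trans h2
  have h1 := (iIndep_coord p N).precomp hinj
  have h2 := (iIndepFun_iff_map_fun_eq_pi_map
    (fun v => (measurable_pi_apply (s(v,u))).aemeasurable)).1 h1
  have : star u = fun (z : Cf N) (v : Fin N) => z s(v,u) := rfl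
  rw [this]
  refine Eq.trans h2 ?_
  unfold QQ
  congr 1
  funext v
  exact map_coord p N _

lemma map_cav_star {N : ℕ} (u : Fin N) : (PP N p).map (fun z => (cavz u z, star u z)) =
    ((PP N p).map (cavz u)).prod (QQ N p) := by
  have := (indepFun_iff_map_prod_eq_prod_map_map (measurable_cavz u).aemeasurable
    (measurable_star u).aemeasurable).1 (indep_star p u)
  rw [this, map_star]

lemma lint_cav_star {N : ℕ} (u : Fin N) (Φ : Cf N → St N → ℝ≥0∞)
    (hΦ : Measurable (Function.uncurry Φ)) :
    ∫⁻ z, Φ (cavz u z) (star u z) ∂(PP N p) = ∫⁻ z, ∫⁻ y, Φ (cavz u z) y ∂(QQ N p) ∂(PP N p) := by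
  have h1 : ∫⁻ z, Φ (cavz u z) (star u z) ∂(PP N p) =
     ∫⁻ x, Function.uncurry Φ x ∂((PP N p).map (fun z => (cavz u z, star u z))) := by
    rw [lintegral_map hΦ ((measurable_cavz u).prodMk (measurable_star u))]; rfl
  rw [h1, map_cav_star, lintegral_prod _ hΦ.aemeasurable, lintegral_map _ (measurable_cavz u)]
  · rfl
  · exact hΦ.lintegral_prod_right'

lemma int_cav_star {N : ℕ} (u : Fin N) (Φ : Cf N → St N → ℂ)
    (hΦ : Measurable (Function.uncurry Φ)) (C : ℝ) (hC : ∀ z y, ‖Φ z y‖ ≤ C) :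
    ∫ z, Φ (cavz u z) (star u z) ∂(PP N p) = ∫ z, ∫ y, Φ (cavz u z) y ∂(QQ N p) ∂(PP N p) := by
  have h1 : ∫ z, Φ (cavz u z) (star u z) ∂(PP N p) =
     ∫ x, Function.uncurry Φ x ∂((PP N p).map (fun z => (cavz u z, star u z))) := by
    rw [integral_map ((measurable_cavz u).prodMk (measurable_star u)).aemeasurable
      hΦ.aestronglyMeasurable]; rfl
  haveI : IsProbabilityMeasure ((PP N p).map (cavz u)) :=
    Measure.isProbabilityMeasure_map (measurable_cavz u).aemeasurable
  rw [h1, map_cav_star, integral_prod, integral_map (measurable_cavz u).aemeasurable]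
  · rfl
  · exact (hΦ.stronglyMeasurable.integral_prod_right').aestronglyMeasurable
  · exact Integrable.of_bound hΦ.aestronglyMeasurable C (ae_of_all _ fun x => hC _ _)

def sv (p x : ℝ) : ℝ := if 0 ≤ x then 1 - p + p * exp (-x) else 1

lemma lint_nu (f : Bool × ℝ → ℝ≥0∞) (hf : Measurable f) :
    ∫⁻ b, f b ∂(nu p) = ofReal p * (∫⁻ x in Set.Ioi 0, ofReal (exp (-x)) * f (true, x))
      + ofReal (1 - p) * ∫⁻ x, f (false, x) ∂expDist := by
  unfold nu
  rw [lintegral_prod _ hf.aemeasurable]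
  unfold bernoulliDist
  rw [lintegral_add_measure, lintegral_smul_measure, lintegral_smul_measure, lintegral_dirac, lintegral_dirac,
   lint_exp _ (by fun_prop)]
  simp

end FPP

namespace FPP

lemma map_upd {ι β : Type*} [Fintype ι] [DecidableEq ι] [MeasurableSpace β] (ν : Measure β)
    [IsProbabilityMeasure ν] (v : ι) :
    ((Measure.pi fun _ : ι => ν).prod ν).map (fun x => Function.update x.1 v x.2) = Measure.pi fun _ : ι => ν := by
  symm
  have hm : Measurable (fun x : (ι → β) × β => Function.update x.1 v x.2) := by
    refine measurable_pi_lambda _ fun i => ?_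
    by_cases h : i = v
    · subst h; simpa using measurable_snd
    · simp only [ne_eq, h, not_false_eq_true, Function.update_of_ne]
      exact (measurable_pi_apply i).comp measurable_fst
  apply Measure.pi_eq
  intro s hs
  rw [Measure.map_apply hm (MeasurableSet.univ_pi hs)]
  have : (fun x : (ι → β) × β => Function.update x.1 v x.2) ⁻¹' (Set.univ.pi s) =
      (Set.univ.pi (Function.update s v Set.univ)) ×ˢ s v := by
    ext x
    simp only [Set.mem_preimage, Set.mem_pi, Set.mem_univ, true_imp_iff, Set.mem_prod]
    constructor
    · intro h
      refine ⟨fun i => ?_, by simpa using h v⟩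
      by_cases hi : i = v
      · subst hi; simp
      · simpa [Function.update_of_ne hi] using h i
    · rintro ⟨h1, h2⟩ i
      by_cases hi : i = v
      · subst hi; simpa using h2
      · simpa [Function.update_of_ne hi] using h1 i
  rw [this, Measure.prod_prod, Measure.pi_pi, ← Finset.mul_prod_erase _ _ (Finset.mem_univ v),
    ← Finset.mul_prod_erase (a := v) _ _ (Finset.mem_univ v)]
  simp only [Function.update_self, measure_univ, one_mul]
  rw [mul_comm]
  congr 1
  apply Finset.prod_congr rfl
  intro i hi
  rw [Function.update_of_ne (Finset.ne_of_mem_erase hi)]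

lemma measurable_upd {ι β : Type*} [DecidableEq ι] [MeasurableSpace β] (v : ι) :
    Measurable (fun x : (ι → β) × β => Function.update x.1 v x.2) := by
  refine measurable_pi_lambda _ fun i => ?_
  by_cases h : i = v
  · subst h; simpa using measurable_snd
  · simp only [ne_eq, h, not_false_eq_true, Function.update_of_ne]
    exact (measurable_pi_apply i).comp measurable_fst

lemma lint_upd {ι β : Type*} [Fintype ι] [DecidableEq ι] [MeasurableSpace β] (ν : Measure β)
    [IsProbabilityMeasure ν] (v : ι) (f : (ι → β) → ℝ≥0∞) (hf : Measurable f) :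
    ∫⁻ y, f y ∂(Measure.pi fun _ : ι => ν) =
      ∫⁻ b, ∫⁻ y, f (Function.update y v b) ∂(Measure.pi fun _ : ι => ν) ∂ν := by
  conv_lhs => rw [← map_upd ν v]
  rw [lintegral_map hf (measurable_upd v), lintegral_prod_symm]
  exact (hf.comp (measurable_upd v)).aemeasurable

lemma lint_upd' {ι β : Type*} [Fintype ι] [DecidableEq ι] [MeasurableSpace β] (ν : Measure β)
    [IsProbabilityMeasure ν] (v : ι) (f : (ι → β) → ℝ≥0∞) (hf : Measurable f) :
    ∫⁻ y, f y ∂(Measure.pi fun _ : ι => ν) =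
      ∫⁻ y, ∫⁻ b, f (Function.update y v b) ∂ν ∂(Measure.pi fun _ : ι => ν) := by
  conv_lhs => rw [← map_upd ν v]
  rw [lintegral_map hf (measurable_upd v), lintegral_prod]
  exact (hf.comp (measurable_upd v)).aemeasurable

variable (p : ℝ) [hp : Fact (0 ≤ p ∧ p ≤ 1)]

lemma nu_atom (a Y : ℝ≥0∞) (hY : Y ≠ ⊤) : nu p {b | a + ew b = Y} = 0 := by
  have hm : MeasurableSet {b | a + ew b = Y} :=
    measurableSet_eq_fun (measurable_const.add measurable_ew) measurable_const
  rw [← lintegral_indicator_one hm, lint_nu p _ (measurable_one.indicator hm)]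
  have h2 : ∀ x : ℝ, ({b : Bool × ℝ | a + ew b = Y}.indicator 1 (false, x) : ℝ≥0∞) = 0 := by
    intro x
    apply Set.indicator_of_notMem
    simp [ew, hY.symm]
  simp only [h2, lintegral_zero, mul_zero, add_zero]
  rw [mul_eq_zero]; right
  rw [lintegral_eq_zero_iff]
  · rw [EventuallyEq, ae_restrict_iff' measurableSet_Ioi]
    have : ∀ᵐ x : ℝ, x ≠ (Y - a).toReal := by simp [ae_iff]
    filter_upwards [this] with x hx hx0
    simp only [Pi.zero_apply, mul_eq_zero]
    right
    apply Set.indicator_of_notMem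
    simp only [Set.mem_ofPred_eq, ew, if_true]
    rintro rfl
    apply hx
    have ha : a ≠ ⊤ := fun hc => hY (by simp [hc])
    rw [ENNReal.add_sub_cancel_left ha, ENNReal.toReal_ofReal (le_of_lt hx0)]
  · exact ((Real.measurable_exp.comp measurable_neg).ennreal_ofReal).mul
      ((measurable_one.indicator hm).comp (by fun_prop))

def ga (c : ℝ≥0∞) (t : ℝ) : ℝ≥0∞ := nu p {b | ofReal t ≤ c + ew b}

lemma ga_le (c : ℝ≥0∞) (t : ℝ) : ga p c t ≤ 1 := prob_le_one

lemma exp_one_minus (x : ℝ) (hx : 0 ≤ x) : p * exp (-x) + (1 - p) = sv p x := by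
  simp [sv, hx]; ring

lemma ga_eq {c : ℝ≥0∞} {t : ℝ} (h : c < ofReal t) :
    ga p c t = ofReal (sv p (t - c.toReal)) := by
  have hm : MeasurableSet {b | ofReal t ≤ c + ew b} :=
    measurableSet_le measurable_const (measurable_const.add measurable_ew)
  have hc : c ≠ ⊤ := h.ne_top
  have ht : 0 < t := ENNReal.ofReal_pos.1 (lt_of_le_of_lt (zero_le) h)
  have hct : c.toReal < t := (ENNReal.lt_ofReal_iff_toReal_lt hc).1 h
  unfold ga
  rw [← lintegral_indicator_one hm, lint_nu p _ (measurable_one.indicator hm)]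
  have h2 : ∀ x : ℝ, ({b : Bool × ℝ | ofReal t ≤ c + ew b}.indicator 1 (false, x) : ℝ≥0∞) = 1 := by
    intro x
    apply Set.indicator_of_mem
    simp [ew]
  have h3 : ∫⁻ x in Set.Ioi 0, ofReal (exp (-x)) *
      ({b : Bool × ℝ | ofReal t ≤ c + ew b}.indicator 1 (true, x) : ℝ≥0∞) =
      ∫⁻ x in Set.Ioi (t - c.toReal), ofReal (exp (-x)) := by
    rw [← lintegral_indicator measurableSet_Ioi, ← lintegral_indicator measurableSet_Ioi]
    apply lintegral_congr_ae
    have : ∀ᵐ x : ℝ, x ≠ t - c.toReal := by simp [ae_iff]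
    filter_upwards [this] with x hx
    by_cases hx1 : t - c.toReal < x
    · have hx0 : 0 < x := by linarith
      have : (true, x) ∈ {b : Bool × ℝ | ofReal t ≤ c + ew b} := by
        simp only [Set.mem_ofPred_eq, ew, if_true]
        rw [← ENNReal.ofReal_toReal hc, ← ENNReal.ofReal_add ENNReal.toReal_nonneg hx0.le]
        exact ENNReal.ofReal_le_ofReal (by linarith)
      simp [hx1, hx0, this]
    · have hx1' : x < t - c.toReal := lt_of_le_of_ne (not_lt.1 hx1) hx
      by_cases hx0 : 0 < x
      · have : (true, x) ∉ {b : Bool × ℝ | ofReal t ≤ c + ew b} := by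
          simp only [Set.mem_ofPred_eq, ew, if_true, not_le]
          rw [← ENNReal.ofReal_toReal hc, ← ENNReal.ofReal_add ENNReal.toReal_nonneg hx0.le]
          exact (ENNReal.ofReal_lt_ofReal_iff ht).2 (by linarith)
        simp [hx1, hx0, this]
      · simp [hx1, hx0]
  rw [h3, lint_exp_Ioi]
  simp only [h2, lintegral_const, measure_univ, mul_one]
  rw [← ENNReal.ofReal_mul hp.out.1, ← ENNReal.ofReal_add (mul_nonneg hp.out.1 (Real.exp_pos _).le)
    (by linarith [hp.out.2]), exp_one_minus _ _ (by linarith)]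

lemma sv_pos {x : ℝ} (hx : 0 ≤ x) : 0 < sv p x := by
  have := hp.out
  simp only [sv, hx, if_true]
  have h1 := Real.exp_pos (-x)
  have h2 : exp (-x) ≤ 1 := Real.exp_le_one_iff.2 (by linarith)
  nlinarith

lemma measurable_ga (c : ℝ≥0∞) : Measurable (ga p c) := by
  have hanti : Antitone (ga p c) := by
    intro s t hst
    exact measure_mono fun b hb => (ENNReal.ofReal_le_ofReal hst).trans hb
  exact hanti.measurable

lemma shift_lint (c : ℝ) (g : ℝ → ℝ≥0∞) :
    ∫⁻ x in Set.Ioi 0, g (c + x) = ∫⁻ t in Set.Ioi c, g t := by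
  rw [← lintegral_indicator measurableSet_Ioi, ← lintegral_indicator measurableSet_Ioi,
    ← lintegral_add_left_eq_self (Set.indicator (Set.Ioi c) g) c]
  congr 1
  funext x
  by_cases h : 0 < x <;> simp [Set.indicator, h]

end FPP

namespace FPP
variable (p : ℝ) [hp : Fact (0 ≤ p ∧ p ≤ 1)] {N : ℕ}

def mm (c : Fin N → ℝ≥0∞) (y : St N) : ℝ≥0∞ := ⨅ v, c v + ew (y v)

def EE (c : Fin N → ℝ≥0∞) (v : Fin N) : Set (St N) := {y | c v + ew (y v) = mm c y ∧ mm c y ≠ ⊤}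

def kk (c : Fin N → ℝ≥0∞) (v : Fin N) (t : ℝ) : ℝ≥0∞ :=
  if c v < ofReal t then ofReal (p * exp (-(t - (c v).toReal))) *
    ∏ v' ∈ Finset.univ.erase v, ga p (c v') t else 0

lemma measurable_mm (c : Fin N → ℝ≥0∞) : Measurable (mm c) :=
  Measurable.iInf fun v => measurable_const.add (measurable_ew.comp (measurable_pi_apply v))

lemma measurableSet_EE (c : Fin N → ℝ≥0∞) (v : Fin N) : MeasurableSet (EE c v) :=
  (measurableSet_eq_fun (measurable_const.add (measurable_ew.comp (measurable_pi_apply v)))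
    (measurable_mm c)).inter ((measurable_mm c) (measurableSet_singleton ⊤).compl)

lemma measurable_kk (c : Fin N → ℝ≥0∞) (v : Fin N) : Measurable (kk p c v) := by
  refine Measurable.ite ?_ ?_ measurable_const
  · exact measurableSet_lt measurable_const ENNReal.measurable_ofReal
  · refine Measurable.mul ?_ (Finset.measurable_prod _ fun v' _ => measurable_ga p (c v'))
    apply Measurable.ennreal_ofReal
    fun_prop

lemma QQ_box (A : Fin N → Set (Bool × ℝ)) (s : Finset (Fin N)) :
    QQ N p {y | ∀ v ∈ s, y v ∈ A v} = ∏ v ∈ s, nu p (A v) := by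
  have : {y : St N | ∀ v ∈ s, y v ∈ A v} = Set.univ.pi fun v => if v ∈ s then A v else Set.univ := by
    ext y
    simp only [Set.mem_ofPred_eq, Set.mem_pi, Set.mem_univ, true_imp_iff]
    refine forall_congr' fun v => ?_
    by_cases h : v ∈ s <;> simp [h]
  rw [this, QQ, Measure.pi_pi, ← Finset.prod_subset (Finset.subset_univ s)]
  · exact Finset.prod_congr rfl fun v hv => by simp [hv]
  · intro v _ hv; simp [hv]

lemma EE_upd (c : Fin N → ℝ≥0∞) (v : Fin N) (y : St N) (b) : Function.update y v b ∈ EE c v ↔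
    (c v + ew b ≠ ⊤ ∧ ∀ v' ∈ Finset.univ.erase v, c v + ew b ≤ c v' + ew (y v')) := by
  have h1 : c v + ew (Function.update y v b v) = mm c (Function.update y v b) ↔
      ∀ v' ∈ Finset.univ.erase v, c v + ew b ≤ c v' + ew (y v') := by
    simp only [Function.update_self]
    constructor
    · intro h v' hv'
      rw [h]
      refine (iInf_le _ v').trans ?_
      rw [Function.update_of_ne (Finset.ne_of_mem_erase hv')]
    · intro h
      apply le_antisymm
      · refine le_iInf fun v' => ?_
        by_cases hv : v' = v
        · subst hv; simp
        · rw [Function.update_of_ne hv]; exact h v' (by simp [hv])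
      · refine (iInf_le _ v).trans ?_
        simp
  constructor
  · rintro ⟨h2, h3⟩
    refine ⟨?_, h1.1 h2⟩
    rw [← h2] at h3; simpa using h3
  · rintro ⟨h2, h3⟩
    refine ⟨h1.2 h3, ?_⟩
    rw [← h1.2 h3]; simpa using h2

lemma SF (c : Fin N → ℝ≥0∞) (v : Fin N) (f : ℝ → ℝ≥0∞) (hf : Measurable f) :
    ∫⁻ y in EE c v, f (mm c y).toReal ∂(QQ N p) = ∫⁻ t, kk p c v t * f t := by
  by_cases hc : c v = ⊤
  · have h1 : EE c v = ∅ := by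
      ext y; simp only [EE, hc, top_add, Set.mem_ofPred_eq, Set.mem_empty_iff_false, iff_false]
      rintro ⟨h, h'⟩; exact h' h.symm
    simp [h1, kk, hc]
  have hF : Measurable ((EE c v).indicator (fun y => f (mm c y).toReal)) :=
    (hf.comp (measurable_mm c).ennreal_toReal).indicator (measurableSet_EE c v)
  rw [← lintegral_indicator (measurableSet_EE c v), QQ, lint_upd (nu p) v _ hF, ← QQ]
  have step : ∀ b, ∫⁻ y, (EE c v).indicator (fun y => f (mm c y).toReal) (Function.update y v b) ∂(QQ N p) =
      (if c v + ew b ≠ ⊤ then f (c v + ew b).toReal *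
        ∏ v' ∈ Finset.univ.erase v, ga p (c v') (c v + ew b).toReal else 0) := by
    intro b
    by_cases hb : c v + ew b = ⊤
    · simp only [hb, ne_eq, not_true_eq_false, if_false]
      have : ∀ y : St N, (EE c v).indicator (fun y => f (mm c y).toReal) (Function.update y v b) = 0 := by
        intro y
        apply Set.indicator_of_notMem
        rw [EE_upd]; tauto
      simp [this]
    · have h2 : ∀ y : St N, (EE c v).indicator (fun y => f (mm c y).toReal) (Function.update y v b) =
          f (c v + ew b).toReal * Set.indicator {y : St N | ∀ v' ∈ Finset.univ.erase v,
            y v' ∈ {b' | ofReal (c v + ew b).toReal ≤ c v' + ew b'}} 1 y := by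
        intro y
        by_cases hy : Function.update y v b ∈ EE c v
        · have h3 := hy.1
          rw [Function.update_self] at h3
          rw [Set.indicator_of_mem hy, Set.indicator_of_mem, ← h3]
          · simp
          · have := ((EE_upd c v y b).1 hy).2
            simpa [ENNReal.ofReal_toReal hb] using this
        · rw [Set.indicator_of_notMem hy, Set.indicator_of_notMem, mul_zero]
          intro h
          apply hy
          rw [EE_upd]
          refine ⟨hb, ?_⟩
          simpa [ENNReal.ofReal_toReal hb] using h
      have hms : MeasurableSet {y : St N | ∀ v' ∈ Finset.univ.erase v,
            y v' ∈ {b' | ofReal (c v + ew b).toReal ≤ c v' + ew b'}} := by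
        simp only [Set.ofPred_forall]
        refine MeasurableSet.iInter fun v' => MeasurableSet.iInter fun _ => ?_
        exact (measurable_pi_apply v') (measurableSet_le measurable_const (measurable_const.add measurable_ew))
      simp only [h2]
      rw [lintegral_const_mul _ (measurable_one.indicator hms), lintegral_indicator_one hms, QQ_box]
      simp only [ne_eq, hb, not_false_eq_true, if_true]
      rfl
  simp only [step]
  have hgm : Measurable fun x : ℝ≥0∞ => f x.toReal * ∏ v' ∈ Finset.univ.erase v, ga p (c v') x.toReal :=
    (hf.comp ENNReal.measurable_toReal).mul (Finset.measurable_prod _ fun v' _ =>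
      (measurable_ga p (c v')).comp ENNReal.measurable_toReal)
  have hce : Measurable fun b : Bool × ℝ => c v + ew b := measurable_const.add measurable_ew
  have hite : Measurable fun b : Bool × ℝ => if c v + ew b ≠ ⊤ then f (c v + ew b).toReal *
        ∏ v' ∈ Finset.univ.erase v, ga p (c v') (c v + ew b).toReal else 0 :=
    Measurable.ite (hce (measurableSet_singleton ⊤).compl) (hgm.comp hce) measurable_const
  rw [lint_nu p _ hite]
  have h0 : ∀ x : ℝ, c v + ew (false, x) = ⊤ := by intro x; simp [ew]
  simp only [h0, ne_eq, not_true_eq_false, if_false, lintegral_zero, mul_zero, add_zero]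
  have hkk : ∀ t, kk p c v t * f t = (Set.Ioi (c v).toReal).indicator
      (fun t => ofReal (p * exp (-(t - (c v).toReal))) *
    (∏ v' ∈ Finset.univ.erase v, ga p (c v') t) * f t) t := by
    intro t
    by_cases h : (c v).toReal < t
    · have : c v < ofReal t := (ENNReal.lt_ofReal_iff_toReal_lt hc).2 h
      simp [kk, h, this]
    · have : ¬ c v < ofReal t := fun h' => h ((ENNReal.lt_ofReal_iff_toReal_lt hc).1 h')
      simp [kk, h, this]
  simp only [hkk]
  rw [lintegral_indicator measurableSet_Ioi, ← shift_lint (c v).toReal, ← lintegral_const_mul']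
  · apply setLIntegral_congr_fun measurableSet_Ioi
    intro x hx
    have hx : 0 < x := hx
    have h3 : c v + ew (true, x) = ofReal ((c v).toReal + x) := by
      simp only [ew, if_true]
      rw [ENNReal.ofReal_add ENNReal.toReal_nonneg hx.le, ENNReal.ofReal_toReal hc]
    have h4 : (0:ℝ) ≤ (c v).toReal + x := add_nonneg ENNReal.toReal_nonneg hx.le
    simp only [h3, ENNReal.ofReal_ne_top, not_false_eq_true, if_true, ENNReal.toReal_ofReal h4,
      add_sub_cancel_left]
    rw [ENNReal.ofReal_mul hp.out.1]
    ring
  · exact ENNReal.ofReal_ne_top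

lemma EE_disj (c : Fin N → ℝ≥0∞) {v v' : Fin N} (h : v ≠ v') : QQ N p (EE c v ∩ EE c v') = 0 := by
  have hm := (measurableSet_EE c v).inter (measurableSet_EE c v')
  rw [← lintegral_indicator_one hm, QQ, lint_upd' (nu p) v _ (measurable_one.indicator hm)]
  have key : ∀ y : St N, ∫⁻ b, (EE c v ∩ EE c v').indicator (1 : St N → ℝ≥0∞) (Function.update y v b) ∂(nu p) = 0 := by
    intro y
    by_cases hY : c v' + ew (y v') = ⊤
    · have : ∀ b, (EE c v ∩ EE c v').indicator (1 : St N → ℝ≥0∞) (Function.update y v b) = 0 := by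
        intro b
        apply Set.indicator_of_notMem
        rintro ⟨_, h2, h3⟩
        rw [Function.update_of_ne h.symm] at h2
        exact h3 (h2 ▸ hY)
      simp [this]
    · refine le_antisymm ?_ zero_le
      have hms : MeasurableSet {b | c v + ew b = c v' + ew (y v')} :=
        measurableSet_eq_fun (measurable_const.add measurable_ew) measurable_const
      rw [← nu_atom p (c v) _ hY, ← lintegral_indicator_one hms]
      apply lintegral_mono
      intro b
      by_cases hb : Function.update y v b ∈ EE c v ∩ EE c v'
      · have h1 := hb.1.1
        have h2 := hb.2.1
        rw [Function.update_self] at h1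
        rw [Function.update_of_ne h.symm] at h2
        have : b ∈ {b | c v + ew b = c v' + ew (y v')} := h1.trans h2.symm
        simp [Set.indicator_of_mem this, Set.indicator_of_mem hb]
      · simp [Set.indicator_of_notMem hb]
  simp [key]

lemma mm_attain (c : Fin N → ℝ≥0∞) (y : St N) (h : mm c y ≠ ⊤) : ∃ v, y ∈ EE c v := by
  have : Nonempty (Fin N) := by
    by_contra hc
    rw [not_nonempty_iff] at hc
    exact h (by simp [mm])
  obtain ⟨v, hv⟩ := exists_min (fun v => c v + ew (y v))
  exact ⟨v, hv, h⟩

lemma mm_atom (c : Fin N → ℝ≥0∞) (Y : ℝ≥0∞) (hY : Y ≠ ⊤) : QQ N p {y | mm c y = Y} = 0 := by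
  have hsub : {y | mm c y = Y} ⊆ ⋃ v, {y : St N | y v ∈ {b | c v + ew b = Y}} := by
    intro y hy
    have hy : mm c y = Y := hy
    obtain ⟨v, hv⟩ := mm_attain c y (hy ▸ hY)
    exact Set.mem_iUnion.2 ⟨v, hv.1.trans hy⟩
  refine measure_mono_null hsub (measure_iUnion_null fun v => ?_)
  have := QQ_box p (fun v => {b | c v + ew b = Y}) {v}
  simp only [Finset.mem_singleton, forall_eq, Finset.prod_singleton] at this
  rw [this, nu_atom p _ _ hY]

end FPP

namespace FPP
variable (p : ℝ) [hp : Fact (0 ≤ p ∧ p ≤ 1)] {N : ℕ}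

lemma tv_lemma {ι : Type*} (s : Finset ι) (g γ : ι → ℝ) (γ0 δ : ℝ) (x : ι → ℂ) (hx : ∀ v ∈ s, ‖x v‖ ≤ 1)
    (hg : ∀ v ∈ s, 0 ≤ g v) (hγ : ∀ v ∈ s, |γ v - γ0| ≤ δ * γ v) :
    ‖∑ v ∈ s, ((g v * γ v : ℝ) : ℂ) * (x v - (∑ v ∈ s, x v * (g v : ℂ)) / ((∑ v ∈ s, g v : ℝ) : ℂ))‖
      ≤ 2 * δ * ∑ v ∈ s, g v * γ v := by
  by_cases hG : ∑ v ∈ s, g v = 0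
  · have h0 : ∀ v ∈ s, g v = 0 := (Finset.sum_eq_zero_iff_of_nonneg hg).1 hG
    rw [Finset.sum_eq_zero (fun v hv => by simp [h0 v hv]), Finset.sum_eq_zero (fun v hv => by simp [h0 v hv])]
    simp
  set A : ℂ := (∑ v ∈ s, x v * (g v : ℂ)) / ((∑ v ∈ s, g v : ℝ) : ℂ) with hA
  have hGpos : 0 < ∑ v ∈ s, g v := lt_of_le_of_ne (Finset.sum_nonneg hg) (Ne.symm hG)
  have hAn : ‖A‖ ≤ 1 := by
    rw [hA, norm_div, Complex.norm_real, Real.norm_of_nonneg hGpos.le, div_le_one hGpos]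
    refine (norm_sum_le _ _).trans (Finset.sum_le_sum fun v hv => ?_)
    rw [norm_mul, Complex.norm_real, Real.norm_of_nonneg (hg v hv)]
    exact mul_le_of_le_one_left (hg v hv) (hx v hv)
  have hz : ∑ v ∈ s, ((g v : ℝ) : ℂ) * (x v - A) = 0 := by
    simp only [mul_sub, Finset.sum_sub_distrib, ← Finset.sum_mul]
    rw [hA, Complex.ofReal_sum, mul_div_cancel₀]
    · rw [sub_eq_zero]; exact Finset.sum_congr rfl fun v _ => mul_comm _ _
    · exact_mod_cast hG
  have : ∑ v ∈ s, ((g v * γ v : ℝ) : ℂ) * (x v - A) =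
      ∑ v ∈ s, ((g v * (γ v - γ0) : ℝ) : ℂ) * (x v - A) := by
    have h2 : ∑ v ∈ s, ((g v * (γ v - γ0) : ℝ) : ℂ) * (x v - A) =
      ∑ v ∈ s, ((g v * γ v : ℝ) : ℂ) * (x v - A) - γ0 * ∑ v ∈ s, ((g v : ℝ) : ℂ) * (x v - A) := by
      rw [Finset.mul_sum, ← Finset.sum_sub_distrib]
      refine Finset.sum_congr rfl fun v _ => ?_
      push_cast; ring
    rw [h2, hz]; simp
  rw [this]
  refine (norm_sum_le _ _).trans ?_
  rw [Finset.mul_sum]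
  refine Finset.sum_le_sum fun v hv => ?_
  rw [norm_mul, Complex.norm_real, Real.norm_eq_abs, abs_mul, abs_of_nonneg (hg v hv)]
  have h1 : ‖x v - A‖ ≤ 2 := (norm_sub_le _ _).trans (by linarith [hx v hv])
  have h3 := hγ v hv
  have h4 := hg v hv
  have h5 : 0 ≤ g v * (δ * γ v) := mul_nonneg h4 ((abs_nonneg _).trans h3)
  calc g v * |γ v - γ0| * ‖x v - A‖ ≤ g v * (δ * γ v) * 2 := by gcongr
    _ = _ := by ring

def ac (c : Fin N → ℝ≥0∞) (t : ℝ) : Finset (Fin N) := Finset.univ.filter fun v => c v < ofReal t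

def aa (c : Fin N → ℝ≥0∞) (t : ℝ) : ℝ := ∑ v ∈ ac c t, exp (c v).toReal
def bb (c : Fin N → ℝ≥0∞) (x : Fin N → ℂ) (t : ℝ) : ℂ := ∑ v ∈ ac c t, x v * (exp (c v).toReal : ℝ)

lemma kk_ne_top (c : Fin N → ℝ≥0∞) (v : Fin N) (t : ℝ) : kk p c v t ≠ ⊤ := by
  unfold kk
  split_ifs
  · refine ENNReal.mul_ne_top ENNReal.ofReal_ne_top (ENNReal.prod_ne_top fun v' _ => ?_)
    exact ne_top_of_le_ne_top ENNReal.one_ne_top (ga_le p _ _)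
  · simp

lemma kk_toReal (c : Fin N → ℝ≥0∞) (v : Fin N) (t : ℝ) (h : v ∈ ac c t) :
    (kk p c v t).toReal = (∏ v', (ga p (c v') t).toReal) * (exp (c v).toReal *
      (p * exp (-t) / sv p (t - (c v).toReal))) := by
  have h' : c v < ofReal t := by simpa [ac] using h
  have hct : (c v).toReal < t := (ENNReal.lt_ofReal_iff_toReal_lt h'.ne_top).1 h'
  have hs := sv_pos p (x := t - (c v).toReal) (by linarith)
  rw [kk, if_pos h', ENNReal.toReal_mul, ENNReal.toReal_prod, ← Finset.mul_prod_erase _ _ (Finset.mem_univ v),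
    ga_eq p h', ENNReal.toReal_ofReal hs.le, ENNReal.toReal_ofReal (mul_nonneg hp.out.1 (Real.exp_pos _).le)]
  have : exp (-(t - (c v).toReal)) = exp (c v).toReal * exp (-t) := by
    rw [← Real.exp_add]; congr 1; ring
  rw [this]
  field_simp

lemma kk_zero (c : Fin N → ℝ≥0∞) (v : Fin N) (t : ℝ) (h : v ∉ ac c t) : kk p c v t = 0 := by
  have h' : ¬ c v < ofReal t := by simpa [ac] using h
  simp [kk, h']

lemma kk_sum_zero {M : Type*} [AddCommMonoid M] (c : Fin N → ℝ≥0∞) (t : ℝ) (f : Fin N → ℝ → M) (hf : ∀ v, f v 0 = 0) :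
    ∑ v, f v (kk p c v t).toReal = ∑ v ∈ ac c t, f v (kk p c v t).toReal := by
  symm
  apply Finset.sum_subset (Finset.subset_univ _)
  intro v _ hv
  rw [kk_zero p c v t hv]; simp [hf]

lemma kk_tv (c : Fin N → ℝ≥0∞) (x : Fin N → ℂ) (hx : ∀ v, ‖x v‖ ≤ 1) (τ t : ℝ) (ht : t ≤ τ) :
    ‖∑ v, ((kk p c v t).toReal : ℂ) * (x v - bb c x t / (aa c t : ℂ))‖ ≤
      2 * (p * τ) * ∑ v, (kk p c v t).toReal := by
  have hp' := hp.out
  rw [kk_sum_zero p c t (fun v k => (k : ℂ) * (x v - bb c x t / (aa c t : ℂ))) (by simp),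
    kk_sum_zero p c t (fun v k => k) (by simp)]
  set G := ∏ v', (ga p (c v') t).toReal with hG
  have hG0 : 0 ≤ G := Finset.prod_nonneg fun _ _ => ENNReal.toReal_nonneg
  have e1 : ∑ v ∈ ac c t, ((kk p c v t).toReal : ℂ) * (x v - bb c x t / (aa c t : ℂ)) =
      G * ∑ v ∈ ac c t, ((exp (c v).toReal *
      (p * exp (-t) / sv p (t - (c v).toReal)) : ℝ) : ℂ) * (x v - bb c x t / (aa c t : ℂ)) := by
    rw [Finset.mul_sum]
    refine Finset.sum_congr rfl fun v hv => ?_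
    rw [kk_toReal p c v t hv, ← hG, Complex.ofReal_mul]; ring
  have e2 : ∑ v ∈ ac c t, (kk p c v t).toReal = G * ∑ v ∈ ac c t, (exp (c v).toReal *
      (p * exp (-t) / sv p (t - (c v).toReal))) := by
    rw [Finset.mul_sum]
    refine Finset.sum_congr rfl fun v hv => ?_
    rw [kk_toReal p c v t hv]
  rw [e1, e2, norm_mul, Complex.norm_real, Real.norm_of_nonneg hG0]
  have := tv_lemma (ac c t) (fun v => exp (c v).toReal) (fun v => p * exp (-t) / sv p (t - (c v).toReal))
    (p * exp (-t)) (p * τ) x (fun v _ => hx v) (fun v _ => (Real.exp_pos _).le) ?_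
  · calc _ ≤ G * _ := mul_le_mul_of_nonneg_left this hG0
      _ = _ := by ring
  · intro v hv
    have h' : c v < ofReal t := by simpa [ac] using hv
    have hct : (c v).toReal < t := (ENNReal.lt_ofReal_iff_toReal_lt h'.ne_top).1 h'
    have hc0 : 0 ≤ (c v).toReal := ENNReal.toReal_nonneg
    set y := t - (c v).toReal with hy
    have hy0 : 0 ≤ y := by linarith
    have hs := sv_pos p hy0
    have hs1 : 1 - sv p y ≤ p * τ := by
      simp only [sv, hy0, if_true]
      have : 1 - y ≤ exp (-y) := by linarith [Real.add_one_le_exp (-y)]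
      nlinarith
    have hs2 : sv p y ≤ 1 := by
      simp only [sv, hy0, if_true]
      have : exp (-y) ≤ 1 := Real.exp_le_one_iff.2 (by linarith)
      nlinarith
    have hq : 0 ≤ p * exp (-t) / sv p y := div_nonneg (mul_nonneg hp'.1 (Real.exp_pos _).le) hs.le
    have e3 : p * exp (-t) / sv p y - p * exp (-t) = (p * exp (-t) / sv p y) * (1 - sv p y) := by
      field_simp
    rw [e3, abs_of_nonneg (mul_nonneg hq (by linarith)), mul_comm (p * τ)]
    exact mul_le_mul_of_nonneg_left hs1 hq

lemma map_EE (c : Fin N → ℝ≥0∞) (v : Fin N) :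
    ((QQ N p).restrict (EE c v)).map (fun y => (mm c y).toReal) = volume.withDensity (kk p c v) := by
  ext s hs
  rw [Measure.map_apply (measurable_mm c).ennreal_toReal hs, withDensity_apply _ hs]
  have := SF p c v (s.indicator 1) (measurable_one.indicator hs)
  have e1 : ∫⁻ y in EE c v, s.indicator (1 : ℝ → ℝ≥0∞) (mm c y).toReal ∂(QQ N p) =
     ∫⁻ y in EE c v, ((fun y => (mm c y).toReal) ⁻¹' s).indicator 1 y ∂(QQ N p) := rfl
  rw [e1, lintegral_indicator_one ((measurable_mm c).ennreal_toReal hs)] at this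
  rw [this, ← lintegral_indicator hs]
  congr 1; funext t
  by_cases h : t ∈ s <;> simp [h]

lemma SFb {E : Type*} [NormedAddCommGroup E] [NormedSpace ℝ E]
    (c : Fin N → ℝ≥0∞) (v : Fin N) (F : ℝ → E) (hF : StronglyMeasurable F) :
    ∫ y in EE c v, F (mm c y).toReal ∂(QQ N p) = ∫ t, (kk p c v t).toReal • F t := by
  rw [← integral_withDensity_eq_integral_toReal_smul (measurable_kk p c v)
    (ae_of_all _ fun t => (kk_ne_top p c v t).lt_top), ← map_EE, integral_map
    (measurable_mm c).ennreal_toReal.aemeasurable hF.aestronglyMeasurable]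

lemma kk_integrable {E : Type*} [NormedAddCommGroup E] [NormedSpace ℝ E]
    (c : Fin N → ℝ≥0∞) (v : Fin N) (F : ℝ → E) (hF : StronglyMeasurable F) (C : ℝ)
    (hC : ∀ t, ‖F t‖ ≤ C) : Integrable (fun t => (kk p c v t).toReal • F t) := by
  rw [← integrable_withDensity_iff_integrable_smul' (measurable_kk p c v)
    (ae_of_all _ fun t => (kk_ne_top p c v t).lt_top), ← map_EE]
  haveI : IsFiniteMeasure (((QQ N p).restrict (EE c v)).map (fun y => (mm c y).toReal)) := by infer_instance
  exact Integrable.of_bound hF.aestronglyMeasurable C (ae_of_all _ hC)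

lemma measurable_bb (c : Fin N → ℝ≥0∞) (x : Fin N → ℂ) : Measurable (bb c x) := by
  unfold bb ac
  simp only [Finset.sum_filter]
  refine Finset.measurable_sum _ fun v _ => Measurable.ite ?_ measurable_const measurable_const
  exact measurableSet_lt measurable_const ENNReal.measurable_ofReal

lemma measurable_aa (c : Fin N → ℝ≥0∞) : Measurable (aa c) := by
  unfold aa ac
  simp only [Finset.sum_filter]
  refine Finset.measurable_sum _ fun v _ => Measurable.ite ?_ measurable_const measurable_const
  exact measurableSet_lt measurable_const ENNReal.measurable_ofReal

lemma avg_norm (c : Fin N → ℝ≥0∞) (x : Fin N → ℂ) (hx : ∀ v, ‖x v‖ ≤ 1) (t : ℝ) :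
    ‖bb c x t / (aa c t : ℂ)‖ ≤ 1 := by
  have h0 : 0 ≤ aa c t := Finset.sum_nonneg fun _ _ => (Real.exp_pos _).le
  rw [norm_div, Complex.norm_real, Real.norm_of_nonneg h0]
  apply div_le_one_of_le₀ _ h0
  refine (norm_sum_le _ _).trans (Finset.sum_le_sum fun v hv => ?_)
  rw [norm_mul, Complex.norm_real, Real.norm_of_nonneg (Real.exp_pos _).le]
  exact mul_le_of_le_one_left (Real.exp_pos _).le (hx v)

lemma SI (c : Fin N → ℝ≥0∞) (x : Fin N → ℂ) (hx : ∀ v, ‖x v‖ ≤ 1) (τ : ℝ) (F : ℝ → ℂ) (hF : Measurable F)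
    (C : ℝ) (hC : ∀ t, ‖F t‖ ≤ C) (hτ : ∀ t, τ < t → F t = 0) :
    ‖∑ v, ∫ y in EE c v, (x v - bb c x (mm c y).toReal / (aa c (mm c y).toReal : ℂ)) * F (mm c y).toReal ∂(QQ N p)‖
     ≤ 2 * (p * τ) * ∑ v, ∫ y in EE c v, ‖F (mm c y).toReal‖ ∂(QQ N p) := by
  have hm : ∀ v, Measurable fun t => (x v - bb c x t / (aa c t : ℂ)) * F t := fun v =>
    (measurable_const.sub ((measurable_bb c x).div (Complex.measurable_ofReal.comp (measurable_aa c)))).mul hF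
  have hb : ∀ v t, ‖(x v - bb c x t / (aa c t : ℂ)) * F t‖ ≤ 2 * C := by
    intro v t
    rw [norm_mul]
    have h1 := avg_norm c x hx t
    have h2 : ‖x v - bb c x t / (aa c t : ℂ)‖ ≤ 2 := (norm_sub_le _ _).trans (by linarith [hx v])
    exact mul_le_mul h2 (hC t) (norm_nonneg _) (by norm_num)
  have e1 : ∀ v, ∫ y in EE c v, (x v - bb c x (mm c y).toReal / (aa c (mm c y).toReal : ℂ)) * F (mm c y).toReal ∂(QQ N p)
      = ∫ t, (kk p c v t).toReal • ((x v - bb c x t / (aa c t : ℂ)) * F t) := fun v =>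
    SFb p c v (fun t => (x v - bb c x t / (aa c t : ℂ)) * F t) (hm v).stronglyMeasurable
  have e2 : ∀ v, ∫ y in EE c v, ‖F (mm c y).toReal‖ ∂(QQ N p) = ∫ t, (kk p c v t).toReal • ‖F t‖ := fun v =>
    SFb p c v (fun t => ‖F t‖) hF.norm.stronglyMeasurable
  simp only [e1, e2]
  rw [← integral_finsetSum _ (fun v _ => kk_integrable p c v _ (hm v).stronglyMeasurable _ (hb v)),
    ← integral_finsetSum _ (fun v _ => kk_integrable p c v _ hF.norm.stronglyMeasurable C (by simpa using hC)),
    ← integral_const_mul]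
  apply norm_integral_le_of_norm_le
  · exact (integrable_finsetSum _ (fun v _ => kk_integrable p c v _ hF.norm.stronglyMeasurable C (by simpa using hC))).const_mul _
  · refine ae_of_all _ fun t => ?_
    by_cases ht : τ < t
    · simp [hτ t ht]
    · have := kk_tv p c x hx τ t (not_lt.1 ht)
      have e3 : ∑ v, (kk p c v t).toReal • ((x v - bb c x t / (aa c t : ℂ)) * F t) =
          (∑ v, ((kk p c v t).toReal : ℂ) * (x v - bb c x t / (aa c t : ℂ))) * F t := by
        rw [Finset.sum_mul]
        refine Finset.sum_congr rfl fun v _ => ?_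
        rw [Complex.real_smul]; ring
      rw [e3, norm_mul]
      simp only [smul_eq_mul]
      rw [← Finset.sum_mul, ← mul_assoc]
      exact mul_le_mul_of_nonneg_right this (norm_nonneg _)

end FPP

namespace FPP
variable (p : ℝ) [hp : Fact (0 ≤ p ∧ p ≤ 1)] {N : ℕ}

def tt (o : Fin N) (z : Cf N) (v : Fin N) : ℝ≥0∞ := TT o (effWeight z) v
def dd (o : Fin N) (z : Cf N) (v : Fin N) : ℕ := hop o (effWeight z) v
def Pos (z : Cf N) : Prop := ∀ e, 0 < (z e).2

lemma measurable_tt (o v : Fin N) : Measurable fun z => tt o z v := measurable_TT o v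
lemma measurable_dd (o v : Fin N) : Measurable fun z => dd o z v := measurable_hop o v

lemma ae_Pos : ∀ᵐ z ∂(PP N p), Pos z := by
  unfold Pos
  rw [ae_all_iff]
  intro e
  have h : ∀ᵐ b ∂(nu p), 0 < b.2 := by
    rw [ae_iff]
    have hm : MeasurableSet {b : Bool × ℝ | ¬ 0 < b.2} := (measurableSet_lt measurable_const measurable_snd).compl
    have hm2 : ∀ b : Bool, Measurable fun x : ℝ => ({b : Bool × ℝ | ¬0<b.2}.indicator 1 (b,x) : ℝ≥0∞) :=
      fun b => (measurable_one.indicator hm).comp (measurable_const.prodMk measurable_id)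
    rw [← lintegral_indicator_one hm, lint_nu p _ (measurable_one.indicator hm)]
    rw [lint_exp _ (hm2 false)]
    have : ∀ b, ∫⁻ x in Set.Ioi (0:ℝ), ofReal (exp (-x)) *
      ({b : Bool × ℝ | ¬ 0 < b.2}.indicator 1 (b, x) : ℝ≥0∞) = 0 := by
      intro b
      rw [setLIntegral_congr_fun (g := fun _ => 0) measurableSet_Ioi]
      · simp
      · intro x hx
        have hx : 0 < x := hx
        simp [hx]
    rw [this true, this false]; simp
  rw [← map_coord p N e] at h
  exact ae_of_ae_map (measurable_pi_apply e).aemeasurable h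

lemma Pos.eff {z : Cf N} (h : Pos z) (a b : Fin N) : 0 < effWeight z a b := by
  unfold effWeight
  split_ifs
  · exact ENNReal.ofReal_pos.2 (h _)
  · simp

lemma tt_cavz (o u : Fin N) (z : Cf N) (v) : tt o (cavz u z) v = TT o (cv u (effWeight z)) v := by
  unfold tt; rw [eff_cavz]

lemma tt_cavz_u {o u : Fin N} (hu : u ≠ o) (z : Cf N) : tt o (cavz u z) u = ⊤ := by
  rw [tt_cavz]; exact cv_root o u _ hu

lemma tt_le_cavz (o u : Fin N) (z : Cf N) (v) : tt o z v ≤ tt o (cavz u z) v := by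
  rw [tt_cavz]; exact TT_le_wr _ _ _ _

lemma tt_eq_mm {o u : Fin N} (hu : u ≠ o) {z : Cf N} (hz : Pos z) :
    tt o z u = mm (tt o (cavz u z)) (star u z) := by
  unfold mm
  have := cv_inf o (effWeight z) hz.eff hu
  unfold tt
  rw [this]
  refine iInf_congr fun v => ?_
  rw [eff_cavz]
  by_cases h : v = u
  · subst h; rw [cv_root o v _ hu]; simp
  · rw [effWeight_eq, if_neg h]; rfl

lemma tt_cav_eq {o u v : Fin N} {z : Cf N} (hz : Pos z) (h : tt o z v < tt o z u) :
    tt o (cavz u z) v = tt o z v := by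
  rw [tt_cavz]
  have hvu : v ≠ u := by rintro rfl; exact lt_irrefl _ h
  exact cv_eq o _ hz.eff hvu h.le

lemma tt_cav_eq' {o u v : Fin N} {z : Cf N} (hz : Pos z) (hvu : v ≠ u) (h : tt o z v ≤ tt o z u) :
    tt o (cavz u z) v = tt o z v := by
  rw [tt_cavz]
  exact cv_eq o _ hz.eff hvu h

lemma tt_cav_lt {o u v : Fin N} {z : Cf N} (hu : u ≠ o) (hz : Pos z) :
    tt o (cavz u z) v < tt o z u ↔ tt o z v < tt o z u := by
  rw [tt_cavz]; exact cv_lt_iff o _ hz.eff hu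

lemma dd_cav {o u v : Fin N} {z : Cf N} (hz : Pos z) (h : tt o z v < tt o z u) :
    dd o (cavz u z) v = dd o z v := by
  unfold dd; rw [eff_cavz]; exact cv_hop o _ hz.eff h

lemma tt_pos {o u : Fin N} {z : Cf N} (hz : Pos z) (hu : u ≠ o) : 0 < tt o z u := by
  by_contra hc
  have h0 : tt o z u = 0 := by simpa using hc
  obtain ⟨v, hv⟩ := TT_attain o (effWeight z) hu
  unfold tt at h0
  rw [h0, add_eq_zero] at hv
  exact (hz.eff v u).ne' hv.2

@[simp] lemma tt_o (o : Fin N) (z : Cf N) : tt o z o = 0 := TT_root _ _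
@[simp] lemma dd_o (o : Fin N) (z : Cf N) : dd o z o = 0 := hop_root _ _
lemma mEE (o v : Fin N) : MeasurableSet {x : Cf N × St N | x.2 ∈ EE (tt o x.1) v} := by
  have h1 : Measurable fun x : Cf N × St N => mm (tt o x.1) x.2 :=
    Measurable.iInf fun v => ((measurable_tt o v).comp measurable_fst).add
      (measurable_ew.comp ((measurable_pi_apply v).comp measurable_snd))
  exact (measurableSet_eq_fun (((measurable_tt o v).comp measurable_fst).add
      (measurable_ew.comp ((measurable_pi_apply v).comp measurable_snd))) h1).inter
    (h1 (measurableSet_singleton ⊤).compl)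

lemma measurable_mm2 (o : Fin N) : Measurable fun x : Cf N × St N => mm (tt o x.1) x.2 :=
    Measurable.iInf fun v => ((measurable_tt o v).comp measurable_fst).add
      (measurable_ew.comp ((measurable_pi_apply v).comp measurable_snd))

lemma null_cav (u : Fin N) (A : Set (Cf N × St N)) (hA : MeasurableSet A)
    (h : ∀ z, QQ N p {y | (z, y) ∈ A} = 0) : ∀ᵐ z ∂(PP N p), (cavz u z, star u z) ∉ A := by
  rw [ae_iff]
  have hm : MeasurableSet {z | ¬ (cavz u z, star u z) ∉ A} := by
    simp only [not_not]
    exact ((measurable_cavz u).prodMk (measurable_star u)) hA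
  rw [← lintegral_indicator_one hm]
  have := lint_cav_star p u (fun z y => A.indicator (1 : Cf N × St N → ℝ≥0∞) (z, y)) (measurable_one.indicator hA)
  have e1 : ∫⁻ z, {z | ¬ (cavz u z, star u z) ∉ A}.indicator 1 z ∂(PP N p) =
      ∫⁻ z, A.indicator (1 : Cf N × St N → ℝ≥0∞) (cavz u z, star u z) ∂(PP N p) := by
    congr 1; funext z
    by_cases hz : (cavz u z, star u z) ∈ A <;> simp [hz]
  rw [e1, this]
  have e2 : ∀ z, ∫⁻ y, A.indicator (1 : Cf N × St N → ℝ≥0∞) (z, y) ∂(QQ N p) = 0 := by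
    intro z
    have : ∫⁻ y, A.indicator (1 : Cf N × St N → ℝ≥0∞) (z, y) ∂(QQ N p) =
      ∫⁻ y, {y | (z, y) ∈ A}.indicator 1 y ∂(QQ N p) := rfl
    have h2 : MeasurableSet {y | (z, y) ∈ A} := measurable_prodMk_left hA
    rw [this, lintegral_indicator_one h2, h]
  simp [e2]

lemma ae_uniq (o u : Fin N) : ∀ᵐ z ∂(PP N p), ∀ v v', v ≠ v' →
    star u z ∈ EE (tt o (cavz u z)) v → star u z ∉ EE (tt o (cavz u z)) v' := by
  rw [ae_all_iff]; intro v
  rw [ae_all_iff]; intro v'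
  by_cases h : v = v'
  · simp [h]
  · have := null_cav p u ({x | x.2 ∈ EE (tt o x.1) v} ∩ {x | x.2 ∈ EE (tt o x.1) v'})
      ((mEE o v).inter (mEE o v')) (fun z => EE_disj p (tt o z) h)
    filter_upwards [this] with z hz _ h1 h2
    exact hz ⟨h1, h2⟩

lemma ae_inj (o : Fin N) : ∀ᵐ z ∂(PP N p), ∀ u v, u ≠ v → tt o z u = tt o z v → tt o z u = ⊤ := by
  rw [ae_all_iff]; intro u
  rw [ae_all_iff]; intro v
  by_cases hu : u = o
  · subst hu
    filter_upwards [ae_Pos p] with z hz h1 h2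
    exfalso
    have := tt_pos hz (Ne.symm h1)
    rw [← h2, tt_o] at this
    exact lt_irrefl _ this
  · have := null_cav p u {x : Cf N × St N | mm (tt o x.1) x.2 = tt o x.1 v ∧ tt o x.1 v ≠ ⊤}
      ((measurableSet_eq_fun (measurable_mm2 o) ((measurable_tt o v).comp measurable_fst)).inter
        (((measurable_tt o v).comp measurable_fst) (measurableSet_singleton ⊤).compl)) (fun z => by
          by_cases h : tt o z v = ⊤
          · simp [h]
          · simpa [h] using mm_atom p (tt o z) _ h)
    filter_upwards [ae_Pos p, this] with z hz h1 huv h2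
    by_contra hc
    apply h1
    have h3 := tt_cav_eq' hz (Ne.symm huv) h2.ge
    refine ⟨?_, ?_⟩
    · show mm (tt o (cavz u z)) (star u z) = tt o (cavz u z) v
      rw [← tt_eq_mm hu hz, h3, h2]
    · show tt o (cavz u z) v ≠ ⊤
      rw [h3, ← h2]; exact hc

end FPP

namespace FPP
variable (p : ℝ) [hp : Fact (0 ≤ p ∧ p ≤ 1)] {N : ℕ}

lemma ae_parent {o u : Fin N} (hu : u ≠ o) : ∀ᵐ z ∂(PP N p), tt o z u ≠ ⊤ →
    ∃ v, (∀ v', star u z ∈ EE (tt o (cavz u z)) v' ↔ v' = v) ∧ dd o z u = dd o z v + 1 ∧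
      tt o z v < tt o z u := by
  filter_upwards [ae_Pos p, ae_uniq p o u] with z hz huq ht
  rw [tt_eq_mm hu hz] at ht
  obtain ⟨v, hv⟩ := mm_attain _ _ ht
  have hv1 : ∀ v', star u z ∈ EE (tt o (cavz u z)) v' ↔ v' = v := by
    intro v'
    constructor
    · intro h; by_contra hc; exact huq v' v hc h hv
    · rintro rfl; exact hv
  have hew : ∀ v', v' ≠ u → ew (star u z v') = effWeight z v' u := by
    intro v' h; rw [effWeight_eq, if_neg h]; rfl
  have hvu : v ≠ u := by
    rintro rfl
    have := hv.1
    rw [tt_cavz_u hu, top_add] at this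
    exact hv.2 this.symm
  have hlt : tt o z v < tt o z u := by
    rw [← tt_cav_lt hu hz, tt_eq_mm hu hz, ← hv.1, hew v hvu]
    refine ENNReal.lt_add_right ?_ (hz.eff v u).ne'
    intro h; apply hv.2; rw [← hv.1, h, top_add]
  refine ⟨v, hv1, ?_, hlt⟩
  unfold dd
  refine hop_succ o (effWeight z) hz.eff hu ?_ ?_ ?_
  · show tt o z u ≠ ⊤
    rw [tt_eq_mm hu hz]; exact ht
  · show tt o z v + _ = tt o z u
    rw [tt_eq_mm hu hz, ← hv.1, hew v hvu, tt_cav_eq hz hlt]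
  · intro v' h'
    have h'' : tt o z v' + effWeight z v' u = tt o z u := h'
    have htu : tt o z u ≠ ⊤ := by rw [tt_eq_mm hu hz]; exact ht
    have hvu' : v' ≠ u := by
      rintro rfl
      apply htu
      rw [← h'', effWeight_eq, if_pos rfl, add_top]
    have hlt' : tt o z v' < tt o z u := by
      rw [← h'']
      refine ENNReal.lt_add_right ?_ (hz.eff v' u).ne'
      intro h; apply htu; rw [← h'', h, top_add]
    rw [← hv1]
    refine ⟨?_, ht⟩
    rw [← tt_eq_mm hu hz, tt_cav_eq hz hlt', hew v' hvu', h'']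

def xi (ζ : ℂ) (o : Fin N) (z : Cf N) (v : Fin N) : ℂ := ζ ^ dd o z v

lemma xi_norm {ζ : ℂ} (hζ : ‖ζ‖ = 1) (o : Fin N) (z : Cf N) (v : Fin N) : ‖xi ζ o z v‖ ≤ 1 := by
  simp [xi, hζ]

lemma measurable_xi (ζ : ℂ) (o v : Fin N) : Measurable fun z => xi ζ o z v :=
  (measurable_from_nat (f := fun k => ζ ^ k)).comp (measurable_dd o v)

lemma measurable_aa2 {X : Type*} [MeasurableSpace X] (c : X → Fin N → ℝ≥0∞) (hc : ∀ v, Measurable fun x => c x v)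
    (t : X → ℝ) (ht : Measurable t) : Measurable fun x => aa (c x) (t x) := by
  unfold aa ac
  simp only [Finset.sum_filter]
  refine Finset.measurable_sum _ fun v _ => Measurable.ite ?_ ?_ measurable_const
  · exact measurableSet_lt (hc v) (ENNReal.measurable_ofReal.comp ht)
  · exact Real.measurable_exp.comp (hc v).ennreal_toReal

lemma measurable_bb2 {X : Type*} [MeasurableSpace X] (c : X → Fin N → ℝ≥0∞) (hc : ∀ v, Measurable fun x => c x v)
    (y : X → Fin N → ℂ) (hy : ∀ v, Measurable fun x => y x v)
    (t : X → ℝ) (ht : Measurable t) : Measurable fun x => bb (c x) (y x) (t x) := by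
  unfold bb ac
  simp only [Finset.sum_filter]
  refine Finset.measurable_sum _ fun v _ => Measurable.ite ?_ ?_ measurable_const
  · exact measurableSet_lt (hc v) (ENNReal.measurable_ofReal.comp ht)
  · exact (hy v).mul (Complex.measurable_ofReal.comp (Real.measurable_exp.comp (hc v).ennreal_toReal))

lemma ac_congr {c c' : Fin N → ℝ≥0∞} {t : ℝ} (h : ∀ v, c v < ofReal t ↔ c' v < ofReal t) :
    ac c t = ac c' t := by
  unfold ac; ext v; simp [h]

lemma ac_cav {o u : Fin N} (hu : u ≠ o) {z : Cf N} (hz : Pos z) (ht : tt o z u ≠ ⊤) :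
    ac (tt o (cavz u z)) (tt o z u).toReal = ac (tt o z) (tt o z u).toReal := by
  apply ac_congr
  intro v
  rw [ENNReal.ofReal_toReal ht, tt_cav_lt hu hz]

lemma mem_ac {c : Fin N → ℝ≥0∞} {t : ℝ} {v : Fin N} : v ∈ ac c t ↔ c v < ofReal t := by simp [ac]

lemma mem_ac_tt {o u v : Fin N} {z : Cf N} (ht : tt o z u ≠ ⊤) :
    v ∈ ac (tt o z) (tt o z u).toReal ↔ tt o z v < tt o z u := by
  rw [mem_ac, ENNReal.ofReal_toReal ht]

lemma aa_cav {o u : Fin N} (hu : u ≠ o) {z : Cf N} (hz : Pos z) (ht : tt o z u ≠ ⊤) :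
    aa (tt o (cavz u z)) (tt o z u).toReal = aa (tt o z) (tt o z u).toReal := by
  unfold aa
  rw [ac_cav hu hz ht]
  refine Finset.sum_congr rfl fun v hv => ?_
  rw [tt_cav_eq hz ((mem_ac_tt ht).1 hv)]

lemma bb_cav (ζ : ℂ) {o u : Fin N} (hu : u ≠ o) {z : Cf N} (hz : Pos z) (ht : tt o z u ≠ ⊤) :
    bb (tt o (cavz u z)) (xi ζ o (cavz u z)) (tt o z u).toReal = bb (tt o z) (xi ζ o z) (tt o z u).toReal := by
  unfold bb
  rw [ac_cav hu hz ht]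
  refine Finset.sum_congr rfl fun v hv => ?_
  rw [tt_cav_eq hz ((mem_ac_tt ht).1 hv), xi, dd_cav hz ((mem_ac_tt ht).1 hv), xi]

def inc (ζ : ℂ) (o u : Fin N) (z : Cf N) : ℂ :=
  xi ζ o z u - ζ * (bb (tt o z) (xi ζ o z) (tt o z u).toReal / (aa (tt o z) (tt o z u).toReal : ℂ))

lemma inc_norm {ζ : ℂ} (hζ : ‖ζ‖ = 1) (o u : Fin N) (z : Cf N) : ‖inc ζ o u z‖ ≤ 2 := by
  unfold inc
  refine (norm_sub_le _ _).trans ?_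
  rw [norm_mul, hζ, one_mul]
  linarith [xi_norm hζ o z u, avg_norm (tt o z) (xi ζ o z) (xi_norm hζ o z) (tt o z u).toReal]

lemma measurable_inc (ζ : ℂ) (o u : Fin N) : Measurable (inc ζ o u) := by
  unfold inc
  refine (measurable_xi ζ o u).sub (Measurable.const_mul (Measurable.div ?_ ?_) _)
  · exact measurable_bb2 _ (measurable_tt o) _ (measurable_xi ζ o) _ (measurable_tt o u).ennreal_toReal
  · exact Complex.measurable_ofReal.comp (measurable_aa2 _ (measurable_tt o) _ (measurable_tt o u).ennreal_toReal)

set_option maxHeartbeats 1000000 in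
lemma MI {ζ : ℂ} (hζ : ‖ζ‖ = 1) {o u : Fin N} (hu : u ≠ o) (τ : ℝ) (F : Cf N → ℝ → ℂ)
    (hF : Measurable (Function.uncurry F)) (C : ℝ) (hC : ∀ z t, ‖F z t‖ ≤ C)
    (hτ : ∀ z t, τ < t → F z t = 0) :
    ‖∫ z, (if tt o z u ≠ ⊤ then inc ζ o u z * F (cavz u z) (tt o z u).toReal else 0) ∂(PP N p)‖ ≤
      2 * (p * τ) * ∫ z, (if tt o z u ≠ ⊤ then ‖F (cavz u z) (tt o z u).toReal‖ else 0) ∂(PP N p) := by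
  obtain ⟨Ψ, hΨ⟩ : ∃ Ψ : Cf N → St N → ℂ, Ψ = fun z y => ∑ v, (EE (tt o z) v).indicator (fun y =>
    (xi ζ o z v - bb (tt o z) (xi ζ o z) (mm (tt o z) y).toReal / (aa (tt o z) (mm (tt o z) y).toReal : ℂ)) *
      F z (mm (tt o z) y).toReal) y := ⟨_, rfl⟩
  obtain ⟨Θ, hΘ⟩ : ∃ Θ : Cf N → St N → ℂ, Θ = fun z y => ∑ v, (EE (tt o z) v).indicator (fun y =>
      (‖F z (mm (tt o z) y).toReal‖ : ℂ)) y := ⟨_, rfl⟩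
  have hC0 : 0 ≤ C := (norm_nonneg _).trans (hC (fun _ => (true, 0)) 0)
  have hmt : Measurable fun x : Cf N × St N => (mm (tt o x.1) x.2).toReal := (measurable_mm2 o).ennreal_toReal
  have hmF : Measurable fun x : Cf N × St N => F x.1 (mm (tt o x.1) x.2).toReal :=
    hF.comp (measurable_fst.prodMk hmt)
  have hΨm : Measurable (Function.uncurry Ψ) := by
    rw [hΨ]
    refine Finset.measurable_sum _ fun v _ => ?_
    have : (fun x : Cf N × St N => (EE (tt o x.1) v).indicator (fun y =>
      (xi ζ o x.1 v - bb (tt o x.1) (xi ζ o x.1) (mm (tt o x.1) y).toReal / (aa (tt o x.1) (mm (tt o x.1) y).toReal : ℂ)) *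
      F x.1 (mm (tt o x.1) y).toReal) x.2) = {x : Cf N × St N | x.2 ∈ EE (tt o x.1) v}.indicator (fun x =>
      (xi ζ o x.1 v - bb (tt o x.1) (xi ζ o x.1) (mm (tt o x.1) x.2).toReal / (aa (tt o x.1) (mm (tt o x.1) x.2).toReal : ℂ)) *
      F x.1 (mm (tt o x.1) x.2).toReal) := rfl
    change Measurable (fun x : Cf N × St N => _)
    rw [this]
    refine (Measurable.indicator (Measurable.mul (Measurable.sub ?_ (Measurable.div ?_ ?_)) hmF) (mEE o v))
    · exact (measurable_xi ζ o v).comp measurable_fst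
    · exact measurable_bb2 _ (fun v => (measurable_tt o v).comp measurable_fst) _
        (fun v => (measurable_xi ζ o v).comp measurable_fst) _ hmt
    · exact Complex.measurable_ofReal.comp (measurable_aa2 _ (fun v => (measurable_tt o v).comp measurable_fst) _ hmt)
  have hΘm : Measurable (Function.uncurry Θ) := by
    rw [hΘ]
    refine Finset.measurable_sum _ fun v _ => ?_
    have : (fun x : Cf N × St N => (EE (tt o x.1) v).indicator (fun y =>
      (‖F x.1 (mm (tt o x.1) y).toReal‖ : ℂ)) x.2) = {x : Cf N × St N | x.2 ∈ EE (tt o x.1) v}.indicator (fun x =>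
      (‖F x.1 (mm (tt o x.1) x.2).toReal‖ : ℂ)) := rfl
    change Measurable (fun x : Cf N × St N => _)
    rw [this]
    exact (Measurable.indicator (Complex.measurable_ofReal.comp hmF.norm) (mEE o v))
  have hterm : ∀ z v t, ‖(xi ζ o z v - bb (tt o z) (xi ζ o z) t / (aa (tt o z) t : ℂ)) *
      F z t‖ ≤ 2 * C := by
    intro z v t
    rw [norm_mul]
    refine mul_le_mul ((norm_sub_le _ _).trans ?_) (hC _ _) (norm_nonneg _) (by norm_num)
    linarith [xi_norm hζ o z v, avg_norm (tt o z) (xi ζ o z) (xi_norm hζ o z) t]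
  have hΨb : ∀ z y, ‖Ψ z y‖ ≤ N * (2 * C) := by
    intro z y
    simp only [hΨ]
    refine (norm_sum_le _ _).trans ?_
    refine (Finset.sum_le_sum (g := fun _ => 2 * C) fun v _ => ?_).trans (by simp)
    by_cases hy : y ∈ EE (tt o z) v
    rw [Set.indicator_of_mem hy]
    rotate_left
    rw [Set.indicator_of_notMem hy]
    rotate_left
    · exact hterm z v _
    · simpa using hC0
  have hΘb : ∀ z y, ‖Θ z y‖ ≤ N * C := by
    intro z y
    simp only [hΘ]
    refine (norm_sum_le _ _).trans ?_
    refine (Finset.sum_le_sum (g := fun _ => C) fun v _ => ?_).trans (by simp)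
    by_cases hy : y ∈ EE (tt o z) v
    rw [Set.indicator_of_mem hy]
    rotate_left
    rw [Set.indicator_of_notMem hy]
    rotate_left
    · simpa using hC _ _
    · simpa using hC0
  have hins : ∀ z, ‖∫ y, Ψ z y ∂(QQ N p)‖ ≤ 2 * (p * τ) * (∫ y, Θ z y ∂(QQ N p)).re := by
    intro z
    have := SI p (tt o z) (xi ζ o z) (xi_norm hζ o z) τ (F z) (hF.comp measurable_prodMk_left) C (hC z) (hτ z)
    have hmm := (measurable_mm (tt o z)).ennreal_toReal
    have hFz : Measurable fun y => F z (mm (tt o z) y).toReal := hF.comp (measurable_const.prodMk hmm)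
    have e1 : ∫ y, Ψ z y ∂(QQ N p) = ∑ v, ∫ y in EE (tt o z) v, (xi ζ o z v - bb (tt o z) (xi ζ o z) (mm (tt o z) y).toReal
        / (aa (tt o z) (mm (tt o z) y).toReal : ℂ)) * F z (mm (tt o z) y).toReal ∂(QQ N p) := by
      rw [hΨ]
      simp only []
      rw [integral_finsetSum]
      · exact Finset.sum_congr rfl fun v _ => integral_indicator (measurableSet_EE _ v)
      · intro v _
        refine Integrable.indicator (Integrable.of_bound (Measurable.aestronglyMeasurable ?_) (2 * C) (ae_of_all _ fun y => hterm _ _ _)) (measurableSet_EE _ v)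
        exact (measurable_const.sub (((measurable_bb _ _).comp hmm).div (Complex.measurable_ofReal.comp ((measurable_aa _).comp hmm)))).mul hFz
    have e2 : ∫ y, Θ z y ∂(QQ N p) = ((∑ v, ∫ y in EE (tt o z) v, ‖F z (mm (tt o z) y).toReal‖ ∂(QQ N p) : ℝ) : ℂ) := by
      rw [hΘ]
      simp only []
      rw [integral_finsetSum]
      · rw [Complex.ofReal_sum]
        refine Finset.sum_congr rfl fun v _ => ?_
        rw [integral_indicator (measurableSet_EE _ v), integral_complex_ofReal]
      · intro v _
        exact Integrable.indicator (Integrable.of_bound (Complex.measurable_ofReal.comp hFz.norm).aestronglyMeasurable C (ae_of_all _ fun y => by simpa using hC _ _)) (measurableSet_EE _ v)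
    rw [e1, e2, Complex.ofReal_re]
    exact this
  have hL : ∫ z, (if tt o z u ≠ ⊤ then inc ζ o u z * F (cavz u z) (tt o z u).toReal else 0) ∂(PP N p) =
      ζ * ∫ z, Ψ (cavz u z) (star u z) ∂(PP N p) := by
    rw [← integral_const_mul]
    apply integral_congr_ae
    filter_upwards [ae_Pos p, ae_parent p hu] with z hz hpar
    by_cases ht : tt o z u = ⊤
    · simp only [ht, ne_eq, not_true_eq_false, if_false, hΨ]
      rw [Finset.sum_eq_zero, mul_zero]
      intro v _
      rw [Set.indicator_of_notMem]
      intro h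
      apply h.2
      rw [← tt_eq_mm hu hz, ht]
    · obtain ⟨v, h1, h2, h3⟩ := hpar ht
      simp only [ne_eq, ht, not_false_eq_true, if_true, hΨ]
      rw [Finset.sum_eq_single v]
      · rw [Set.indicator_of_mem ((h1 v).2 rfl), ← tt_eq_mm hu hz, aa_cav hu hz ht, bb_cav ζ hu hz ht, inc]
        simp only [xi]
        rw [h2, dd_cav hz h3, pow_succ]
        ring
      · intro v' _ h
        rw [Set.indicator_of_notMem]
        rw [h1]; exact h
      · simp
  have hR : ((∫ z, (if tt o z u ≠ ⊤ then ‖F (cavz u z) (tt o z u).toReal‖ else 0) ∂(PP N p) : ℝ) : ℂ) =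
      ∫ z, Θ (cavz u z) (star u z) ∂(PP N p) := by
    rw [← integral_complex_ofReal]
    apply integral_congr_ae
    filter_upwards [ae_Pos p, ae_parent p hu] with z hz hpar
    by_cases ht : tt o z u = ⊤
    · simp only [ht, ne_eq, not_true_eq_false, if_false, hΘ]
      rw [Finset.sum_eq_zero, Complex.ofReal_zero]
      intro v _
      rw [Set.indicator_of_notMem]
      intro h
      apply h.2
      rw [← tt_eq_mm hu hz, ht]
    · obtain ⟨v, h1, h2, h3⟩ := hpar ht
      simp only [ne_eq, ht, not_false_eq_true, if_true, hΘ]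
      rw [Finset.sum_eq_single v]
      · rw [Set.indicator_of_mem ((h1 v).2 rfl), ← tt_eq_mm hu hz]
      · intro v' _ h
        rw [Set.indicator_of_notMem]
        rw [h1]; exact h
      · simp
  rw [hL, norm_mul, hζ, one_mul, int_cav_star p u Ψ hΨm _ hΨb]
  have hI : Integrable (fun z => ∫ y, Θ (cavz u z) y ∂(QQ N p)) (PP N p) := by
    refine Integrable.of_bound (C := N * C) ?_ (ae_of_all _ fun z => ?_)
    · exact ((hΘm.stronglyMeasurable.integral_prod_right' (ν := QQ N p)).comp_measurable (measurable_cavz u)).aestronglyMeasurable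
    · refine (norm_integral_le_of_norm_le_const (ae_of_all _ fun y => hΘb _ _)).trans ?_
      simp
  have hR' : ∫ z, (if tt o z u ≠ ⊤ then ‖F (cavz u z) (tt o z u).toReal‖ else 0) ∂(PP N p) =
      ∫ z, (∫ y, Θ (cavz u z) y ∂(QQ N p)).re ∂(PP N p) := by
    have := congrArg Complex.re (hR.trans (int_cav_star p u Θ hΘm _ hΘb))
    rw [Complex.ofReal_re] at this
    rw [this]
    exact (integral_re (𝕜 := ℂ) hI).symm
  rw [hR', ← integral_const_mul]
  apply norm_integral_le_of_norm_le
  · exact Integrable.const_mul (Integrable.re (𝕜 := ℂ) hI) _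
  · exact ae_of_all _ fun z => hins _

end FPP

namespace FPP
variable (p : ℝ) [hp : Fact (0 ≤ p ∧ p ≤ 1)] {N : ℕ}

lemma sv_ge {x : ℝ} (hx : 0 ≤ x) : 1 - p * x ≤ sv p x := by
  have := hp.out
  rw [sv, if_pos hx]
  nlinarith [Real.add_one_le_exp (-x), mul_nonneg this.1 (by linarith [Real.add_one_le_exp (-x)] : 0 ≤ exp (-x) - (1 - x))]

lemma kk_sum_le (c : Fin N → ℝ≥0∞) (τ t E : ℝ) (ht : t ≤ τ) (hpτ : p * τ ≤ 1/2) (hE : aa c t ≤ E * exp t) :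
    ∑ v, kk p c v t ≤ ofReal (2 * p * E) := by
  have hp' := hp.out
  have e : ∑ v, kk p c v t = ofReal (∑ v, (kk p c v t).toReal) := by
    rw [ENNReal.ofReal_sum_of_nonneg (fun _ _ => ENNReal.toReal_nonneg)]
    exact Finset.sum_congr rfl fun v _ => (ENNReal.ofReal_toReal (kk_ne_top p c v t)).symm
  rw [e]
  apply ENNReal.ofReal_le_ofReal
  rw [kk_sum_zero p c t (fun v k => k) (by simp)]
  calc ∑ v ∈ ac c t, (kk p c v t).toReal ≤ ∑ v ∈ ac c t, exp (c v).toReal * (2 * p * exp (-t)) := by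
        refine Finset.sum_le_sum fun v hv => ?_
        rw [kk_toReal p c v t hv]
        have h' : c v < ofReal t := mem_ac.1 hv
        have hct : (c v).toReal < t := (ENNReal.lt_ofReal_iff_toReal_lt h'.ne_top).1 h'
        have h0 : 0 ≤ (c v).toReal := ENNReal.toReal_nonneg
        have hs : 1/2 ≤ sv p (t - (c v).toReal) := by
          refine le_trans ?_ (sv_ge p (by linarith))
          have : p * (t - (c v).toReal) ≤ p * τ := mul_le_mul_of_nonneg_left (by linarith) hp'.1
          linarith
        have hg : ∏ v', (ga p (c v') t).toReal ≤ 1 :=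
          Finset.prod_le_one (fun _ _ => ENNReal.toReal_nonneg) fun v' _ =>
            ENNReal.toReal_le_of_le_ofReal zero_le_one (by simpa using ga_le p _ _)
        have hb : p * exp (-t) / sv p (t - (c v).toReal) ≤ 2 * p * exp (-t) := by
          rw [div_le_iff₀ (by linarith)]
          nlinarith [mul_nonneg hp'.1 (Real.exp_pos (-t)).le]
        have hb0 : 0 ≤ p * exp (-t) / sv p (t - (c v).toReal) :=
          div_nonneg (mul_nonneg hp'.1 (Real.exp_pos (-t)).le) (by linarith)
        have h3 : 0 ≤ exp (c v).toReal * (p * exp (-t) / sv p (t - (c v).toReal)) :=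
          mul_nonneg (Real.exp_pos _).le hb0
        calc _ ≤ 1 * (exp (c v).toReal * (p * exp (-t) / sv p (t - (c v).toReal))) :=
              mul_le_mul_of_nonneg_right hg h3
          _ ≤ _ := by rw [one_mul]; exact mul_le_mul_of_nonneg_left hb (Real.exp_pos _).le
    _ = aa c t * (2 * p * exp (-t)) := by rw [aa, Finset.sum_mul]
    _ ≤ E * exp t * (2 * p * exp (-t)) := by
        refine mul_le_mul_of_nonneg_right hE (mul_nonneg (by linarith) (Real.exp_pos _).le)
    _ = 2 * p * E * (exp t * exp (-t)) := by ring
    _ = 2 * p * E := by rw [← Real.exp_add]; simp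

lemma SC {o u : Fin N} (hu : u ≠ o) (τ E : ℝ) (hτ : 0 ≤ τ) (hE0 : 0 ≤ E) (hpτ : p * τ ≤ 1/2) :
    PP N p {z | tt o z u ≠ ⊤ ∧ (tt o z u).toReal ≤ τ ∧
      aa (tt o z) (tt o z u).toReal ≤ E * exp (tt o z u).toReal} ≤ ofReal (2 * p * E * τ) := by
  have hp' := hp.out
  obtain ⟨g, hg⟩ : ∃ g : Cf N → ℝ → ℝ≥0∞, g = fun z t =>
    if (0 < t ∧ t ≤ τ) ∧ aa (tt o z) t ≤ E * exp t then 1 else 0 := ⟨_, rfl⟩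
  have hgm : Measurable (Function.uncurry g) := by
    rw [hg]
    refine Measurable.ite ?_ measurable_const measurable_const
    refine MeasurableSet.inter ?_ (measurableSet_le (measurable_aa2 _ (fun v => (measurable_tt o v).comp measurable_fst) _ measurable_snd) (by fun_prop))
    exact (measurableSet_lt measurable_const measurable_snd).inter (measurableSet_le measurable_snd measurable_const)
  obtain ⟨Φ, hΦ⟩ : ∃ Φ : Cf N → St N → ℝ≥0∞, Φ = fun z y => ∑ v, (EE (tt o z) v).indicator
    (fun y => g z (mm (tt o z) y).toReal) y := ⟨_, rfl⟩
  have hmt : Measurable fun x : Cf N × St N => (mm (tt o x.1) x.2).toReal := (measurable_mm2 o).ennreal_toReal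
  have hΦm : Measurable (Function.uncurry Φ) := by
    rw [hΦ]
    refine Finset.measurable_sum _ fun v _ => ?_
    have : (fun x : Cf N × St N => (EE (tt o x.1) v).indicator (fun y =>
      g x.1 (mm (tt o x.1) y).toReal) x.2) = {x : Cf N × St N | x.2 ∈ EE (tt o x.1) v}.indicator (fun x =>
      g x.1 (mm (tt o x.1) x.2).toReal) := rfl
    change Measurable (fun x : Cf N × St N => _)
    rw [this]
    exact (hgm.comp (measurable_fst.prodMk hmt)).indicator (mEE o v)
  have key := lint_cav_star p u Φ hΦm
  have hin : ∀ z, ∫⁻ y, Φ z y ∂(QQ N p) ≤ ofReal (2 * p * E * τ) := by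
    intro z
    have hgz : Measurable (g z) := hgm.comp measurable_prodMk_left
    rw [hΦ]
    simp only []
    rw [lintegral_finsetSum]
    · calc _ = ∑ v, ∫⁻ t, kk p (tt o z) v t * g z t := by
            refine Finset.sum_congr rfl fun v _ => ?_
            rw [lintegral_indicator (measurableSet_EE _ v)]
            exact SF p (tt o z) v (g z) hgz
        _ = ∫⁻ t, ∑ v, kk p (tt o z) v t * g z t :=
            (lintegral_finsetSum _ fun v _ => (measurable_kk p _ v).mul hgz).symm
        _ ≤ ∫⁻ t, (Set.Ioc 0 τ).indicator (fun _ => ofReal (2 * p * E)) t := by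
            apply lintegral_mono
            intro t
            simp only []
            rw [← Finset.sum_mul, hg]
            simp only []
            split_ifs with h
            · rw [Set.indicator_of_mem (show t ∈ Set.Ioc 0 τ from h.1), mul_one]
              exact kk_sum_le p _ τ t E h.1.2 hpτ h.2
            · simp
        _ = _ := by
            rw [lintegral_indicator measurableSet_Ioc, setLIntegral_const, Real.volume_Ioc, sub_zero,
              ← ENNReal.ofReal_mul (mul_nonneg (by linarith) hE0)]
    · intro v _
      exact (hgz.comp (measurable_mm _).ennreal_toReal).indicator (measurableSet_EE _ v)
  have hms : MeasurableSet {z | tt o z u ≠ ⊤ ∧ (tt o z u).toReal ≤ τ ∧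
      aa (tt o z) (tt o z u).toReal ≤ E * exp (tt o z u).toReal} := by
    refine (measurable_tt o u (measurableSet_singleton ⊤).compl).inter (MeasurableSet.inter ?_ ?_)
    · exact measurableSet_le (measurable_tt o u).ennreal_toReal measurable_const
    · exact measurableSet_le (measurable_aa2 _ (measurable_tt o) _ (measurable_tt o u).ennreal_toReal)
        ((Real.measurable_exp.comp (measurable_tt o u).ennreal_toReal).const_mul _)
  rw [← lintegral_indicator_one hms]
  calc _ ≤ ∫⁻ z, Φ (cavz u z) (star u z) ∂(PP N p) := by
        apply lintegral_mono_ae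
        filter_upwards [ae_Pos p, ae_parent p hu] with z hz hpar
        rw [Set.indicator_apply]
        split_ifs with h
        · obtain ⟨v, h1, -⟩ := hpar h.1
          rw [hΦ]
          simp only []
          refine le_trans ?_ (Finset.single_le_sum (fun _ _ => zero_le) (Finset.mem_univ v))
          rw [Set.indicator_of_mem ((h1 v).2 rfl), ← tt_eq_mm hu hz, hg]
          simp only []
          rw [aa_cav hu hz h.1, if_pos]
          · simp
          · exact ⟨⟨ENNReal.toReal_pos (tt_pos hz hu).ne' h.1, h.2.1⟩, h.2.2⟩
        · exact zero_le
    _ = _ := key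
    _ ≤ ∫⁻ z, ofReal (2 * p * E * τ) ∂(PP N p) := lintegral_mono fun z => hin _
    _ = _ := by simp

end FPP

namespace FPP
variable (p : ℝ) [hp : Fact (0 ≤ p ∧ p ≤ 1)] {N : ℕ}

def lx (s : ℝ) (x : ℝ≥0∞) : ℝ≥0∞ := if x = ⊤ then 0 else ofReal (exp (-(s * x.toReal)))

lemma measurable_lx (s : ℝ) : Measurable (lx s) := by
  unfold lx
  refine Measurable.ite (measurableSet_singleton _) measurable_const ?_
  exact ENNReal.measurable_ofReal.comp (Real.measurable_exp.comp (measurable_id.ennreal_toReal.const_mul s).neg)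

lemma lx_add (s : ℝ) (x y : ℝ≥0∞) : lx s (x + y) = lx s x * lx s y := by
  unfold lx
  by_cases hx : x = ⊤
  · simp [hx]
  by_cases hy : y = ⊤
  · simp [hy]
  rw [if_neg (by simp [hx, hy]), if_neg hx, if_neg hy, ← ENNReal.ofReal_mul (Real.exp_pos _).le, ← Real.exp_add,
    ENNReal.toReal_add hx hy]
  congr 2; ring

lemma lx_iInf_le (s : ℝ) {V : Type} [Fintype V] [DecidableEq V] [Nonempty V] (f : V → ℝ≥0∞) :
    lx s (⨅ v, f v) ≤ ∑ v, lx s (f v) := by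
  obtain ⟨v, hv⟩ := exists_min f
  rw [← hv]
  exact Finset.single_le_sum (f := fun v => lx s (f v)) (fun _ _ => zero_le) (Finset.mem_univ v)

lemma lint_lx_ew (s : ℝ) (hs : 0 ≤ s) : ∫⁻ b, lx s (ew b) ∂(nu p) = ofReal (p / (1 + s)) := by
  have hm : Measurable fun b => lx s (ew b) := (measurable_lx s).comp measurable_ew
  rw [lint_nu p _ hm]
  have h1 : ∀ x, lx s (ew (false, x)) = 0 := by intro x; simp [lx, ew]
  simp only [h1, lintegral_zero, mul_zero, add_zero]
  have h2 : ∫⁻ x in Set.Ioi (0:ℝ), ofReal (exp (-x)) * lx s (ew (true, x)) =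
     ∫⁻ x in Set.Ioi (0:ℝ), ofReal (exp (-(1+s) * x)) := by
    apply setLIntegral_congr_fun measurableSet_Ioi
    intro x hx
    have hx : 0 < x := hx
    simp only [lx, ew, if_true, ENNReal.ofReal_ne_top, if_false]
    rw [ENNReal.toReal_ofReal hx.le, ← ENNReal.ofReal_mul (Real.exp_pos _).le, ← Real.exp_add]
    congr 2; ring
  rw [h2, ← ofReal_integral_eq_lintegral_ofReal, integral_exp_mul_Ioi (by linarith), ← ENNReal.ofReal_mul hp.out.1]
  · congr 1
    have : 1 + s ≠ 0 := by linarith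
    rw [mul_zero, Real.exp_zero, neg_div_neg_eq]
    ring
  · exact integrableOn_exp_mul_Ioi (by linarith) 0
  · exact ae_of_all _ fun x => (Real.exp_pos _).le

lemma lap_A (s : ℝ) (hs : s = 2 * (N * p)) (o : Fin N) : ∀ (k : ℕ) (A : Finset (Fin N)), A.card = k → o ∈ A →
    ∀ u ∈ A, u ≠ o →
    ∫⁻ z, lx s (TT o (wr A (effWeight z)) u) ∂(PP N p) ≤ ofReal (2 * p / (1 + s)) := by
  have hp' := hp.out
  have hs0 : 0 ≤ s := by rw [hs]; have := mul_nonneg (Nat.cast_nonneg (α := ℝ) N) hp'.1; linarith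
  intro k
  induction k with
  | zero => intro A hA ho; simp at hA; simp [hA] at ho
  | succ k ih =>
    intro A hA hoA u huA hu
    have hcard : (A.erase u).card = k := by rw [Finset.card_erase_of_mem huA, hA]; rfl
    haveI : Nonempty (Fin N) := ⟨o⟩
    have hoA' : o ∈ A.erase u := Finset.mem_erase.2 ⟨Ne.symm hu, hoA⟩
    have hmA : ∀ v, Measurable fun z : Cf N => TT o (wr (A.erase u) (effWeight z)) v := by
      intro v
      have := (measurable_TT o v).comp (measurable_mask {e : Sym2 (Fin N) | ∀ v ∈ e, v ∈ A.erase u})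
      simpa only [Function.comp_def, eff_mask] using this
    have step1 : ∫⁻ z, lx s (TT o (wr A (effWeight z)) u) ∂(PP N p) ≤
        ∫⁻ z, ∑ v, lx s (TT o (wr (A.erase u) (effWeight (cavz u z))) v) * lx s (ew (star u z v)) ∂(PP N p) := by
      apply lintegral_mono_ae
      filter_upwards [ae_Pos p] with z hz
      rw [cav3 o (effWeight z) A hz.eff hu huA hoA]
      refine (lx_iInf_le s _).trans (Finset.sum_le_sum fun v _ => ?_)
      rw [lx_add]
      have e1 : wr (A.erase u) (effWeight (cavz u z)) = wr (A.erase u) (effWeight z) := by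
        rw [eff_cavz]
        funext a b
        simp only [wr, Finset.mem_erase, Finset.mem_univ, and_true]
        split_ifs with h1 h2
        · rfl
        · exact absurd ⟨h1.1.1, h1.2.1⟩ h2
        · rfl
      rw [e1]
      refine mul_le_mul_right ?_ _
      rw [effWeight_eq]
      split_ifs with h
      · simp [lx]
      · exact le_rfl
    refine step1.trans ?_
    have hΦ : Measurable (Function.uncurry fun (z : Cf N) (y : St N) =>
        ∑ v, lx s (TT o (wr (A.erase u) (effWeight z)) v) * lx s (ew (y v))) := by
      refine Finset.measurable_sum _ fun v _ => ?_
      exact (((measurable_lx s).comp (hmA v)).comp measurable_fst).mul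
        (((measurable_lx s).comp measurable_ew).comp ((measurable_pi_apply v).comp measurable_snd))
    rw [lint_cav_star p u (fun (z : Cf N) (y : St N) =>
        ∑ v, lx s (TT o (wr (A.erase u) (effWeight z)) v) * lx s (ew (y v))) hΦ]
    have hy : ∀ v : Fin N, ∫⁻ y, lx s (ew (y v)) ∂(QQ N p) = ofReal (p / (1 + s)) := by
      intro v
      rw [← lint_lx_ew p s hs0]
      exact (measurePreserving_eval (fun _ : Fin N => nu p) v).lintegral_comp ((measurable_lx s).comp measurable_ew)
    have e2 : ∀ z : Cf N, ∫⁻ y, ∑ v, lx s (TT o (wr (A.erase u) (effWeight (cavz u z))) v) * lx s (ew (y v)) ∂(QQ N p) =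
        ∑ v, lx s (TT o (wr (A.erase u) (effWeight z)) v) * ofReal (p / (1 + s)) := by
      intro z
      rw [lintegral_finsetSum]
      · refine Finset.sum_congr rfl fun v _ => ?_
        rw [lintegral_const_mul, hy]
        · have e1 : wr (A.erase u) (effWeight (cavz u z)) = wr (A.erase u) (effWeight z) := by
            rw [eff_cavz]
            funext a b
            simp only [wr, Finset.mem_erase, Finset.mem_univ, and_true]
            split_ifs with h1 h2
            · rfl
            · exact absurd ⟨h1.1.1, h1.2.1⟩ h2
            · rfl
          rw [e1]
        · exact ((measurable_lx s).comp measurable_ew).comp (measurable_pi_apply v)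
      · intro v _
        exact (((measurable_lx s).comp measurable_ew).comp (measurable_pi_apply v)).const_mul _
    simp only [e2]
    rw [lintegral_finsetSum]
    · have e3 : ∀ v, v ≠ o → ∫⁻ z, lx s (TT o (wr (A.erase u) (effWeight z)) v) * ofReal (p / (1 + s)) ∂(PP N p) ≤
          ofReal (2 * p / (1 + s) * (p / (1 + s))) := by
        intro v hv
        have hm : Measurable fun z => lx s (TT o (wr (A.erase u) (effWeight z)) v) := (measurable_lx s).comp (hmA v)
        rw [lintegral_mul_const _ hm, ENNReal.ofReal_mul (div_nonneg (by linarith) (by linarith))]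
        refine mul_le_mul_left ?_ _
        by_cases hvA : v ∈ A.erase u
        · exact ih _ hcard hoA' v hvA hv
        · simp [TT_wr_notMem o _ _ hvA hv, lx]
      have e4 : ∫⁻ z, lx s (TT o (wr (A.erase u) (effWeight z)) o) * ofReal (p / (1 + s)) ∂(PP N p) =
          ofReal (p / (1 + s)) := by
        simp [lx]
      rw [← Finset.add_sum_erase _ _ (Finset.mem_univ o), e4]
      refine (add_le_add_right (Finset.sum_le_sum (g := fun _ => ofReal (2 * p / (1 + s) * (p / (1 + s)))) fun v hv => e3 v (Finset.ne_of_mem_erase hv)) _).trans ?_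
      have hq : 0 ≤ p / (1 + s) := div_nonneg hp'.1 (by linarith)
      have hq2 : 0 ≤ 2 * p / (1 + s) := div_nonneg (by linarith) (by linarith)
      rw [Finset.sum_const, nsmul_eq_mul, ← ENNReal.ofReal_natCast, ← ENNReal.ofReal_mul (Nat.cast_nonneg _),
        ← ENNReal.ofReal_add hq (by positivity)]
      apply ENNReal.ofReal_le_ofReal
      have hc : ((Finset.univ.erase o).card : ℝ) ≤ N := by
        exact_mod_cast (Finset.card_le_univ _).trans (by simp)
      have h5 : (N : ℝ) * (2 * p / (1 + s)) ≤ 1 := by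
        rw [mul_div_assoc', div_le_one (by linarith)]; linarith
      have h6 : ((Finset.univ.erase o).card : ℝ) * (2 * p / (1 + s) * (p / (1 + s))) ≤ p / (1 + s) := by
        calc _ ≤ (N:ℝ) * (2 * p / (1 + s) * (p / (1 + s))) := mul_le_mul_of_nonneg_right hc (by positivity)
          _ = (N:ℝ) * (2 * p / (1 + s)) * (p / (1 + s)) := by ring
          _ ≤ 1 * (p / (1 + s)) := mul_le_mul_of_nonneg_right h5 hq
          _ = _ := one_mul _
      have : 2 * p / (1 + s) = p / (1 + s) + p / (1 + s) := by ring
      linarith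
    · intro v _
      exact ((measurable_lx s).comp (hmA v)).mul_const _

lemma lap (hN : 0 < N) {o u : Fin N} (hu : u ≠ o) (t : ℝ) :
    PP N p {z | tt o z u ≤ ofReal t} ≤ ofReal (exp (2 * (N * p) * t) / N) := by
  have hp' := hp.out
  have hNp : 0 ≤ (N : ℝ) * p := mul_nonneg (Nat.cast_nonneg _) hp'.1
  have h1 := lap_A p (2 * (N * p)) rfl o _ Finset.univ rfl (Finset.mem_univ _) u (Finset.mem_univ _) hu
  have hNr : (0:ℝ) < N := by exact_mod_cast hN
  by_cases ht : 0 ≤ t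
  · have hms : MeasurableSet {z | tt o z u ≤ ofReal t} := measurableSet_le (measurable_tt o u) measurable_const
    rw [← lintegral_indicator_one hms]
    calc _ ≤ ∫⁻ z, ofReal (exp (2 * (N * p) * t)) * lx (2 * (N * p)) (TT o (wr Finset.univ (effWeight z)) u) ∂(PP N p) := by
          apply lintegral_mono
          intro z
          simp only []
          rw [Set.indicator_apply]
          split_ifs with h
          · have h : tt o z u ≤ ofReal t := h
            have hT : tt o z u ≠ ⊤ := ne_top_of_le_ne_top ENNReal.ofReal_ne_top h
            have h2 : (tt o z u).toReal ≤ t := ENNReal.toReal_le_of_le_ofReal ht h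
            rw [wr_univ]
            change (1:ℝ≥0∞) ≤ _ * lx _ (tt o z u)
            rw [lx, if_neg hT, ← ENNReal.ofReal_mul (Real.exp_pos _).le, ← Real.exp_add, ENNReal.one_le_ofReal,
              Real.one_le_exp_iff]
            nlinarith
          · exact zero_le
      _ = ofReal (exp (2 * (N * p) * t)) * ∫⁻ z, lx (2 * (N * p)) (TT o (wr Finset.univ (effWeight z)) u) ∂(PP N p) := by
          refine lintegral_const_mul _ ?_
          simp only [wr_univ]
          exact (measurable_lx _).comp (measurable_tt o u)
      _ ≤ ofReal (exp (2 * (N * p) * t)) * ofReal (2 * p / (1 + 2 * (N * p))) :=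
          mul_le_mul_right h1 _
      _ ≤ _ := by
          rw [← ENNReal.ofReal_mul (Real.exp_pos _).le]
          apply ENNReal.ofReal_le_ofReal
          rw [div_eq_mul_inv (exp _)]
          refine mul_le_mul_of_nonneg_left ?_ (Real.exp_pos _).le
          rw [inv_eq_one_div, div_le_div_iff₀ (by linarith) hNr]
          linarith
  · have : PP N p {z | tt o z u ≤ ofReal t} = 0 := by
      have hae : ∀ᵐ z ∂(PP N p), ¬ (tt o z u ≤ ofReal t) := by
        filter_upwards [ae_Pos p] with z hz
        rw [ENNReal.ofReal_of_nonpos (by linarith)]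
        exact not_le.2 (tt_pos hz hu)
      simpa [ae_iff] using hae
    rw [this]; exact zero_le

end FPP

namespace FPP
variable (p : ℝ) [hp : Fact (0 ≤ p ∧ p ≤ 1)] {N : ℕ}

lemma wr_cavz (S : Finset (Fin N)) {u : Fin N} (hu : u ∉ S) (z : Cf N) :
    wr S (effWeight (cavz u z)) = wr S (effWeight z) := by
  rw [eff_cavz]
  funext a b
  simp only [wr, Finset.mem_erase, Finset.mem_univ, and_true]
  split_ifs with h1 h2
  · rfl
  · exact absurd ⟨fun h => hu (h ▸ h1.1), fun h => hu (h ▸ h1.2)⟩ h2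
  · rfl

lemma measurable_TTwr (o : Fin N) (S : Finset (Fin N)) (v : Fin N) :
    Measurable fun z : Cf N => TT o (wr S (effWeight z)) v := by
  have := (measurable_TT o v).comp (measurable_mask {e : Sym2 (Fin N) | ∀ v ∈ e, v ∈ S})
  simpa only [Function.comp_def, eff_mask] using this

lemma cross (S : Finset (Fin N)) (f : Cf N → Fin N → St N → ℝ≥0∞)
    (hfm : ∀ u, Measurable fun x : Cf N × St N => f x.1 u x.2)
    (hfc : ∀ u ∉ S, ∀ z, f (cavz u z) = f z)
    (hfS : ∀ z u y y', (∀ v ∈ S, y v = y' v) → f z u y = f z u y') (U : Finset (Fin N)) :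
    Disjoint U S → ∀ G : Cf N → ℝ≥0∞, Measurable G → (∀ u ∉ S, ∀ z, G (cavz u z) = G z) →
    ∫⁻ z, G z * ∏ u ∈ U, f z u (star u z) ∂(PP N p) = ∫⁻ z, G z * ∏ u ∈ U, ∫⁻ y, f z u y ∂(QQ N p) ∂(PP N p) := by
  induction U using Finset.induction_on with
  | empty => intro _ G _ _; simp
  | insert u U hu ih =>
    intro hd G hG hGc
    have huS : u ∉ S := Finset.disjoint_left.1 hd (Finset.mem_insert_self u U)
    have hd' : Disjoint U S := Finset.disjoint_of_subset_left (Finset.subset_insert u U) hd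
    have hUS : ∀ x ∈ U, x ∉ S := fun x hx => Finset.disjoint_left.1 hd' hx
    have hstar : ∀ z, ∀ x ∈ U, f z x (star x (cavz u z)) = f z x (star x z) := by
      intro z x hx
      apply hfS
      intro v hv
      have h1 : u ≠ x := fun h => hu (h ▸ hx)
      have h2 : u ≠ v := fun h => huS (h ▸ hv)
      simp [star, cavz, mask, h1, h2]
    have hI : Measurable fun z => ∫⁻ y, f z u y ∂(QQ N p) := (hfm u).lintegral_prod_right'
    have e1 : ∀ z, G z * ∏ x ∈ insert u U, f z x (star x z) =
        (fun (z : Cf N) (y : St N) => G z * (f z u y * ∏ x ∈ U, f z x (star x z))) (cavz u z) (star u z) := by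
      intro z
      simp only []
      rw [Finset.prod_insert hu, hGc u huS, hfc u huS, Finset.prod_congr rfl (hstar z)]
    have hΦ : Measurable (Function.uncurry (fun (z : Cf N) (y : St N) => G z * (f z u y * ∏ x ∈ U, f z x (star x z)))) := by
      refine (hG.comp measurable_fst).mul ((hfm u).mul ?_)
      refine Finset.measurable_prod _ fun x _ => ?_
      exact (hfm x).comp (measurable_fst.prodMk ((measurable_star x).comp measurable_fst))
    simp only [e1]
    rw [lint_cav_star p u _ hΦ]
    have e2 : ∀ z, ∫⁻ y, G (cavz u z) * (f (cavz u z) u y * ∏ x ∈ U, f (cavz u z) x (star x (cavz u z))) ∂(QQ N p)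
        = (G z * ∫⁻ y, f z u y ∂(QQ N p)) * ∏ x ∈ U, f z x (star x z) := by
      intro z
      rw [hGc u huS, hfc u huS, Finset.prod_congr rfl (hstar z)]
      have hfz : Measurable (f z u) := (hfm u).comp measurable_prodMk_left
      rw [lintegral_const_mul _ (hfz.mul_const _), lintegral_mul_const _ hfz, mul_assoc]
    simp only [e2]
    have hGI : Measurable fun z => G z * ∫⁻ y, f z u y ∂(QQ N p) := hG.mul hI
    rw [ih hd' (fun z => G z * ∫⁻ y, f z u y ∂(QQ N p)) hGI]
    · refine lintegral_congr fun z => ?_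
      rw [Finset.prod_insert hu, mul_assoc]
    · intro x hx z
      rw [hGc x hx, hfc x hx]

def gs (c : ℝ≥0∞) (t : ℝ) : ℝ≥0∞ := nu p {b | ofReal t < c + ew b}

lemma gs_eq {c : ℝ≥0∞} {t : ℝ} (ht : 0 ≤ t) (h : c ≤ ofReal t) :
    gs p c t = ofReal (sv p (t - c.toReal)) := by
  have hc : c ≠ ⊤ := ne_top_of_le_ne_top ENNReal.ofReal_ne_top h
  rcases h.lt_or_eq with h1 | h1
  · rw [← ga_eq p h1]
    unfold gs ga
    apply measure_congr
    have : ∀ᵐ b ∂(nu p), c + ew b ≠ ofReal t := by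
      rw [ae_iff]
      simp only [ne_eq, not_not]
      exact nu_atom p c (ofReal t) ENNReal.ofReal_ne_top
    filter_upwards [this] with b hb
    apply propext
    show ofReal t < c + ew b ↔ ofReal t ≤ c + ew b
    exact ⟨fun h => h.le, fun h => lt_of_le_of_ne h (Ne.symm hb)⟩
  · have h2 : c.toReal = t := by rw [h1, ENNReal.toReal_ofReal ht]
    rw [h2, sub_self, sv, if_pos le_rfl]
    simp only [neg_zero, Real.exp_zero, mul_one, sub_add_cancel, ENNReal.ofReal_one]
    unfold gs
    have : ∀ᵐ b ∂(nu p), c + ew b ≠ ofReal t := by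
      rw [ae_iff]
      simp only [ne_eq, not_not]
      exact nu_atom p c (ofReal t) ENNReal.ofReal_ne_top
    rw [← measure_univ (μ := nu p)]
    apply measure_congr
    filter_upwards [this] with b hb
    apply propext
    show ofReal t < c + ew b ↔ True
    rw [iff_true, ← h1]
    exact lt_of_le_of_ne le_self_add (Ne.symm (h1 ▸ hb))

lemma sv_mono {x d : ℝ} (hx : 0 ≤ x) (hd : 0 ≤ d) : sv p (x + d) ≤ sv p x := by
  rw [sv, sv, if_pos hx, if_pos (by linarith)]
  have := mul_le_mul_of_nonneg_left (Real.exp_le_exp.2 (by linarith : -(x+d) ≤ -x)) hp.out.1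
  linarith

lemma sv_le_one {x : ℝ} (hx : 0 ≤ x) : sv p x ≤ 1 := by
  rw [sv, if_pos hx]
  have := mul_le_mul_of_nonneg_left (Real.exp_le_one_iff.2 (by linarith : -x ≤ 0)) hp.out.1
  linarith

lemma sv_step {x d : ℝ} (hx : 0 ≤ x) (hd : 0 ≤ d) (hd2 : d ≤ 1/2) (hxd : x ≤ d) :
    sv p (x + d) ≤ sv p x * exp (-(p * d / 4)) := by
  have hp' := hp.out
  have h1 : sv p (x + d) = sv p x - p * (exp (-x) * (1 - exp (-d))) := by
    rw [sv, sv, if_pos hx, if_pos (by linarith), neg_add, Real.exp_add]; ring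
  have h2 : 1/2 ≤ exp (-x) := by linarith [Real.add_one_le_exp (-x)]
  have h3 : d / 2 ≤ 1 - exp (-d) := by
    have : exp (-d) ≤ 1 / (1 + d) := by
      rw [Real.exp_neg, inv_eq_one_div]
      exact one_div_le_one_div_of_le (by linarith) (by linarith [Real.add_one_le_exp d])
    have h4 : 1 / (1 + d) ≤ 1 - d / 2 := by
      rw [div_le_iff₀ (by linarith)]; nlinarith
    linarith
  have h5 : d / 4 ≤ exp (-x) * (1 - exp (-d)) := by nlinarith
  have h6 : p * (d / 4) ≤ p * (exp (-x) * (1 - exp (-d))) := mul_le_mul_of_nonneg_left h5 hp'.1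
  have h7 := sv_le_one p hx
  have h8 := (sv_pos p hx)
  have h9 := Real.add_one_le_exp (-(p * d / 4))
  have h10 : sv p x * (1 - p * d / 4) ≤ sv p x * exp (-(p * d / 4)) := mul_le_mul_of_nonneg_left (by linarith) h8.le
  have h11 : 0 ≤ p * d / 4 := by have := mul_nonneg hp'.1 hd; linarith
  nlinarith

end FPP

namespace FPP
variable (p : ℝ) [hp : Fact (0 ≤ p ∧ p ≤ 1)] {N : ℕ}

def cS (o : Fin N) (S : Finset (Fin N)) (z : Cf N) (v : Fin N) : ℝ≥0∞ := TT o (wr S (effWeight z)) v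

lemma measurable_cS (o : Fin N) (S : Finset (Fin N)) (v : Fin N) : Measurable fun z => cS o S z v :=
  measurable_TTwr o S v

lemma cS_cavz (o : Fin N) (S : Finset (Fin N)) {u : Fin N} (hu : u ∉ S) (z : Cf N) :
    cS o S (cavz u z) = cS o S z := by
  funext v; unfold cS; rw [wr_cavz S hu]

def avS (o : Fin N) (S : Finset (Fin N)) (t : ℝ) (z : Cf N) (y : St N) : Prop :=
  ∀ v ∈ S, ofReal t < cS o S z v + ew (y v)

lemma measurableSet_avS (o : Fin N) (S : Finset (Fin N)) (t : ℝ) :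
    MeasurableSet {x : Cf N × St N | avS o S t x.1 x.2} := by
  unfold avS
  simp only [Set.ofPred_forall]
  refine MeasurableSet.iInter fun v => MeasurableSet.iInter fun _ => ?_
  exact measurableSet_lt measurable_const (((measurable_cS o S v).comp measurable_fst).add
    (measurable_ew.comp ((measurable_pi_apply v).comp measurable_snd)))

open Classical in
def fS (o : Fin N) (S : Finset (Fin N)) (t : ℝ) (z : Cf N) (y : St N) : ℝ≥0∞ :=
  if avS o S t z y then 1 else 0

lemma measurable_fS (o : Fin N) (S : Finset (Fin N)) (t : ℝ) :
    Measurable fun x : Cf N × St N => fS o S t x.1 x.2 := by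
  unfold fS
  exact Measurable.ite (measurableSet_avS o S t) measurable_const measurable_const

lemma int_fS (o : Fin N) (S : Finset (Fin N)) (t : ℝ) (z : Cf N) :
    ∫⁻ y, fS o S t z y ∂(QQ N p) = ∏ v ∈ S, gs p (cS o S z v) t := by
  have hm : MeasurableSet {y : St N | avS o S t z y} :=
    measurable_prodMk_left (measurableSet_avS o S t)
  have : (fun y => fS o S t z y) = {y : St N | avS o S t z y}.indicator 1 := by
    funext y
    by_cases h : avS o S t z y
    · rw [Set.indicator_of_mem (by exact h)]; simp [fS, h]
    · rw [Set.indicator_of_notMem (by exact h)]; simp [fS, h]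
  rw [this, lintegral_indicator_one hm]
  exact QQ_box p (fun v => {b | ofReal t < cS o S z v + ew b}) S

lemma mix_bound {y : ℝ} (h0 : 0 ≤ y) (h1 : y ≤ 1) :
    exp (-1) + (1 - exp (-1)) * exp (-y) ≤ exp (-(y/4)) := by
  have e1 : exp (-1) ≤ 1/2 := by
    have := Real.add_one_le_exp (1:ℝ)
    rw [Real.exp_neg, inv_eq_one_div]
    exact one_div_le_one_div_of_le (by norm_num) (by linarith)
  have e2 : exp (-y) ≤ 1 - y/2 := by
    have : exp (-y) ≤ 1 / (1 + y) := by
      rw [Real.exp_neg, inv_eq_one_div]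
      exact one_div_le_one_div_of_le (by linarith) (by linarith [Real.add_one_le_exp y])
    refine this.trans ?_
    rw [div_le_iff₀ (by linarith)]; nlinarith
  have e3 := Real.add_one_le_exp (-(y/4))
  nlinarith [Real.exp_pos (-1)]

lemma prod_step (o : Fin N) (S : Finset (Fin N)) {t Δ : ℝ} (ht : 0 ≤ t) (hΔ : 0 < Δ) (hΔ2 : Δ ≤ 1/2) (z : Cf N)
    (hc : ∀ v ∈ S, cS o S z v ≤ ofReal t)
    (hr : 2 * (S.filter fun v => cS o S z v + ofReal Δ ≤ ofReal t).card ≤ S.card)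
    (hy : p * Δ * S.card / 8 ≤ 1) :
    ofReal (exp (-1)) * ∏ v ∈ S, gs p (cS o S z v) t
      + ofReal (1 - exp (-1)) * ∏ v ∈ S, gs p (cS o S z v) (t + Δ)
      ≤ ofReal (exp (-(p * Δ * S.card / 8 / 4))) * ∏ v ∈ S, gs p (cS o S z v) t := by
  have hx : ∀ v ∈ S, 0 ≤ t - (cS o S z v).toReal := by
    intro v hv
    have := ENNReal.toReal_mono ENNReal.ofReal_ne_top (hc v hv)
    rw [ENNReal.toReal_ofReal ht] at this
    linarith
  have hsn : ∀ v ∈ S, 0 ≤ sv p (t - (cS o S z v).toReal) := fun v hv => (sv_pos p (hx v hv)).le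
  have hsn2 : ∀ v ∈ S, 0 ≤ sv p (t - (cS o S z v).toReal + Δ) := fun v hv =>
    (sv_pos p (by linarith [hx v hv])).le
  have hA : ∏ v ∈ S, gs p (cS o S z v) t = ofReal (∏ v ∈ S, sv p (t - (cS o S z v).toReal)) := by
    rw [ENNReal.ofReal_prod_of_nonneg hsn]
    exact Finset.prod_congr rfl fun v hv => gs_eq p ht (hc v hv)
  have hB : ∏ v ∈ S, gs p (cS o S z v) (t + Δ) =
      ofReal (∏ v ∈ S, sv p (t - (cS o S z v).toReal + Δ)) := by
    rw [ENNReal.ofReal_prod_of_nonneg hsn2]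
    refine Finset.prod_congr rfl fun v hv => ?_
    rw [gs_eq p (by linarith) ((hc v hv).trans (ENNReal.ofReal_le_ofReal (by linarith)))]
    congr 2; ring
  have hp0 := hp.out.1
  have hBA : ∏ v ∈ S, sv p (t - (cS o S z v).toReal + Δ) ≤
      (∏ v ∈ S, sv p (t - (cS o S z v).toReal)) * exp (-(p * Δ * S.card / 8)) := by
    have h1 : ∏ v ∈ S, sv p (t - (cS o S z v).toReal + Δ) ≤
      ∏ v ∈ S, (sv p (t - (cS o S z v).toReal) *
        (if cS o S z v + ofReal Δ ≤ ofReal t then 1 else exp (-(p * Δ / 4)))) := by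
      refine Finset.prod_le_prod hsn2 fun v hv => ?_
      split_ifs with h
      · rw [mul_one]; exact sv_mono p (hx v hv) hΔ.le
      · refine sv_step p (hx v hv) hΔ.le hΔ2 ?_
        by_contra hcon
        apply h
        have hcv := hc v hv
        rw [← ENNReal.ofReal_toReal (ne_top_of_le_ne_top ENNReal.ofReal_ne_top hcv),
          ← ENNReal.ofReal_add ENNReal.toReal_nonneg hΔ.le]
        exact ENNReal.ofReal_le_ofReal (by linarith)
    refine h1.trans ?_
    rw [Finset.prod_mul_distrib]
    refine mul_le_mul_of_nonneg_left ?_ (Finset.prod_nonneg hsn)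
    rw [Finset.prod_ite, Finset.prod_const_one, one_mul, Finset.prod_const, ← Real.exp_nat_mul]
    apply Real.exp_le_exp.2
    have h2 := Finset.card_filter_add_card_filter_not (s := S) (fun v => cS o S z v + ofReal Δ ≤ ofReal t)
    have h3 : (S.card : ℝ) ≤ 2 * ((S.filter fun v => ¬ (cS o S z v + ofReal Δ ≤ ofReal t)).card : ℝ) := by
      exact_mod_cast (by omega)
    nlinarith [mul_nonneg hp0 hΔ.le]
  have hA0 := Finset.prod_nonneg hsn
  have hB0 := Finset.prod_nonneg hsn2
  rw [hA, hB]
  have e1 : exp (-1) ≤ 1 := Real.exp_le_one_iff.2 (by norm_num)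
  rw [← ENNReal.ofReal_mul (Real.exp_pos _).le, ← ENNReal.ofReal_mul (by linarith),
    ← ENNReal.ofReal_add (mul_nonneg (Real.exp_pos _).le hA0) (mul_nonneg (by linarith) hB0),
    ← ENNReal.ofReal_mul (Real.exp_pos _).le]
  apply ENNReal.ofReal_le_ofReal
  have hmx := mix_bound (y := p * Δ * S.card / 8) (by positivity) hy
  have h4 := mul_le_mul_of_nonneg_left hBA (sub_nonneg.2 e1)
  have h5 := mul_le_mul_of_nonneg_left hmx hA0
  nlinarith

end FPP

namespace FPP
variable (p : ℝ) [hp : Fact (0 ≤ p ∧ p ≤ 1)] {N : ℕ}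

def ball (o : Fin N) (z : Cf N) (t : ℝ) : Finset (Fin N) :=
  Finset.univ.filter fun v => tt o z v ≤ ofReal t

def Rec (o : Fin N) (z : Cf N) (t Δ : ℝ) : Prop :=
  2 * (Finset.univ.filter fun v => tt o z v + ofReal Δ ≤ ofReal t).card ≤ (ball o z t).card

lemma mem_ball {o : Fin N} {z : Cf N} {t : ℝ} {v : Fin N} : v ∈ ball o z t ↔ tt o z v ≤ ofReal t := by
  simp [ball]

lemma o_mem_ball (o : Fin N) (z : Cf N) (t : ℝ) : o ∈ ball o z t := by
  rw [mem_ball, tt_o]; exact zero_le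

lemma measurableSet_ball (o : Fin N) (t : ℝ) (S : Finset (Fin N)) : MeasurableSet {z : Cf N | ball o z t = S} := by
  have : {z : Cf N | ball o z t = S} = ⋂ v, {z | tt o z v ≤ ofReal t ↔ v ∈ S} := by
    ext z
    simp only [Set.mem_iInter, Finset.ext_iff, mem_ball]
    rfl
  rw [this]
  refine MeasurableSet.iInter fun v => ?_
  by_cases hv : v ∈ S
  · simp only [hv, iff_true]
    exact measurableSet_le (measurable_tt o v) measurable_const
  · simp only [hv, iff_false, not_le]
    exact measurableSet_lt measurable_const (measurable_tt o v)

def GS (o : Fin N) (S : Finset (Fin N)) (t Δ : ℝ) (z : Cf N) : Prop :=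
  (∀ v ∈ S, cS o S z v ≤ ofReal t) ∧
    2 * (S.filter fun v => cS o S z v + ofReal Δ ≤ ofReal t).card ≤ S.card

lemma measurableSet_GS (o : Fin N) (S : Finset (Fin N)) (t Δ : ℝ) : MeasurableSet {z : Cf N | GS o S t Δ z} := by
  unfold GS
  refine MeasurableSet.inter (s₁ := {z : Cf N | ∀ v ∈ S, cS o S z v ≤ ofReal t}) ?_ ?_
  · simp only [Set.ofPred_forall]
    exact MeasurableSet.iInter fun v => MeasurableSet.iInter fun _ =>
      measurableSet_le (measurable_cS o S v) measurable_const
  · have hm : Measurable fun z : Cf N => (S.filter fun v => cS o S z v + ofReal Δ ≤ ofReal t).card := by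
      simp only [Finset.card_filter]
      refine Finset.measurable_sum _ fun v _ => ?_
      exact Measurable.ite (measurableSet_le ((measurable_cS o S v).add measurable_const) measurable_const)
        measurable_const measurable_const
    exact measurableSet_le (measurable_const.mul hm) measurable_const

lemma ball_char {o : Fin N} {z : Cf N} (hz : Pos z) {S : Finset (Fin N)} (ho : o ∈ S) {t : ℝ} :
    ball o z t = S ↔ (∀ v ∈ S, cS o S z v ≤ ofReal t) ∧ ∀ u ∈ Sᶜ, avS o S t z (star u z) := by
  have h1 := ball_iff o (effWeight z) hz.eff S ho (ofReal t) ENNReal.ofReal_ne_top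
  rw [Finset.ext_iff]
  simp only [mem_ball]
  unfold tt
  rw [h1]
  unfold cS avS star
  refine and_congr_right fun _ => ?_
  constructor
  · intro h u hu v hv
    have hu' : u ∉ S := by simpa using hu
    have := h v hv u hu'
    rwa [effWeight_eq, if_neg (fun h : v = u => hu' (h ▸ hv))] at this
  · intro h v hv u hu'
    have := h u (by simpa using hu') v hv
    rwa [effWeight_eq, if_neg (fun h : v = u => hu' (h ▸ hv))]

lemma ball_cS {o : Fin N} {z : Cf N} (hz : Pos z) {S : Finset (Fin N)} {t : ℝ} (h : ball o z t = S) {v : Fin N}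
    (hv : v ∈ S) : cS o S z v = tt o z v := by
  refine ball_eq o (effWeight z) hz.eff S (ofReal t) ENNReal.ofReal_ne_top ?_ v hv
  intro v; rw [← h, mem_ball]; rfl

lemma Rec_GS {o : Fin N} {z : Cf N} (hz : Pos z) {S : Finset (Fin N)} (ho : o ∈ S) {t Δ : ℝ}
    (h : ball o z t = S) (hr : Rec o z t Δ) : GS o S t Δ z := by
  refine ⟨((ball_char hz ho).1 h).1, ?_⟩
  unfold Rec at hr
  rw [h] at hr
  refine le_trans ?_ hr
  refine Nat.mul_le_mul_left _ (Finset.card_le_card ?_)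
  intro v
  simp only [Finset.mem_filter, Finset.mem_univ, true_and]
  rintro ⟨hv, h2⟩
  rwa [ball_cS hz h hv] at h2

lemma escape {o : Fin N} {z : Cf N} (hz : Pos z) {S : Finset (Fin N)} {t s : ℝ}
    (h : ball o z t = S) {u : Fin N} (hu : u ∉ S) (h2 : u ∉ ball o z s) : avS o S s z (star u z) := by
  intro v hv
  rw [ball_cS hz h hv]
  rw [mem_ball, not_le] at h2
  refine h2.trans_le ?_
  have h3 := TT_step o (effWeight z) v u
  rw [effWeight_eq, if_neg (fun h : v = u => hu (h ▸ hv))] at h3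
  exact h3

lemma growS (o : Fin N) (S : Finset (Fin N)) (ho : o ∈ S) {t Δ : ℝ} (ht : 0 ≤ t) (hΔ : 0 < Δ) (hΔ2 : Δ ≤ 1/2)
    (ha : 128 ≤ N * p * Δ) (haS : N * p * Δ * S.card ≤ N) :
    PP N p {z | ball o z t = S ∧ Rec o z t Δ ∧ (ball o z (t + Δ)).card < 2 * S.card} ≤
      ofReal (exp (- (N * p * Δ * S.card / 128))) * PP N p {z | ball o z t = S} := by
  classical
  obtain ⟨m, hm⟩ : ∃ m, m = S.card := ⟨_, rfl⟩
  set q : ℝ≥0∞ := ofReal (exp (-1)) with hq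
  set q' : ℝ≥0∞ := ofReal (1 - exp (-1)) with hq'
  have e1 : exp (-1) ≤ 1 := Real.exp_le_one_iff.2 (by norm_num)
  have hqq : q + q' = 1 := by
    rw [hq, hq', ← ENNReal.ofReal_add (Real.exp_pos _).le (by linarith)]; simp
  obtain ⟨φ, hφ⟩ : ∃ φ : Cf N → Fin N → St N → ℝ≥0∞, φ = fun z _ y => q * fS o S t z y + q' * fS o S (t + Δ) z y := ⟨_, rfl⟩
  obtain ⟨G, hG⟩ : ∃ G : Cf N → ℝ≥0∞, G = fun z => if GS o S t Δ z then 1 else 0 := ⟨_, rfl⟩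
  have hGm : Measurable G := by
    rw [hG]; exact Measurable.ite (measurableSet_GS o S t Δ) measurable_const measurable_const
  have hGc : ∀ u ∉ S, ∀ z, G (cavz u z) = G z := by
    intro u hu z; rw [hG]
    have : GS o S t Δ (cavz u z) ↔ GS o S t Δ z := by simp only [GS, cS_cavz o S hu]
    exact if_congr this rfl rfl
  have hfc : ∀ s, ∀ u ∉ S, ∀ z, fS o S s (cavz u z) = fS o S s z := by
    intro s u hu z; funext y
    have : avS o S s (cavz u z) y ↔ avS o S s z y := by simp only [avS, cS_cavz o S hu]
    exact if_congr this rfl rfl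
  have hfS : ∀ s z y y', (∀ v ∈ S, y v = y' v) → fS o S s z y = fS o S s z y' := by
    intro s z y y' h
    unfold fS avS
    congr 1
    apply propext
    exact forall₂_congr fun v hv => by rw [h v hv]
  have hφm : ∀ u, Measurable fun x : Cf N × St N => φ x.1 u x.2 := by
    intro u; rw [hφ]
    exact ((measurable_fS o S t).const_mul q).add ((measurable_fS o S (t+Δ)).const_mul q')
  have hdis : Disjoint Sᶜ S := disjoint_compl_left
  have C1 := cross p S φ hφm (by intro u hu z; rw [hφ]; simp only [hfc _ u hu])
    (by intro z u y y' h; rw [hφ]; simp only [hfS _ z y y' h]) Sᶜ hdis G hGm hGc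
  obtain ⟨ψ, hψ⟩ : ∃ ψ : Cf N → Fin N → St N → ℝ≥0∞, ψ = fun z _ y => fS o S t z y := ⟨_, rfl⟩
  have hψm : ∀ u, Measurable fun x : Cf N × St N => ψ x.1 u x.2 := by
    intro u; rw [hψ]; exact measurable_fS o S t
  have C2 := cross p S ψ hψm
    (by intro u hu z; rw [hψ]; simp only [hfc _ u hu])
    (by intro z u y y' h; rw [hψ]; simp only [hfS _ z y y' h]) Sᶜ hdis G hGm hGc
  have hψ1 : ∀ z u y, ψ z u y = fS o S t z y := by intro z u y; rw [hψ]
  simp only [hψ1] at C2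
  have hs : ∀ s z, Measurable fun y => fS o S s z y := by
    intro s z
    have hm : MeasurableSet {y : St N | avS o S s z y} :=
      measurable_prodMk_left (measurableSet_avS o S s)
    unfold fS
    exact Measurable.ite hm measurable_const measurable_const
  have hφi : ∀ z u, ∫⁻ y, φ z u y ∂(QQ N p) = q * ∏ v ∈ S, gs p (cS o S z v) t + q' * ∏ v ∈ S, gs p (cS o S z v) (t + Δ) := by
    intro z u
    rw [hφ]
    simp only []
    rw [lintegral_add_left ((hs t z).const_mul q), lintegral_const_mul _ (hs t z), lintegral_const_mul _ (hs _ z),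
      int_fS, int_fS]
  have hN : (0:ℝ) < N := by
    rcases Nat.eq_zero_or_pos N with h | h
    · subst h; exact o.elim0
    · exact_mod_cast h
  have hy : p * Δ * S.card / 8 = N * p * Δ * S.card / (8 * N) := by field_simp
  have hy1 : p * Δ * S.card / 8 ≤ 1 := by
    rw [hy, div_le_one (by positivity)]; linarith
  obtain ⟨E, hE⟩ : ∃ E : ℝ≥0∞, E = ofReal (exp (-(p * Δ * S.card / 8 / 4))) := ⟨_, rfl⟩
  have hint : ∫⁻ z, G z * ∏ u ∈ Sᶜ, φ z u (star u z) ∂(PP N p) ≤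
      E ^ (Sᶜ.card) * PP N p {z | ball o z t = S} := by
    rw [C1]
    have h1 : ∀ z, G z * ∏ u ∈ Sᶜ, ∫⁻ y, φ z u y ∂(QQ N p) ≤
        E ^ (Sᶜ.card) * (G z * ∏ u ∈ Sᶜ, ∫⁻ y, fS o S t z y ∂(QQ N p)) := by
      intro z
      simp only [hφi, int_fS, Finset.prod_const]
      by_cases h : GS o S t Δ z
      · have := prod_step p o S ht hΔ hΔ2 z h.1 h.2 hy1
        rw [← hE] at this
        rw [mul_left_comm, ← mul_pow]
        gcongr
      · rw [hG]; simp [h]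
    refine (lintegral_mono h1).trans ?_
    rw [lintegral_const_mul' _ _ (by rw [hE]; exact ENNReal.pow_ne_top ENNReal.ofReal_ne_top)]
    rw [← C2]
    refine mul_le_mul_right ?_ _
    rw [← lintegral_indicator_one (measurableSet_ball o t S)]
    refine lintegral_mono_ae ?_
    filter_upwards [ae_Pos p] with z hz
    by_cases h : ball o z t = S
    · rw [Set.indicator_of_mem (by exact h)]
      have hg : G z ≤ 1 := by rw [hG]; simp only []; split_ifs <;> simp
      have hpr : ∏ u ∈ Sᶜ, fS o S t z (star u z) ≤ 1 :=
        Finset.prod_le_one' fun u _ => by unfold fS; split_ifs <;> simp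
      calc _ ≤ (1:ℝ≥0∞) * 1 := mul_le_mul' hg hpr
        _ = _ := by simp
    · rw [Set.indicator_of_notMem (by exact h)]
      rw [ball_char hz ho] at h
      by_cases h2 : GS o S t Δ z
      · have : ∃ u ∈ Sᶜ, ¬ avS o S t z (star u z) := by
          by_contra hc; push Not at hc; exact h ⟨h2.1, hc⟩
        obtain ⟨u, hu, hu2⟩ := this
        rw [Finset.prod_eq_zero hu (by simp [fS, hu2]), mul_zero]
      · rw [hG]; simp [h2]
  have hlow : ∀ᵐ z ∂(PP N p), z ∈ {z | ball o z t = S ∧ Rec o z t Δ ∧ (ball o z (t + Δ)).card < 2 * S.card} →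
      1 ≤ ofReal (exp m) * (G z * ∏ u ∈ Sᶜ, φ z u (star u z)) := by
    filter_upwards [ae_Pos p] with z hz
    rintro ⟨h1, h2, h3⟩
    have hGz : G z = 1 := by rw [hG]; simp [Rec_GS hz ho h1 h2]
    rw [hGz, one_mul]
    have hge : ∀ u ∈ Sᶜ, (if u ∈ ball o z (t + Δ) then q else 1) ≤ φ z u (star u z) := by
      intro u hu
      have hu' : u ∉ S := by simpa using hu
      have ha1 : fS o S t z (star u z) = 1 := by
        simp [fS, ((ball_char hz ho).1 h1).2 u hu]
      rw [hφ]
      simp only [ha1, mul_one]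
      split_ifs with h
      · exact le_self_add
      · have : fS o S (t + Δ) z (star u z) = 1 := by simp [fS, escape hz h1 hu' h]
        rw [this, mul_one, hqq]
    have hpr := Finset.prod_le_prod' hge
    rw [Finset.prod_ite, Finset.prod_const_one, mul_one, Finset.prod_const] at hpr
    have hcard : (Sᶜ.filter fun u => u ∈ ball o z (t + Δ)).card ≤ m := by
      have hsub : S ∪ (Sᶜ.filter fun u => u ∈ ball o z (t + Δ)) ⊆ ball o z (t + Δ) := by
        intro u hu
        rcases Finset.mem_union.1 hu with h | h
        · rw [mem_ball]
          rw [← h1, mem_ball] at h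
          exact h.trans (ENNReal.ofReal_le_ofReal (by linarith))
        · exact (Finset.mem_filter.1 h).2
      have := Finset.card_le_card hsub
      rw [Finset.card_union_of_disjoint] at this
      · omega
      · exact Finset.disjoint_of_subset_right (Finset.filter_subset _ _) disjoint_compl_right
    have hq1 : q ≤ 1 := by rw [hq]; simp
    have hpow : q ^ m ≤ q ^ (Sᶜ.filter fun u => u ∈ ball o z (t + Δ)).card := pow_le_pow_right_of_le_one' hq1 hcard
    have hone : ofReal (exp m) * q ^ m = 1 := by
      rw [hq, ← ENNReal.ofReal_pow (Real.exp_pos _).le, ← Real.exp_nat_mul, ← ENNReal.ofReal_mul (Real.exp_pos _).le,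
        ← Real.exp_add]
      simp
    rw [← hone]
    exact mul_le_mul_right (hpow.trans hpr) _
  have hmeas : Measurable fun z => ofReal (exp m) * (G z * ∏ u ∈ Sᶜ, φ z u (star u z)) := by
    refine (hGm.mul (Finset.measurable_prod _ fun u _ => ?_)).const_mul _
    exact (hφm u).comp (measurable_id.prodMk (measurable_star u))
  have hfin : PP N p {z | ball o z t = S ∧ Rec o z t Δ ∧ (ball o z (t + Δ)).card < 2 * S.card} ≤
      ∫⁻ z, ofReal (exp m) * (G z * ∏ u ∈ Sᶜ, φ z u (star u z)) ∂(PP N p) := by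
    have h1 : PP N p {z | ball o z t = S ∧ Rec o z t Δ ∧ (ball o z (t + Δ)).card < 2 * S.card} ≤
      PP N p {z | 1 ≤ ofReal (exp m) * (G z * ∏ u ∈ Sᶜ, φ z u (star u z))} :=
      measure_mono_ae hlow
    exact h1.trans (meas_le_lintegral₀ hmeas.aemeasurable fun x hx => hx)
  refine hfin.trans ?_
  rw [lintegral_const_mul' _ _ ENNReal.ofReal_ne_top]
  refine (mul_le_mul_right hint _).trans ?_
  rw [← mul_assoc]
  refine mul_le_mul_left ?_ _
  rw [hE, ← ENNReal.ofReal_pow (Real.exp_pos _).le, ← Real.exp_nat_mul, ← ENNReal.ofReal_mul (Real.exp_pos _).le,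
        ← Real.exp_add]
  apply ENNReal.ofReal_le_ofReal
  apply Real.exp_le_exp.2
  have hcc : (Sᶜ.card : ℝ) = N - m := by
    rw [Finset.card_compl, Fintype.card_fin, ← hm, Nat.cast_sub]
    rw [hm]; simpa using Finset.card_le_univ S
  rw [hcc, ← hm]
  rw [← hm] at haS
  have hm0 : (0:ℝ) ≤ m := Nat.cast_nonneg m
  have h128 : 128 * (m:ℝ) ≤ N := le_trans (mul_le_mul_of_nonneg_right ha hm0) haS
  have hx : p * Δ * m / 8 / 4 = N * p * Δ * m / (32 * N) := by field_simp; ring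
  have h6 : N * p * Δ * m / 64 ≤ (N - m) * (p * Δ * m / 8 / 4) := by
    rw [hx]
    have : (N:ℝ)/2 * (N * p * Δ * m / (32 * N)) ≤ (N - m) * (N * p * Δ * m / (32 * N)) := by
      refine mul_le_mul_of_nonneg_right (by linarith) ?_
      have : 0 ≤ N * p * Δ * m := mul_nonneg (by linarith) hm0
      positivity
    refine le_trans (le_of_eq ?_) this
    field_simp; ring
  have h7 : 128 * (m:ℝ) ≤ N * p * Δ * m := mul_le_mul_of_nonneg_right ha hm0
  linarith

lemma grow (o : Fin N) {t Δ : ℝ} (M : ℕ) (ht : 0 ≤ t) (hΔ : 0 < Δ) (hΔ2 : Δ ≤ 1/2) (ha : 128 ≤ N * p * Δ) :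
    PP N p {z | Rec o z t Δ ∧ M ≤ (ball o z t).card ∧ N * p * Δ * (ball o z t).card ≤ N ∧
      (ball o z (t + Δ)).card < 2 * (ball o z t).card} ≤
      ofReal (exp (- (N * p * Δ * M / 128))) := by
  classical
  set U := (Finset.univ : Finset (Finset (Fin N))).filter fun S => o ∈ S ∧ M ≤ S.card ∧ N * p * Δ * S.card ≤ N with hU
  have hsub : {z | Rec o z t Δ ∧ M ≤ (ball o z t).card ∧ N * p * Δ * (ball o z t).card ≤ N ∧
      (ball o z (t + Δ)).card < 2 * (ball o z t).card} ⊆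
      ⋃ S ∈ U, {z | ball o z t = S ∧ Rec o z t Δ ∧ (ball o z (t + Δ)).card < 2 * S.card} := by
    rintro z ⟨h1, h2, h3, h4⟩
    simp only [Set.mem_iUnion]
    exact ⟨ball o z t, by simp [hU, o_mem_ball, h2, h3], rfl, h1, h4⟩
  refine (measure_mono hsub).trans ((measure_biUnion_finset_le _ _).trans ?_)
  have hb : ∀ S ∈ U, PP N p {z | ball o z t = S ∧ Rec o z t Δ ∧ (ball o z (t + Δ)).card < 2 * S.card} ≤
     ofReal (exp (- (N * p * Δ * M / 128))) * PP N p {z | ball o z t = S} := by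
    intro S hS
    simp only [hU, Finset.mem_filter, Finset.mem_univ, true_and] at hS
    refine (growS p o S hS.1 ht hΔ hΔ2 ha hS.2.2).trans ?_
    refine mul_le_mul_left (ENNReal.ofReal_le_ofReal (Real.exp_le_exp.2 ?_)) _
    have : (M:ℝ) ≤ S.card := by exact_mod_cast hS.2.1
    nlinarith
  refine (Finset.sum_le_sum hb).trans ?_
  rw [← Finset.mul_sum]
  rw [← measure_biUnion_finset]
  · calc _ ≤ _ * (1:ℝ≥0∞) := mul_le_mul_right prob_le_one _
      _ = _ := by rw [mul_one]
  · intro S _ S' _ h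
    exact Set.disjoint_left.2 fun z hz hz' => h (hz.symm.trans hz')
  · exact fun S _ => measurableSet_ball o t S

end FPP

namespace FPP
variable (p : ℝ) [hp : Fact (0 ≤ p ∧ p ≤ 1)] {N : ℕ}

lemma dbl_rec (o : Fin N) (z : Cf N) {Δ : ℝ} (hΔ : 0 < Δ) (k : ℕ)
    (h : ∀ j < k, 2 * (ball o z (j * Δ)).card ≤ (ball o z ((j + 1 : ℕ) * Δ)).card) :
    Rec o z (k * Δ) Δ ∧ 2 ^ k ≤ (ball o z (k * Δ)).card := by
  induction k with
  | zero =>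
    constructor
    · unfold Rec
      have : (Finset.univ.filter fun v => tt o z v + ofReal Δ ≤ ofReal ((0:ℕ) * Δ)) = ∅ := by
        apply Finset.filter_eq_empty_iff.2
        intro v _
        simp [hΔ]
      rw [this]; simp
    · simpa using Finset.card_pos.2 ⟨o, o_mem_ball o z _⟩
  | succ k ih =>
    have h1 := ih fun j hj => h j (by omega)
    have h2 := h k (by omega)
    refine ⟨?_, by rw [pow_succ]; omega⟩
    unfold Rec
    refine le_trans (Nat.mul_le_mul_left 2 (Finset.card_le_card ?_)) h2
    intro v
    simp only [Finset.mem_filter, Finset.mem_univ, true_and, mem_ball]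
    intro hv
    have e : ofReal ((k + 1 : ℕ) * Δ) = ofReal (k * Δ) + ofReal Δ := by
      rw [← ENNReal.ofReal_add (by positivity) hΔ.le]; push_cast; ring_nf
    rw [e] at hv
    exact (ENNReal.add_le_add_iff_right ENNReal.ofReal_ne_top).1 hv

lemma ball_mono (o : Fin N) (z : Cf N) {s t : ℝ} (h : s ≤ t) : ball o z s ⊆ ball o z t := by
  intro v; simp only [mem_ball]; exact fun hv => hv.trans (ENNReal.ofReal_le_ofReal h)

def Dbl (o : Fin N) (Δ a : ℝ) (z : Cf N) : Prop :=
  ∀ k : ℕ, a * (ball o z (k * Δ)).card ≤ N → 2 * (ball o z (k * Δ)).card ≤ (ball o z ((k + 1 : ℕ) * Δ)).card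

lemma P_Dbl (o : Fin N) {Δ : ℝ} (hΔ : 0 < Δ) (hΔ2 : Δ ≤ 1/2) (ha : 128 ≤ N * p * Δ) :
    PP N p {z | ¬ Dbl o Δ (N * p * Δ) z} ≤ ofReal (2 * exp (-(N * p * Δ / 128))) := by
  classical
  set a := N * p * Δ with hadef
  have hsub : {z | ¬ Dbl o Δ a z} ⊆ ⋃ k : ℕ, {z | Rec o z (k * Δ) Δ ∧ 2 ^ k ≤ (ball o z (k * Δ)).card ∧
      a * (ball o z (k * Δ)).card ≤ N ∧ (ball o z (k * Δ + Δ)).card < 2 * (ball o z (k * Δ)).card} := by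
    intro z hz
    have hz : ∃ k : ℕ, a * (ball o z (k * Δ)).card ≤ N ∧ (ball o z ((k + 1 : ℕ) * Δ)).card < 2 * (ball o z (k * Δ)).card := by
      have : ¬ Dbl o Δ a z := hz
      unfold Dbl at this
      push Not at this
      exact_mod_cast this
    obtain ⟨h1, h2⟩ := Nat.find_spec hz
    rw [Set.mem_iUnion]
    refine ⟨Nat.find hz, ?_⟩
    have h3 := dbl_rec o z hΔ (Nat.find hz) (by
      intro j hj
      have := Nat.find_min hz hj
      by_contra hc
      apply this
      refine ⟨le_trans ?_ h1, not_le.1 hc⟩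
      refine mul_le_mul_of_nonneg_left ?_ (by linarith)
      exact_mod_cast Finset.card_le_card (ball_mono o z (mul_le_mul_of_nonneg_right (by exact_mod_cast hj.le) hΔ.le)))
    refine ⟨h3.1, h3.2, h1, ?_⟩
    have e : ((Nat.find hz + 1 : ℕ) : ℝ) * Δ = (Nat.find hz : ℝ) * Δ + Δ := by push_cast; ring
    rwa [e] at h2
  refine (measure_mono hsub).trans ((measure_iUnion_le _).trans ?_)
  set r : ℝ := exp (-(a / 128)) with hr
  have hr2 : r ≤ 1/2 := by
    have h1 : r ≤ exp (-1) := Real.exp_le_exp.2 (by linarith)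
    have : exp (-1) ≤ 1/2 := by
      have := Real.add_one_le_exp (1:ℝ)
      rw [Real.exp_neg, inv_eq_one_div]
      exact one_div_le_one_div_of_le (by norm_num) (by linarith)
    linarith
  have hb : ∀ k : ℕ, PP N p {z | Rec o z (k * Δ) Δ ∧ 2 ^ k ≤ (ball o z (k * Δ)).card ∧
      a * (ball o z (k * Δ)).card ≤ N ∧ (ball o z (k * Δ + Δ)).card < 2 * (ball o z (k * Δ)).card} ≤
      ofReal r * (ofReal r) ^ k := by
    intro k
    refine (grow p o (2 ^ k) (by positivity) hΔ hΔ2 ha).trans ?_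
    rw [← pow_succ', ← ENNReal.ofReal_pow (Real.exp_pos _).le]
    apply ENNReal.ofReal_le_ofReal
    rw [← Real.exp_nat_mul]
    apply Real.exp_le_exp.2
    have h2 : ((k + 1 : ℕ) : ℝ) ≤ ((2 ^ k : ℕ) : ℝ) := by exact_mod_cast Nat.lt_two_pow_self
    rw [← hadef]
    nlinarith
  refine (ENNReal.tsum_le_tsum hb).trans ?_
  rw [ENNReal.tsum_mul_left, ENNReal.tsum_geometric, mul_comm]
  rw [ENNReal.ofReal_mul (by norm_num)]
  refine mul_le_mul_left ?_ _
  rw [← ENNReal.ofReal_one, ← ENNReal.ofReal_sub _ (Real.exp_pos _).le, ← ENNReal.ofReal_inv_of_pos (by linarith)]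
  apply ENNReal.ofReal_le_ofReal
  rw [inv_le_comm₀ (by linarith) (by norm_num)]
  linarith

def WW (o : Fin N) (Δ a : ℝ) (k : ℕ) (z : Cf N) : Prop :=
  Rec o z (k * Δ) Δ ∧ (N : ℝ) < a * (ball o z (k * Δ)).card

lemma measurable_cardball (o : Fin N) (t : ℝ) : Measurable fun z : Cf N => (ball o z t).card := by
  unfold ball
  simp only [Finset.card_filter]
  exact Finset.measurable_sum _ fun v _ => Measurable.ite (measurableSet_le (measurable_tt o v) measurable_const)
        measurable_const measurable_const

lemma measurableSet_WW (o : Fin N) (Δ a : ℝ) (k : ℕ) : MeasurableSet {z : Cf N | WW o Δ a k z} := by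
  unfold WW Rec
  refine MeasurableSet.inter (s₁ := {z : Cf N | 2 * (Finset.univ.filter fun v => tt o z v + ofReal Δ ≤ ofReal (k * Δ)).card ≤ (ball o z (k * Δ)).card}) ?_ ?_
  · have hm : Measurable fun z : Cf N => (Finset.univ.filter fun v => tt o z v + ofReal Δ ≤ ofReal (k * Δ)).card := by
      simp only [Finset.card_filter]
      refine Finset.measurable_sum _ fun v _ => ?_
      exact Measurable.ite (measurableSet_le ((measurable_tt o v).add measurable_const) measurable_const)
        measurable_const measurable_const
    exact measurableSet_le (measurable_const.mul hm) (measurable_cardball o _)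
  · have hm : Measurable fun z : Cf N => ((ball o z (k * Δ)).card : ℝ) := by
      have h0 : Measurable fun n : ℕ => (n : ℝ) := measurable_from_nat
      exact h0.comp (measurable_cardball o _)
    exact measurableSet_lt measurable_const (measurable_const.mul hm)

lemma last_c (o : Fin N) {Δ : ℝ} (hΔ : 0 < Δ) (ha : 128 ≤ N * p * Δ) (haΔ : (N * p * Δ + 1) * Δ ≤ 1) (k : ℕ) (z : Cf N)
    (hW : WW o Δ (N * p * Δ) k z) :
    QQ N p {y | ofReal (k * Δ + N * p * Δ * Δ) < mm (tt o z) y} ≤ ofReal (exp (-(N * p * Δ / 4))) := by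
  classical
  obtain ⟨a, hadef⟩ : ∃ a, a = N * p * Δ := ⟨_, rfl⟩
  rw [← hadef] at ha haΔ hW ⊢
  have hp0 := hp.out.1
  have hpa : 0 ≤ p * (a * Δ) := mul_nonneg hp0 (by nlinarith)
  set s : ℝ := k * Δ + a * Δ with hs
  have hs0 : 0 ≤ s := by have : 0 ≤ a * Δ := by nlinarith
                         positivity
  set S := (ball o z (k * Δ)).filter fun v => ¬ (tt o z v + ofReal Δ ≤ ofReal (k * Δ)) with hS
  have hcard : (N:ℝ) ≤ 2 * a * S.card := by
    obtain ⟨h1, h2⟩ := hW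
    unfold Rec at h1
    have h3 := Finset.card_filter_add_card_filter_not (s := ball o z (k * Δ)) (fun v => tt o z v + ofReal Δ ≤ ofReal (k * Δ))
    have h4 : ((ball o z (k * Δ)).filter fun v => tt o z v + ofReal Δ ≤ ofReal (k * Δ)).card ≤
      (Finset.univ.filter fun v => tt o z v + ofReal Δ ≤ ofReal (k * Δ)).card :=
      Finset.card_le_card (Finset.filter_subset_filter _ (Finset.subset_univ _))
    have h5 : ((ball o z (k * Δ)).card : ℝ) ≤ 2 * S.card := by
      have : (ball o z (k * Δ)).card ≤ 2 * S.card := by rw [hS]; omega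
      exact_mod_cast this
    nlinarith
  have hsub : {y | ofReal s < mm (tt o z) y} ⊆ {y : St N | ∀ v ∈ S, y v ∈ {b | ofReal s < tt o z v + ew b}} := by
    intro y hy v _
    have hy : ofReal s < mm (tt o z) y := hy
    exact lt_of_lt_of_le hy (iInf_le (fun v => tt o z v + ew (y v)) v)
  refine (measure_mono hsub).trans ?_
  rw [QQ_box]
  have hv : ∀ v ∈ S, nu p {b | ofReal s < tt o z v + ew b} ≤ ofReal (exp (-(p * (a * Δ) / 2))) := by
    intro v hv
    rw [hS, Finset.mem_filter, mem_ball, not_le] at hv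
    have hle : tt o z v ≤ ofReal s := hv.1.trans (ENNReal.ofReal_le_ofReal (by rw [hs]; nlinarith))
    have h1 := gs_eq p hs0 hle
    unfold gs at h1
    rw [h1]
    apply ENNReal.ofReal_le_ofReal
    have htop : tt o z v ≠ ⊤ := ne_top_of_le_ne_top ENNReal.ofReal_ne_top hv.1
    have hx1 : (tt o z v).toReal ≤ k * Δ := by
      have := ENNReal.toReal_mono ENNReal.ofReal_ne_top hv.1
      rwa [ENNReal.toReal_ofReal (by positivity)] at this
    have hx2 : k * Δ < (tt o z v).toReal + Δ := by
      have h := hv.2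
      rw [← ENNReal.ofReal_toReal htop, ← ENNReal.ofReal_add ENNReal.toReal_nonneg hΔ.le] at h
      exact (ENNReal.ofReal_lt_ofReal_iff_of_nonneg (by positivity)).1 h
    set x := s - (tt o z v).toReal with hx
    have hxa : a * Δ ≤ x := by rw [hx, hs]; linarith
    have hxb : x ≤ 1 := by rw [hx, hs]; linarith
    have hx0 : 0 ≤ x := le_trans (by nlinarith) hxa
    rw [sv, if_pos hx0]
    have e2 : exp (-x) ≤ 1 - x/2 := by
      have : exp (-x) ≤ 1 / (1 + x) := by
        rw [Real.exp_neg, inv_eq_one_div]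
        exact one_div_le_one_div_of_le (by linarith) (by linarith [Real.add_one_le_exp x])
      refine this.trans ?_
      rw [div_le_iff₀ (by linarith)]; nlinarith
    have e3 := mul_le_mul_of_nonneg_left e2 hp0
    have e4 := mul_le_mul_of_nonneg_left hxa hp0
    have e5 := Real.add_one_le_exp (-(p * (a * Δ) / 2))
    linarith
  refine (Finset.prod_le_prod' hv).trans ?_
  rw [Finset.prod_const, ← ENNReal.ofReal_pow (Real.exp_pos _).le, ← Real.exp_nat_mul]
  apply ENNReal.ofReal_le_ofReal
  apply Real.exp_le_exp.2
  have hN : (0:ℝ) < N := by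
    rcases Nat.eq_zero_or_pos N with h | h
    · subst h; exact o.elim0
    · exact_mod_cast h
  have h6 := mul_le_mul_of_nonneg_left hcard (mul_nonneg hp0 hΔ.le)
  have h7 : p * Δ * N = a := by rw [hadef]; ring
  nlinarith

lemma measurableSet_lastev (o : Fin N) (s : ℝ) :
    MeasurableSet {x : Cf N × St N | ofReal s < mm (tt o x.1) x.2} := by
  unfold mm
  refine measurableSet_lt measurable_const (Measurable.iInf fun v => ?_)
  exact ((measurable_tt o v).comp measurable_fst).add (measurable_ew.comp ((measurable_pi_apply v).comp measurable_snd))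

lemma last_step {o u : Fin N} (hu : u ≠ o) {Δ : ℝ} (hΔ : 0 < Δ) (ha : 128 ≤ N * p * Δ) (haΔ : (N * p * Δ + 1) * Δ ≤ 1) :
    PP N p {z | ∃ k : ℕ, WW o Δ (N * p * Δ) k (cavz u z) ∧ ofReal (k * Δ + N * p * Δ * Δ) < tt o z u} ≤
      ofReal (exp (-(N * p * Δ / 4))) := by
  classical
  obtain ⟨A, hA⟩ : ∃ A : Set (Cf N × St N), A = {x | ∃ k : ℕ, WW o Δ (N * p * Δ) k x.1 ∧
    ofReal (k * Δ + N * p * Δ * Δ) < mm (tt o x.1) x.2} := ⟨_, rfl⟩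
  have hAm : MeasurableSet A := by
    rw [hA]
    have : {x : Cf N × St N | ∃ k : ℕ, WW o Δ (N * p * Δ) k x.1 ∧
      ofReal (k * Δ + N * p * Δ * Δ) < mm (tt o x.1) x.2} = ⋃ k : ℕ, (Prod.fst ⁻¹' {z : Cf N | WW o Δ (N * p * Δ) k z}) ∩ {x : Cf N × St N | ofReal (k * Δ + N * p * Δ * Δ) < mm (tt o x.1) x.2} := by
      ext x; simp
    rw [this]
    exact MeasurableSet.iUnion fun k => (measurable_fst (measurableSet_WW o Δ _ k)).inter (measurableSet_lastev o _)
  have h1 := lint_cav_star p u (fun z y => A.indicator (1 : Cf N × St N → ℝ≥0∞) (z, y)) (by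
    have : Function.uncurry (fun (z : Cf N) (y : St N) => A.indicator (1 : Cf N × St N → ℝ≥0∞) (z, y)) = A.indicator 1 := by
      funext x; rfl
    rw [this]; exact measurable_one.indicator hAm)
  have h2 : PP N p {z | ∃ k : ℕ, WW o Δ (N * p * Δ) k (cavz u z) ∧ ofReal (k * Δ + N * p * Δ * Δ) < tt o z u} ≤
      ∫⁻ z, A.indicator (1 : Cf N × St N → ℝ≥0∞) (cavz u z, star u z) ∂(PP N p) := by
    have hm : Measurable fun z : Cf N => (cavz u z, star u z) := (measurable_cavz u).prodMk (measurable_star u)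
    have e : ∀ z : Cf N, A.indicator (1 : Cf N × St N → ℝ≥0∞) (cavz u z, star u z) =
      ((fun z : Cf N => (cavz u z, star u z)) ⁻¹' A).indicator 1 z := fun z => rfl
    simp only [e]
    rw [lintegral_indicator_one (hm hAm)]
    refine measure_mono_ae ?_
    filter_upwards [ae_Pos p] with z hz
    rintro ⟨k, hk1, hk2⟩
    rw [tt_eq_mm hu hz] at hk2
    show (cavz u z, star u z) ∈ A
    rw [hA]
    exact ⟨k, hk1, hk2⟩
  refine h2.trans (h1.le.trans ?_)
  have h3 : ∀ z : Cf N, ∫⁻ y, A.indicator (1 : Cf N × St N → ℝ≥0∞) (cavz u z, y) ∂(QQ N p) ≤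
      ofReal (exp (-(N * p * Δ / 4))) := by
    intro z
    have e : ∀ y : St N, A.indicator (1 : Cf N × St N → ℝ≥0∞) (cavz u z, y) =
      ((fun y : St N => (cavz u z, y)) ⁻¹' A).indicator 1 y := fun y => rfl
    simp only [e]
    have hm : Measurable fun y : St N => (cavz u z, y) := measurable_prodMk_left
    rw [lintegral_indicator_one (hm hAm)]
    by_cases hk : ∃ k, WW o Δ (N * p * Δ) k (cavz u z)
    · refine (measure_mono ?_).trans (last_c p o hΔ ha haΔ (Nat.find hk) (cavz u z) (Nat.find_spec hk))
      intro y hy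
      have hy : (cavz u z, y) ∈ A := hy
      rw [hA] at hy
      obtain ⟨j, hj1, hj2⟩ := hy
      refine lt_of_le_of_lt (ENNReal.ofReal_le_ofReal ?_) hj2
      have : ((Nat.find hk : ℕ) : ℝ) ≤ j := by exact_mod_cast Nat.find_min' hk hj1
      nlinarith
    · have : (fun y : St N => (cavz u z, y)) ⁻¹' A = ∅ := by
        ext y
        simp only [Set.mem_preimage, Set.mem_empty_iff_false, iff_false]
        rw [hA]
        rintro ⟨j, hj1, _⟩
        exact hk ⟨j, hj1⟩
      rw [this]; simp
  refine (lintegral_mono h3).trans ?_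
  simp

end FPP

namespace FPP
variable (p : ℝ) [hp : Fact (0 ≤ p ∧ p ≤ 1)] {N : ℕ}

def Fresh (o u : Fin N) (z : Cf N) : Prop :=
  ∀ v, v ≠ o → tt o z v ≤ tt o z u →
    2 * (Finset.univ.filter fun w => tt o z w + 1 ≤ tt o z v).card ≤ (Finset.univ.filter fun w => tt o z w < tt o z v).card

lemma WW_cav {o u : Fin N} {z : Cf N} (hz : Pos z) {Δ a : ℝ} {k : ℕ}
    (h : ofReal (k * Δ) < tt o z u) (hW : WW o Δ a k z) : WW o Δ a k (cavz u z) := by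
  have hb : ball o (cavz u z) (k * Δ) = ball o z (k * Δ) := by
    ext v
    simp only [mem_ball]
    constructor
    · exact fun h1 => (tt_le_cavz o u z v).trans h1
    · intro h1; rwa [tt_cav_eq hz (h1.trans_lt h)]
  unfold WW Rec at *
  rw [hb]
  refine ⟨le_trans (Nat.mul_le_mul_left 2 (Finset.card_le_card ?_)) hW.1, hW.2⟩
  intro v
  simp only [Finset.mem_filter, Finset.mem_univ, true_and]
  exact fun h1 => (add_le_add_left (tt_le_cavz o u z v) _).trans h1

lemma fresh_aux {o v : Fin N} {z : Cf N} {Δ x : ℝ} {j : ℕ} (hΔ : 0 < Δ) (hx : tt o z v = ofReal x)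
    (hj : j * Δ < x) (hj2 : x + Δ ≤ j * Δ + 1) (hr : Rec o z (j * Δ) Δ) :
    2 * (Finset.univ.filter fun w => tt o z w + 1 ≤ tt o z v).card ≤ (Finset.univ.filter fun w => tt o z w < tt o z v).card := by
  have hj0 : 0 ≤ j * Δ := by positivity
  unfold Rec at hr
  refine le_trans (Nat.mul_le_mul_left 2 (Finset.card_le_card ?_)) (hr.trans (Finset.card_le_card ?_))
  · intro w
    simp only [Finset.mem_filter, Finset.mem_univ, true_and]
    intro h
    rw [hx] at h
    have hw : tt o z w ≠ ⊤ := by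
      intro ht; rw [ht, top_add] at h; exact ENNReal.ofReal_ne_top (top_le_iff.1 h)
    rw [← ENNReal.ofReal_toReal hw] at h ⊢
    rw [← ENNReal.ofReal_one, ← ENNReal.ofReal_add ENNReal.toReal_nonneg (by norm_num), ENNReal.ofReal_le_ofReal_iff (by linarith)] at h
    rw [← ENNReal.ofReal_add ENNReal.toReal_nonneg hΔ.le]
    exact ENNReal.ofReal_le_ofReal (by linarith)
  · intro w
    simp only [Finset.mem_filter, Finset.mem_univ, true_and, mem_ball]
    intro h
    rw [hx]
    exact h.trans_lt ((ENNReal.ofReal_lt_ofReal_iff (by linarith)).2 hj)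

lemma good_det {o u : Fin N} (hu : u ≠ o) {z : Cf N} (hz : Pos z) {Δ a : ℝ} (hΔ : 0 < Δ) (ha : 1 ≤ a)
    (haΔ : (a + 1) * Δ ≤ 1) (hD : Dbl o Δ a z)
    (hL : ¬ ∃ k : ℕ, WW o Δ a k (cavz u z) ∧ ofReal (k * Δ + a * Δ) < tt o z u) :
    tt o z u ≤ ofReal ((1 + 2 * log N + a) * Δ) ∧ Fresh o u z := by
  classical
  have hNpos : (0:ℝ) < N := by
    rcases Nat.eq_zero_or_pos N with h | h
    · subst h; exact o.elim0
    · exact_mod_cast h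
  have hK : ∃ k : ℕ, (N:ℝ) < a * (ball o z (k * Δ)).card := by
    by_contra hc
    push Not at hc
    have h1 := (dbl_rec o z hΔ N fun j _ => hD j (hc j)).2
    have h2 : (ball o z (N * Δ)).card ≤ N := by simpa using Finset.card_le_univ (ball o z (N * Δ))
    have := Nat.lt_two_pow_self (n := N)
    omega
  obtain ⟨K, hKs, hKm⟩ : ∃ K : ℕ, (N:ℝ) < a * (ball o z (K * Δ)).card ∧ ∀ j < K, a * (ball o z (j * Δ)).card ≤ N :=
    ⟨Nat.find hK, Nat.find_spec hK, fun j hj => not_lt.1 (Nat.find_min hK hj)⟩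
  have hrec : ∀ j ≤ K, Rec o z (j * Δ) Δ ∧ 2 ^ j ≤ (ball o z (j * Δ)).card := fun j hj =>
    dbl_rec o z hΔ j fun i hi => hD i (hKm i (by omega))
  have hKL : (K:ℝ) ≤ 1 + 2 * log N := by
    have hl0 : 0 ≤ log N := Real.log_natCast_nonneg N
    rcases Nat.eq_zero_or_pos K with h | h
    · subst h; simp; linarith
    · obtain ⟨j, rfl⟩ : ∃ j, K = j + 1 := ⟨K - 1, by omega⟩
      have h1 := (hrec j (by omega)).2
      have h2 : (ball o z (j * Δ)).card ≤ N := by simpa using Finset.card_le_univ (ball o z (j * Δ))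
      have h3 : ((2:ℝ) ^ j) ≤ N := by exact_mod_cast h1.trans h2
      have h4 := Real.log_le_log (by positivity) h3
      rw [Real.log_pow] at h4
      have h5 := Real.log_two_gt_d9
      push_cast
      nlinarith [(Nat.cast_nonneg j : (0:ℝ) ≤ j)]
  have hTu : tt o z u ≤ ofReal (K * Δ + a * Δ) := by
    by_contra hc
    rw [not_le] at hc
    refine hL ⟨K, WW_cav hz (lt_of_le_of_lt (ENNReal.ofReal_le_ofReal ?_) hc) ⟨(hrec K le_rfl).1, hKs⟩, hc⟩
    nlinarith
  refine ⟨hTu.trans (ENNReal.ofReal_le_ofReal (by nlinarith)), ?_⟩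
  intro v hv hvu
  have hvt : tt o z v ≠ ⊤ := ne_top_of_le_ne_top ENNReal.ofReal_ne_top (hvu.trans hTu)
  obtain ⟨x, hx⟩ : ∃ x, x = (tt o z v).toReal := ⟨_, rfl⟩
  have hxv : tt o z v = ofReal x := by rw [hx, ENNReal.ofReal_toReal hvt]
  have hx0 : 0 < x := by rw [hx]; exact ENNReal.toReal_pos (tt_pos hz hv).ne' hvt
  have hxK : x ≤ K * Δ + a * Δ := by
    have := hvu.trans hTu
    rw [hxv, ENNReal.ofReal_le_ofReal_iff (by positivity)] at this
    exact this
  obtain ⟨k, hk1, hk2⟩ : ∃ k : ℕ, k * Δ < x ∧ x ≤ (k + 1) * Δ := by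
    have h1 : 0 < ⌈x / Δ⌉₊ := Nat.ceil_pos.2 (by positivity)
    refine ⟨⌈x / Δ⌉₊ - 1, ?_, ?_⟩
    · have : ⌈x / Δ⌉₊ - 1 < ⌈x / Δ⌉₊ := by omega
      rw [Nat.lt_ceil, lt_div_iff₀ hΔ] at this
      exact this
    · have := Nat.le_ceil (x / Δ)
      rw [div_le_iff₀ hΔ] at this
      rw [Nat.cast_sub h1]; push_cast
      linarith
  by_cases hkK : k ≤ K
  · exact fresh_aux hΔ hxv hk1 (by nlinarith) (hrec k hkK).1
  · have : (K:ℝ) ≤ k := by exact_mod_cast (not_le.1 hkK).le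
    exact fresh_aux hΔ hxv (by nlinarith) (by nlinarith) (hrec K le_rfl).1

lemma growth_main {o u : Fin N} (hu : u ≠ o) {Δ : ℝ} (hΔ : 0 < Δ) (ha : 128 ≤ N * p * Δ) (haΔ : (N * p * Δ + 1) * Δ ≤ 1) :
    PP N p {z | ¬ (tt o z u ≤ ofReal ((1 + 2 * log N + N * p * Δ) * Δ) ∧ Fresh o u z)} ≤
      ofReal (3 * exp (-(N * p * Δ / 128))) := by
  have h1 := P_Dbl p o hΔ (by nlinarith) ha
  have h2 := last_step p hu hΔ ha haΔ
  have h3 : PP N p {z | ¬ (tt o z u ≤ ofReal ((1 + 2 * log N + N * p * Δ) * Δ) ∧ Fresh o u z)} ≤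
     PP N p ({z | ¬ Dbl o Δ (N * p * Δ) z} ∪ {z | ∃ k : ℕ, WW o Δ (N * p * Δ) k (cavz u z) ∧ ofReal (k * Δ + N * p * Δ * Δ) < tt o z u}) := by
    refine measure_mono_ae ?_
    filter_upwards [ae_Pos p] with z hz h
    by_contra hc
    have hc1 : Dbl o Δ (N * p * Δ) z := by
      by_contra h'; exact hc (Or.inl h')
    exact h (good_det hu hz hΔ (by linarith) haΔ hc1 fun h' => hc (Or.inr h'))
  refine h3.trans ((measure_union_le _ _).trans ((add_le_add h1 h2).trans ?_))
  rw [← ENNReal.ofReal_add (by positivity) (by positivity)]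
  apply ENNReal.ofReal_le_ofReal
  have : exp (-(N * p * Δ / 4)) ≤ exp (-(N * p * Δ / 128)) := Real.exp_le_exp.2 (by linarith)
  linarith

end FPP

namespace FPP

section absord
variable {ι : Type*} [DecidableEq ι]

def blw (f : ι → ℝ) (s : Finset ι) (u : ι) : Finset ι := s.filter fun v => f v < f u

lemma tele {M : Type*} [AddCommGroup M] (G : Finset ι → M) (f : ι → ℝ) (s : Finset ι) (hinj : Set.InjOn f s) :
    ∑ u ∈ s, (G (insert u (blw f s u)) - G (blw f s u)) = G s - G ∅ := by
  induction s using Finset.induction_on_max_value f with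
  | empty => simp
  | insert a s ha hmax ih =>
    have hlt : ∀ x ∈ s, f x < f a := fun x hx => lt_of_le_of_ne (hmax x hx) fun h =>
      ha (hinj (by simp [hx]) (by simp) h ▸ hx)
    have h1 : ∀ u ∈ s, blw f (insert a s) u = blw f s u := by
      intro u hu
      unfold blw
      rw [Finset.filter_insert, if_neg (not_lt.2 (hmax u hu))]
    have h2 : blw f (insert a s) a = s := by
      unfold blw
      rw [Finset.filter_insert, if_neg (lt_irrefl _)]
      exact Finset.filter_true_of_mem hlt
    rw [Finset.sum_insert ha, h2, Finset.sum_congr rfl (fun u hu => by rw [h1 u hu]),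
      ih (hinj.mono (by simp))]
    abel

def Aa (f : ι → ℝ) (s : Finset ι) : ℝ := 1 + ∑ v ∈ s, exp (f v)
def Bb (f : ι → ℝ) (x : ι → ℂ) (s : Finset ι) : ℂ := 1 + ∑ v ∈ s, x v * (exp (f v) : ℝ)

lemma Aa_ge (f : ι → ℝ) (s : Finset ι) : 1 ≤ Aa f s := by
  unfold Aa
  linarith [Finset.sum_nonneg (fun v (_ : v ∈ s) => (Real.exp_pos (f v)).le)]

lemma Bb_norm (f : ι → ℝ) (x : ι → ℂ) (hx : ∀ v, ‖x v‖ ≤ 1) (s : Finset ι) : ‖Bb f x s‖ ≤ Aa f s := by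
  unfold Aa Bb
  refine (norm_add_le _ _).trans ?_
  rw [norm_one]
  gcongr
  refine (norm_sum_le _ _).trans (Finset.sum_le_sum fun v _ => ?_)
  rw [norm_mul, Complex.norm_real, Real.norm_of_nonneg (Real.exp_pos _).le]
  exact mul_le_of_le_one_left (Real.exp_pos _).le (hx v)

def qq (f : ι → ℝ) (s : Finset ι) (u : ι) : ℝ := exp (f u) / (Aa f (blw f s u) + exp (f u))

lemma qq_pos (f : ι → ℝ) (s : Finset ι) (u : ι) : 0 < qq f s u := by
  have := Aa_ge f (blw f s u)
  unfold qq; positivity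
lemma qq_lt (f : ι → ℝ) (s : Finset ι) (u : ι) : qq f s u < 1 := by
  have := Aa_ge f (blw f s u)
  have := Real.exp_pos (f u)
  unfold qq; rw [div_lt_one (by linarith)]; linarith

lemma not_mem_blw (f : ι → ℝ) (s : Finset ι) (u : ι) : u ∉ blw f s u := by simp [blw]

lemma Aa_insert (f : ι → ℝ) {s : Finset ι} {u : ι} (h : u ∉ s) : Aa f (insert u s) = Aa f s + exp (f u) := by
  unfold Aa; rw [Finset.sum_insert h]; ring
lemma Bb_insert (f : ι → ℝ) (x : ι → ℂ) {s : Finset ι} {u : ι} (h : u ∉ s) :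
    Bb f x (insert u s) = Bb f x s + x u * (exp (f u) : ℝ) := by
  unfold Bb; rw [Finset.sum_insert h]; ring

lemma log_Aa (f : ι → ℝ) (s : Finset ι) (hinj : Set.InjOn f s) :
    log (Aa f s) = ∑ u ∈ s, -log (1 - qq f s u) := by
  have h := tele (fun s => log (Aa f s)) f s hinj
  have h0 : Aa f ∅ = 1 := by simp [Aa]
  simp only [h0, Real.log_one, sub_zero] at h
  rw [← h]
  refine Finset.sum_congr rfl fun u _ => ?_
  have h1 := Aa_ge f (blw f s u)
  have h2 := Real.exp_pos (f u)
  rw [Aa_insert f (not_mem_blw f s u), ← Real.log_inv, ← Real.log_div (by linarith) (by linarith)]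
  congr 1
  unfold qq
  have : Aa f (blw f s u) + exp (f u) ≠ 0 := by linarith
  have h3 : 1 - exp (f u) / (Aa f (blw f s u) + exp (f u)) = Aa f (blw f s u) / (Aa f (blw f s u) + exp (f u)) := by
    field_simp; ring
  rw [h3, inv_div]

lemma sum_qq_le (f : ι → ℝ) (s : Finset ι) (hinj : Set.InjOn f s) :
    ∑ u ∈ s, qq f s u ≤ log (Aa f s) := by
  rw [log_Aa f s hinj]
  refine Finset.sum_le_sum fun u _ => ?_
  have := Real.log_le_sub_one_of_pos (x := 1 - qq f s u) (by linarith [qq_lt f s u])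
  linarith

lemma log_le_sum_qq (f : ι → ℝ) (s : Finset ι) (hinj : Set.InjOn f s) (h : ∀ u ∈ s, qq f s u ≤ 6 / 7) :
    log (Aa f s) ≤ ∑ u ∈ s, qq f s u + 7 * ∑ u ∈ s, qq f s u ^ 2 := by
  rw [log_Aa f s hinj, Finset.mul_sum, ← Finset.sum_add_distrib]
  refine Finset.sum_le_sum fun u hu => ?_
  have h1 := h u hu
  have h2 := qq_pos f s u
  set q := qq f s u
  rw [← Real.log_inv]
  have h3 := Real.log_le_sub_one_of_pos (x := (1 - q)⁻¹) (by apply inv_pos.2; linarith)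
  refine h3.trans ?_
  have h4 : (1 - q)⁻¹ - 1 = q + q ^ 2 * (1 - q)⁻¹ := by
    have : 1 - q ≠ 0 := by linarith
    field_simp; ring
  have h5 : (1 - q)⁻¹ ≤ 7 := by
    rw [inv_le_comm₀ (by linarith) (by norm_num)]; linarith
  rw [h4]
  nlinarith [sq_nonneg q]

lemma sum_qq_sq (f : ι → ℝ) (s : Finset ι) (hinj : Set.InjOn f s)
    (h : ∀ u ∈ s, qq f s u ≤ 6 / (7 + ((blw f s u).card : ℝ))) : ∑ u ∈ s, qq f s u ^ 2 ≤ 6 := by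
  have ht := tele (fun s : Finset ι => -36 / (6 + (s.card : ℝ))) f s hinj
  have : ∑ u ∈ s, qq f s u ^ 2 ≤ -36 / (6 + (s.card : ℝ)) - -36 / (6 + ((∅ : Finset ι).card : ℝ)) := by
    rw [← ht]
    refine Finset.sum_le_sum fun u hu => ?_
    rw [Finset.card_insert_of_notMem (not_mem_blw f s u)]
    have h1 := h u hu
    set r : ℝ := ((blw f s u).card : ℝ) with hr
    have hr0 : 0 ≤ r := by positivity
    push_cast
    rw [← hr]
    calc qq f s u ^ 2 ≤ (6 / (7 + r)) ^ 2 := pow_le_pow_left₀ (qq_pos f s u).le h1 2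
      _ ≤ _ := by
        rw [div_pow, div_sub_div _ _ (by positivity) (by positivity), div_le_div_iff₀ (by positivity) (by positivity)]
        nlinarith [mul_nonneg hr0 hr0, mul_nonneg hr0 (mul_nonneg hr0 hr0)]
  refine this.trans ?_
  have h6 : 0 ≤ 36 / (6 + (s.card : ℝ)) := by positivity
  rw [neg_div]
  simp
  linarith

def fct (ζ : ℂ) (q : ℝ) : ℂ := 1 + (ζ - 1) * (q : ℂ)

lemma tele_B (ζ : ℂ) (f : ι → ℝ) (x : ι → ℂ) (s : Finset ι) (hinj : Set.InjOn f s)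
    (w : ι → ℂ) (hw : ∀ u ∈ s, w u = fct ζ (qq f s u)) (hw0 : ∀ u ∈ s, w u ≠ 0) :
    Bb f x s / (Aa f s * ∏ v ∈ s, w v) = 1 + ∑ u ∈ s,
      (x u - ζ * (Bb f x (blw f s u) / Aa f (blw f s u))) * qq f s u / ((∏ v ∈ blw f s u, w v) * w u) := by
  have ht := tele (fun s => Bb f x s / (Aa f s * ∏ v ∈ s, w v)) f s hinj
  have h0 : Bb f x ∅ / ((Aa f ∅ : ℝ) * ∏ v ∈ (∅ : Finset ι), w v) = 1 := by simp [Bb, Aa]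
  simp only [h0] at ht
  rw [← sub_eq_iff_eq_add', ← ht]
  refine Finset.sum_congr rfl fun u hu => ?_
  have hn := not_mem_blw f s u
  rw [Aa_insert f hn, Bb_insert f x hn, Finset.prod_insert hn]
  have hA := Aa_ge f (blw f s u)
  have he := Real.exp_pos (f u)
  have hA0 : (Aa f (blw f s u) : ℂ) ≠ 0 := by exact_mod_cast (by linarith : Aa f (blw f s u) ≠ 0)
  have hAe : ((Aa f (blw f s u) + exp (f u) : ℝ) : ℂ) ≠ 0 := by
    exact_mod_cast (by linarith : Aa f (blw f s u) + exp (f u) ≠ 0)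
  have hP : ∏ v ∈ blw f s u, w v ≠ 0 := Finset.prod_ne_zero_iff.2 fun v hv => hw0 v (Finset.mem_of_mem_filter v hv)
  have hwu := hw0 u hu
  have hwe := hw u hu
  have hq : ((qq f s u : ℝ) : ℂ) = (exp (f u) : ℝ) / ((Aa f (blw f s u) + exp (f u) : ℝ) : ℂ) := by
    unfold qq; push_cast; rfl
  unfold fct at hwe
  rw [hq] at hwe ⊢
  generalize (∏ v ∈ blw f s u, w v) = P at *
  generalize Bb f x (blw f s u) = B at *
  push_cast at *
  generalize (Aa f (blw f s u) : ℂ) = A at *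
  generalize Complex.exp (f u : ℂ) = e at *
  generalize w u = W at *
  have hwe' : W * (A + e) = A + ζ * e := by rw [hwe]; field_simp; ring
  field_simp
  linear_combination (-B) * hwe'

lemma fct_norm_sq (η q : ℝ) : ‖fct (Complex.exp (η * Complex.I)) q‖ ^ 2 = 1 - 2 * q * (1 - q) * (1 - Real.cos η) := by
  rw [← Complex.normSq_eq_norm_sq, Complex.normSq_apply]
  have hre : (fct (Complex.exp (η * Complex.I)) q).re = 1 + (Real.cos η - 1) * q := by
    simp [fct, Complex.exp_ofReal_mul_I_re]
  have him : (fct (Complex.exp (η * Complex.I)) q).im = Real.sin η * q := by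
    simp [fct, Complex.exp_ofReal_mul_I_im]
  rw [hre, him]
  linear_combination q ^ 2 * Real.sin_sq_add_cos_sq η

lemma fct_norm_le (η : ℝ) {q : ℝ} (h0 : 0 ≤ q) (h1 : q ≤ 1) : ‖fct (Complex.exp (η * Complex.I)) q‖ ≤ 1 := by
  have h := fct_norm_sq η q
  have hc := Real.cos_le_one η
  have : ‖fct (Complex.exp (η * Complex.I)) q‖ ^ 2 ≤ 1 := by
    rw [h]; nlinarith [mul_nonneg (mul_nonneg h0 (sub_nonneg.2 h1)) (sub_nonneg.2 hc)]
  nlinarith [norm_nonneg (fct (Complex.exp (η * Complex.I)) q)]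

lemma fct_norm_ge {η : ℝ} (hη : η ^ 2 ≤ 1) {q : ℝ} (h0 : 0 ≤ q) (h1 : q ≤ 1) :
    exp (-(η ^ 2 * q)) ≤ ‖fct (Complex.exp (η * Complex.I)) q‖ := by
  have h := fct_norm_sq η q
  have hc := Real.one_sub_sq_div_two_le_cos (x := η)
  have hc1 := Real.cos_le_one η
  set y := q * (1 - q) * η ^ 2 with hy
  have hqq : 0 ≤ q * (1 - q) := mul_nonneg h0 (sub_nonneg.2 h1)
  have hy0 : 0 ≤ y := by positivity
  have hy1 : y ≤ 1 / 4 := by nlinarith [sq_nonneg (q - 1/2), sq_nonneg η]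
  have h2 : 1 - y ≤ ‖fct (Complex.exp (η * Complex.I)) q‖ ^ 2 := by
    rw [h]; nlinarith
  have h3 : exp (-(2 * y)) ≤ 1 - y := by
    rw [Real.exp_neg, inv_le_comm₀ (Real.exp_pos _) (by linarith)]
    have h4 := Real.add_one_le_exp (2 * y)
    refine le_trans ?_ h4
    rw [inv_le_iff_one_le_mul₀ (by linarith)]
    nlinarith
  have h5 : exp (-(η ^ 2 * q)) ^ 2 ≤ exp (-(2 * y)) := by
    rw [← Real.exp_nat_mul]
    apply Real.exp_le_exp.2
    push_cast
    nlinarith [mul_nonneg (mul_nonneg h0 h0) (sq_nonneg η)]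
  exact (le_abs_self _).trans (abs_le_of_sq_le_sq (h5.trans (h3.trans h2)) (norm_nonneg _))

lemma prod_fct_ge {η : ℝ} (hη : η ^ 2 ≤ 1) (s : Finset ι) (q : ι → ℝ) (h0 : ∀ u ∈ s, 0 ≤ q u) (h1 : ∀ u ∈ s, q u ≤ 1) :
    exp (-(η ^ 2 * ∑ u ∈ s, q u)) ≤ ‖∏ u ∈ s, fct (Complex.exp (η * Complex.I)) (q u)‖ := by
  rw [norm_prod, Finset.mul_sum, ← Finset.sum_neg_distrib, Real.exp_sum]
  exact Finset.prod_le_prod (fun _ _ => (Real.exp_pos _).le) fun u hu => fct_norm_ge hη (h0 u hu) (h1 u hu)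

lemma zeta_sub_one (η : ℝ) : ‖Complex.exp (η * Complex.I) - 1‖ ≤ |η| := by
  have := Real.norm_exp_I_mul_ofReal_sub_one_le (x := η)
  rwa [mul_comm, Real.norm_eq_abs] at this

lemma exp_norm_le {η q : ℝ} (h0 : 0 ≤ q) : ‖Complex.exp ((Complex.exp (η * Complex.I) - 1) * q)‖ ≤ 1 := by
  rw [Complex.norm_exp]
  have : ((Complex.exp (η * Complex.I) - 1) * q).re = (Real.cos η - 1) * q := by
    simp [Complex.exp_ofReal_mul_I_re]
  rw [this]
  apply Real.exp_le_one_iff.2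
  nlinarith [Real.cos_le_one η]

lemma prod_fct_exp {η : ℝ} (hη : η ^ 2 ≤ 1) (s : Finset ι) (q : ι → ℝ) (h0 : ∀ u ∈ s, 0 ≤ q u) (h1 : ∀ u ∈ s, q u ≤ 1) :
    ‖∏ u ∈ s, fct (Complex.exp (η * Complex.I)) (q u) - Complex.exp ((Complex.exp (η * Complex.I) - 1) * (∑ u ∈ s, q u : ℝ))‖
      ≤ η ^ 2 * ∑ u ∈ s, q u ^ 2 := by
  induction s using Finset.induction_on with
  | empty => simp
  | insert a s ha ih =>
    have ih := ih (fun u hu => h0 u (by simp [hu])) (fun u hu => h1 u (by simp [hu]))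
    have ha0 := h0 a (by simp)
    have ha1 := h1 a (by simp)
    rw [Finset.prod_insert ha, Finset.sum_insert ha, Finset.sum_insert ha]
    set P := ∏ u ∈ s, fct (Complex.exp (η * Complex.I)) (q u)
    set S := ∑ u ∈ s, q u with hS
    have hS0 : 0 ≤ S := Finset.sum_nonneg fun u hu => h0 u (by simp [hu])
    have hfe : ‖fct (Complex.exp (η * Complex.I)) (q a) - Complex.exp ((Complex.exp (η * Complex.I) - 1) * (q a : ℝ))‖ ≤ η ^ 2 * q a ^ 2 := by
      set w := (Complex.exp (η * Complex.I) - 1) * (q a : ℂ) with hw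
      have hwn : ‖w‖ ≤ |η| * q a := by
        rw [hw, norm_mul, Complex.norm_real, Real.norm_of_nonneg ha0]
        exact mul_le_mul_of_nonneg_right (zeta_sub_one η) ha0
      have hη1 : |η| ≤ 1 := by rw [← sq_le_one_iff_abs_le_one]; exact hη
      have hw1 : ‖w‖ ≤ 1 := hwn.trans (mul_le_one₀ hη1 ha0 ha1)
      have h2 := Complex.norm_exp_sub_one_sub_id_le hw1
      have : fct (Complex.exp (η * Complex.I)) (q a) - Complex.exp w = -(Complex.exp w - 1 - w) := by
        unfold fct; rw [← hw]; ring
      rw [this, norm_neg]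
      refine h2.trans ?_
      calc ‖w‖ ^ 2 ≤ (|η| * q a) ^ 2 := pow_le_pow_left₀ (norm_nonneg _) hwn 2
        _ = _ := by rw [mul_pow, sq_abs]
    have hexp : Complex.exp ((Complex.exp (η * Complex.I) - 1) * ((q a + S : ℝ) : ℂ)) =
      Complex.exp ((Complex.exp (η * Complex.I) - 1) * (q a : ℝ)) * Complex.exp ((Complex.exp (η * Complex.I) - 1) * (S : ℝ)) := by
      rw [← Complex.exp_add]; congr 1; push_cast; ring
    rw [hexp]
    set X := fct (Complex.exp (η * Complex.I)) (q a) with hX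
    set X' := Complex.exp ((Complex.exp (η * Complex.I) - 1) * (q a : ℝ)) with hX'
    set E := Complex.exp ((Complex.exp (η * Complex.I) - 1) * (S : ℝ)) with hE
    have e1 : X * P - X' * E = X * (P - E) + (X - X') * E := by ring
    have hXn : ‖X‖ ≤ 1 := fct_norm_le η ha0 ha1
    have hEn : ‖E‖ ≤ 1 := exp_norm_le hS0
    rw [e1]
    refine (norm_add_le _ _).trans ?_
    rw [norm_mul, norm_mul]
    nlinarith [norm_nonneg (P - E), norm_nonneg (X - X'), norm_nonneg X, norm_nonneg E,
      mul_le_mul hXn (le_refl ‖P - E‖) (norm_nonneg _) zero_le_one,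
      mul_le_mul (le_refl ‖X - X'‖) hEn (norm_nonneg _) (norm_nonneg _)]
end absord

end FPP

namespace FPP
variable (p : ℝ) [hp : Fact (0 ≤ p ∧ p ≤ 1)] {N : ℕ}

structure Nice (o : Fin N) (c : Fin N → ℝ≥0∞) : Prop where
  root : c o = 0
  pos : ∀ v, v ≠ o → 0 < c v
  inj : ∀ u v, u ≠ v → c u = c v → c u = ⊤

lemma ae_Nice (o : Fin N) : ∀ᵐ z ∂(PP N p), Nice o (tt o z) := by
  filter_upwards [ae_Pos p, ae_inj p o] with z h1 h2
  exact ⟨tt_o o z, fun v hv => tt_pos h1 hv, h2⟩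

def fc (c : Fin N → ℝ≥0∞) (v : Fin N) : ℝ := (c v).toReal
def sx (o : Fin N) (c : Fin N → ℝ≥0∞) (t : ℝ) : Finset (Fin N) := (ac c t).erase o
def pq (c : Fin N → ℝ≥0∞) (t : ℝ) : ℝ := exp t / (aa c t + exp t)
def RR (ζ : ℂ) (o : Fin N) (c : Fin N → ℝ≥0∞) (t : ℝ) : ℂ := ∏ v ∈ sx o c t, fct ζ (pq c (fc c v))
def RP (ζ : ℂ) (o : Fin N) (c : Fin N → ℝ≥0∞) (t : ℝ) : ℂ := RR ζ o c t * fct ζ (pq c t)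

lemma aa_nonneg (c : Fin N → ℝ≥0∞) (t : ℝ) : 0 ≤ aa c t := Finset.sum_nonneg fun _ _ => (Real.exp_pos _).le
lemma pq_pos (c : Fin N → ℝ≥0∞) (t : ℝ) : 0 < pq c t := by
  have := aa_nonneg c t
  unfold pq; positivity
lemma pq_le (c : Fin N → ℝ≥0∞) (t : ℝ) : pq c t ≤ 1 := by
  have := aa_nonneg c t
  have := Real.exp_pos t
  unfold pq; rw [div_le_one (by linarith)]; linarith

structure Low (o : Fin N) (c : Fin N → ℝ≥0∞) (s : Finset (Fin N)) : Prop where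
  ne : ∀ u ∈ s, u ≠ o
  fin : ∀ u ∈ s, c u ≠ ⊤
  low : ∀ u ∈ s, ∀ v, v ≠ o → c v < c u → v ∈ s

lemma mem_sx {o : Fin N} {c : Fin N → ℝ≥0∞} {t : ℝ} {v : Fin N} : v ∈ sx o c t ↔ v ≠ o ∧ c v < ofReal t := by
  unfold sx; rw [Finset.mem_erase, mem_ac]

lemma low_sx (o : Fin N) (c : Fin N → ℝ≥0∞) (t : ℝ) : Low o c (sx o c t) :=
  ⟨fun _ hu => (mem_sx.1 hu).1, fun _ hu => ((mem_sx.1 hu).2.trans_le le_top).ne,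
    fun _ hu _ hv h => mem_sx.2 ⟨hv, h.trans (mem_sx.1 hu).2⟩⟩

lemma Low.injOn {o : Fin N} {c : Fin N → ℝ≥0∞} {s : Finset (Fin N)} (h : Low o c s) (hc : Nice o c) :
    Set.InjOn (fc c) s := by
  intro u hu v hv huv
  by_contra hne
  exact h.fin u hu (hc.inj u v hne ((ENNReal.toReal_eq_toReal_iff' (h.fin u hu) (h.fin v hv)).1 huv))

lemma Low.blw {o : Fin N} {c : Fin N → ℝ≥0∞} {s : Finset (Fin N)} (h : Low o c s) {u : Fin N} (hu : u ∈ s) :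
    blw (fc c) s u = sx o c (fc c u) := by
  ext v
  unfold FPP.blw
  rw [Finset.mem_filter, mem_sx]
  unfold fc
  rw [ENNReal.ofReal_toReal (h.fin u hu)]
  constructor
  · rintro ⟨h1, h2⟩
    exact ⟨h.ne v h1, (ENNReal.toReal_lt_toReal (h.fin v h1) (h.fin u hu)).1 h2⟩
  · rintro ⟨h1, h2⟩
    exact ⟨h.low u hu v h1 h2, (ENNReal.toReal_lt_toReal h2.ne_top (h.fin u hu)).2 h2⟩

lemma ac_eq {o : Fin N} {c : Fin N → ℝ≥0∞} (hc : Nice o c) {t : ℝ} (ht : 0 < t) : ac c t = insert o (sx o c t) := by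
  unfold sx
  rw [Finset.insert_erase]
  rw [mem_ac, hc.root]; exact ENNReal.ofReal_pos.2 ht

lemma aa_Aa {o : Fin N} {c : Fin N → ℝ≥0∞} (hc : Nice o c) {t : ℝ} (ht : 0 < t) : aa c t = Aa (fc c) (sx o c t) := by
  unfold aa Aa
  rw [ac_eq hc ht, Finset.sum_insert (by simp [sx]), hc.root]
  simp [fc]

lemma bb_Bb {o : Fin N} {c : Fin N → ℝ≥0∞} (hc : Nice o c) {t : ℝ} (ht : 0 < t) (x : Fin N → ℂ) (hx : x o = 1) :
    bb c x t = Bb (fc c) x (sx o c t) := by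
  unfold bb Bb
  rw [ac_eq hc ht, Finset.sum_insert (by simp [sx]), hc.root, hx]
  simp [fc]

lemma Low.fc_pos {o : Fin N} {c : Fin N → ℝ≥0∞} {s : Finset (Fin N)} (h : Low o c s) (hc : Nice o c) {u : Fin N} (hu : u ∈ s) :
    0 < fc c u := ENNReal.toReal_pos (hc.pos u (h.ne u hu)).ne' (h.fin u hu)

lemma Low.qq {o : Fin N} {c : Fin N → ℝ≥0∞} {s : Finset (Fin N)} (h : Low o c s) (hc : Nice o c) {u : Fin N} (hu : u ∈ s) :
    qq (fc c) s u = pq c (fc c u) := by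
  unfold FPP.qq pq
  rw [h.blw hu, aa_Aa hc (h.fc_pos hc hu)]

lemma pq_fresh {o i u : Fin N} {z : Cf N} (hc : Nice o (tt o z)) (hF : Fresh o i z) (huo : u ≠ o) (hui : tt o z u ≤ tt o z i)
    (hut : tt o z u ≠ ⊤) :
    pq (tt o z) (fc (tt o z) u) ≤ 6 / (7 + ((sx o (tt o z) (fc (tt o z) u)).card : ℝ)) := by
  set c := tt o z with hcd
  have hT : 0 < fc c u := ENNReal.toReal_pos (hc.pos u huo).ne' hut
  have hF := hF u huo hui
  set T := fc c u with hTd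
  have hofT : ofReal T = c u := ENNReal.ofReal_toReal hut
  have hac : (Finset.univ.filter fun w => tt o z w < tt o z u) = ac c T := by
    ext v; rw [mem_ac, hofT]; simp [hcd]
  rw [hac] at hF
  set far := Finset.univ.filter fun w => tt o z w + 1 ≤ tt o z u with hfar
  have hcard : (ac c T).card = (sx o c T).card + 1 := by
    rw [ac_eq hc hT, Finset.card_insert_of_notMem (by simp [sx])]
  have hsub : far ⊆ ac c T := by
    intro v hv
    rw [mem_ac, hofT]
    have hv : tt o z v + 1 ≤ tt o z u := (Finset.mem_filter.1 hv).2
    have hvt : tt o z v ≠ ⊤ := fun h => by rw [h, top_add, top_le_iff] at hv; exact hut hv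
    exact (ENNReal.lt_add_right hvt one_ne_zero).trans_le hv
  have hlow : ((ac c T).card / 2 : ℝ) * exp (T - 1) ≤ aa c T := by
    have h1 : ∑ v ∈ ac c T \ far, exp (T - 1) ≤ aa c T := by
      unfold aa
      refine (Finset.sum_le_sum fun v hv => ?_).trans
        (Finset.sum_le_sum_of_subset_of_nonneg Finset.sdiff_subset fun _ _ _ => (Real.exp_pos _).le)
      apply Real.exp_le_exp.2
      rw [Finset.mem_sdiff, hfar, Finset.mem_filter, mem_ac, hofT] at hv
      have h2 : ¬ (tt o z v + 1 ≤ tt o z u) := fun h => hv.2 ⟨Finset.mem_univ _, h⟩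
      have hvt : c v ≠ ⊤ := (hv.1.trans_le le_top).ne
      have h3 := (ENNReal.toReal_lt_toReal hut (ENNReal.add_ne_top.2 ⟨hvt, ENNReal.one_ne_top⟩)).2 (not_le.1 h2)
      rw [ENNReal.toReal_add hvt ENNReal.one_ne_top] at h3
      have : T = (tt o z u).toReal := rfl
      have : (1 : ℝ≥0∞).toReal = 1 := by simp
      show T - 1 ≤ (tt o z v).toReal
      linarith
    refine le_trans ?_ h1
    rw [Finset.sum_const, nsmul_eq_mul, Finset.card_sdiff_of_subset hsub, Nat.cast_sub (Finset.card_le_card hsub)]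
    have : (2 * far.card : ℝ) ≤ (ac c T).card := by exact_mod_cast hF
    exact mul_le_mul_of_nonneg_right (by linarith) (Real.exp_pos _).le
  rw [hcard] at hlow
  push_cast at hlow
  set r : ℝ := ((sx o c T).card : ℝ)
  have hr : 0 ≤ r := by positivity
  unfold pq
  have he := Real.exp_pos T
  have h3 : exp T / 3 ≤ exp (T - 1) := by
    rw [Real.exp_sub]
    exact div_le_div_of_nonneg_left he.le (Real.exp_pos 1) (by linarith [Real.exp_one_lt_d9])
  have h4 : (r + 1) / 2 * (exp T / 3) ≤ aa c T := (mul_le_mul_of_nonneg_left h3 (by positivity)).trans hlow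
  rw [div_le_div_iff₀ (by linarith [aa_nonneg c T]) (by positivity)]
  nlinarith

lemma fresh_sums {o i : Fin N} {z : Cf N} (hc : Nice o (tt o z)) (hF : Fresh o i z) (hit : tt o z i ≠ ⊤) :
    let c := tt o z
    let s := sx o c (fc c i)
    (∑ u ∈ s, pq c (fc c u) ^ 2 ≤ 6) ∧ log (Aa (fc c) s) ≤ ∑ u ∈ s, pq c (fc c u) + 42 := by
  intro c s
  have hl : Low o c s := low_sx o c _
  have hq : ∀ u ∈ s, qq (fc c) s u = pq c (fc c u) := fun u hu => hl.qq hc hu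
  have hb : ∀ u ∈ s, qq (fc c) s u ≤ 6 / (7 + ((blw (fc c) s u).card : ℝ)) := by
    intro u hu
    rw [hq u hu, hl.blw hu]
    refine pq_fresh hc hF (hl.ne u hu) ?_ (hl.fin u hu)
    have := (mem_sx.1 hu).2.le
    rwa [fc, ENNReal.ofReal_toReal hit] at this
  have h1 := sum_qq_sq (fc c) s (hl.injOn hc) hb
  have h2 := log_le_sum_qq (fc c) s (hl.injOn hc) (fun u hu => (hb u hu).trans (by
    have : (0 : ℝ) ≤ ((blw (fc c) s u).card : ℝ) := by positivity
    exact div_le_div_of_nonneg_left (by norm_num) (by norm_num) (by linarith)))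
  rw [Finset.sum_congr rfl fun u hu => by rw [hq u hu]] at h1
  rw [Finset.sum_congr rfl hq] at h2
  rw [Finset.sum_congr rfl (fun u hu => by rw [hq u hu] : ∀ u ∈ s, qq (fc c) s u ^ 2 = pq c (fc c u) ^ 2)] at h2
  exact ⟨h1, by linarith⟩

lemma log_Aa_le {o : Fin N} {c : Fin N → ℝ≥0∞} {s : Finset (Fin N)} (h : Low o c s) {t : ℝ} (ht : 0 ≤ t) (hs : ∀ u ∈ s, fc c u ≤ t) :
    log (Aa (fc c) s) ≤ log N + t := by
  have hN : 0 < N := o.pos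
  have hNr : (0 : ℝ) < N := by exact_mod_cast hN
  have hcard : (s.card : ℝ) + 1 ≤ N := by
    have : s.card < Fintype.card (Fin N) := Finset.card_lt_univ_of_notMem (fun h' => h.ne o h' rfl)
    rw [Fintype.card_fin] at this
    exact_mod_cast this
  have : Aa (fc c) s ≤ N * exp t := by
    unfold Aa
    have h1 : ∑ v ∈ s, exp (fc c v) ≤ ∑ v ∈ s, exp t := Finset.sum_le_sum fun v hv => Real.exp_le_exp.2 (hs v hv)
    rw [Finset.sum_const, nsmul_eq_mul] at h1
    have h2 : 1 ≤ exp t := Real.one_le_exp ht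
    nlinarith
  calc _ ≤ log (N * exp t) := Real.log_le_log (by linarith [Aa_ge (fc c) s]) this
    _ = _ := by rw [Real.log_mul hNr.ne' (Real.exp_pos t).ne', Real.log_exp]

def MM (ζ : ℂ) (o u : Fin N) (z : Cf N) : ℂ :=
  inc ζ o u z * (pq (tt o z) (fc (tt o z) u) / RP ζ o (tt o z) (fc (tt o z) u))

lemma Low.sum_pq {o : Fin N} {c : Fin N → ℝ≥0∞} {s : Finset (Fin N)} (h : Low o c s) (hc : Nice o c) :
    ∑ u ∈ s, pq c (fc c u) ≤ log (Aa (fc c) s) := by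
  rw [← Finset.sum_congr rfl fun u hu => h.qq hc hu]
  exact sum_qq_le _ _ (h.injOn hc)

lemma Low.MM_sum {ζ : ℂ} {o : Fin N} {z : Cf N} {s : Finset (Fin N)} (h : Low o (tt o z) s) (hc : Nice o (tt o z))
    (h0 : ∀ u ∈ s, fct ζ (pq (tt o z) (fc (tt o z) u)) ≠ 0) :
    1 + ∑ u ∈ s, MM ζ o u z = Bb (fc (tt o z)) (xi ζ o z) s /
      (Aa (fc (tt o z)) s * ∏ v ∈ s, fct ζ (pq (tt o z) (fc (tt o z) v))) := by
  rw [tele_B ζ _ _ _ (h.injOn hc) (fun v => fct ζ (pq (tt o z) (fc (tt o z) v))) (fun u hu => by rw [h.qq hc hu]) h0]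
  congr 1
  refine Finset.sum_congr rfl fun u hu => ?_
  have hT := h.fc_pos hc hu
  unfold MM inc RP RR
  rw [h.qq hc hu, h.blw hu]
  change (xi ζ o z u - ζ * (bb (tt o z) (xi ζ o z) (fc (tt o z) u) / (aa (tt o z) (fc (tt o z) u) : ℂ))) * _ = _
  rw [aa_Aa hc hT, bb_Bb hc hT _ (by simp [xi])]
  ring

def sY (κ τ : ℝ) (ζ : ℂ) (o i : Fin N) (c : Fin N → ℝ≥0∞) : Finset (Fin N) :=
  Finset.univ.filter fun u => u ≠ o ∧ u ≠ i ∧ c u ≠ ⊤ ∧ fc c u ≤ τ ∧ ¬ c i < c u ∧ κ ≤ ‖RP ζ o c (fc c u)‖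

lemma RP_le {η : ℝ} {o u v : Fin N} {c : Fin N → ℝ≥0∞} (hv : v ≠ o) (hu : c u ≠ ⊤) (hvu : c v < c u) :
    ‖RP (Complex.exp (η * Complex.I)) o c (fc c u)‖ ≤ ‖RP (Complex.exp (η * Complex.I)) o c (fc c v)‖ := by
  have hf : ∀ t, ‖fct (Complex.exp (η * Complex.I)) (pq c t)‖ ≤ 1 := fun t => fct_norm_le η (pq_pos c t).le (pq_le c t)
  have hvt : c v ≠ ⊤ := (hvu.trans_le le_top).ne
  have h1 : RP (Complex.exp (η * Complex.I)) o c (fc c v) =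
      ∏ w ∈ insert v (sx o c (fc c v)), fct (Complex.exp (η * Complex.I)) (pq c (fc c w)) := by
    rw [Finset.prod_insert, RP, RR, mul_comm]
    rw [mem_sx, fc, ENNReal.ofReal_toReal hvt]; simp
  have hsub : insert v (sx o c (fc c v)) ⊆ sx o c (fc c u) := by
    intro w hw
    rw [mem_sx, fc, ENNReal.ofReal_toReal hu]
    rw [Finset.mem_insert, mem_sx, fc, ENNReal.ofReal_toReal hvt] at hw
    rcases hw with rfl | ⟨h1, h2⟩
    · exact ⟨hv, hvu⟩
    · exact ⟨h1, h2.trans hvu⟩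
  rw [h1, RP, norm_mul, RR, norm_prod, norm_prod]
  refine (mul_le_of_le_one_right (Finset.prod_nonneg fun _ _ => norm_nonneg _) (hf _)).trans ?_
  rw [← Finset.prod_sdiff hsub]
  exact mul_le_of_le_one_left (Finset.prod_nonneg fun _ _ => norm_nonneg _)
    (Finset.prod_le_one (fun _ _ => norm_nonneg _) fun _ _ => hf _)

lemma low_sY (κ τ η : ℝ) (o i : Fin N) (c : Fin N → ℝ≥0∞) : Low o c (sY κ τ (Complex.exp (η * Complex.I)) o i c) := by
  refine ⟨fun u hu => (Finset.mem_filter.1 hu).2.1, fun u hu => (Finset.mem_filter.1 hu).2.2.2.1, fun u hu v hv hvu => ?_⟩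
  obtain ⟨_, h1, h2, h3, h4, h5, h6⟩ := Finset.mem_filter.1 hu
  refine Finset.mem_filter.2 ⟨Finset.mem_univ _, hv, fun h => ?_, (hvu.trans_le le_top).ne, ?_, fun h => h5 (h.trans hvu),
    h6.trans (RP_le hv h3 hvu)⟩
  · subst h; exact h5 hvu
  · exact (ENNReal.toReal_mono h3 hvu.le).trans h4

lemma sY_prod {κ : ℝ} (hκ : κ ≤ 1) (τ η : ℝ) {o i : Fin N} {c : Fin N → ℝ≥0∞} (hc : Nice o c) :
    κ ≤ ‖∏ v ∈ sY κ τ (Complex.exp (η * Complex.I)) o i c, fct (Complex.exp (η * Complex.I)) (pq c (fc c v))‖ := by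
  set s := sY κ τ (Complex.exp (η * Complex.I)) o i c with hs
  have hl : Low o c s := low_sY κ τ η o i c
  rcases s.eq_empty_or_nonempty with h | h
  · rw [h]; simpa using hκ
  obtain ⟨u, hu, hmax⟩ := s.exists_max_image (fc c) h
  have hins : s = insert u (sx o c (fc c u)) := by
    rw [← hl.blw hu]
    ext v
    rw [Finset.mem_insert, blw, Finset.mem_filter]
    constructor
    · intro hv
      by_cases h : v = u
      · exact Or.inl h
      · exact Or.inr ⟨hv, lt_of_le_of_ne (hmax v hv) fun h' => h (hl.injOn hc hv hu h')⟩
    · rintro (rfl | h)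
      · exact hu
      · exact h.1
  have h6 := (Finset.mem_filter.1 hu).2.2.2.2.2.2
  rw [hins, Finset.prod_insert, mul_comm]
  · exact h6
  · rw [← hl.blw hu]; exact not_mem_blw _ _ _

lemma sY_MM {κ : ℝ} (hκ0 : 0 < κ) (hκ : κ ≤ 1) (τ η : ℝ) {o i : Fin N} {z : Cf N} (hc : Nice o (tt o z)) :
    ‖1 + ∑ u ∈ sY κ τ (Complex.exp (η * Complex.I)) o i (tt o z), MM (Complex.exp (η * Complex.I)) o u z‖ ≤ κ⁻¹ := by
  have hl := low_sY κ τ η o i (tt o z)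
  have h1 := sY_prod (i := i) hκ τ η hc
  have hne : ∏ v ∈ sY κ τ (Complex.exp (η * Complex.I)) o i (tt o z), fct (Complex.exp (η * Complex.I)) (pq (tt o z) (fc (tt o z) v)) ≠ 0 := by
    rw [← norm_pos_iff]; linarith
  rw [hl.MM_sum hc (Finset.prod_ne_zero_iff.1 hne), norm_div, norm_mul, Complex.norm_real]
  have hA := Aa_ge (fc (tt o z)) (sY κ τ (Complex.exp (η * Complex.I)) o i (tt o z))
  have hB := Bb_norm (fc (tt o z)) (xi (Complex.exp (η * Complex.I)) o z)
    (xi_norm (by rw [Complex.norm_exp_ofReal_mul_I]) o z) (sY κ τ (Complex.exp (η * Complex.I)) o i (tt o z))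
  rw [Real.norm_of_nonneg (by linarith), div_le_iff₀ (by positivity), inv_mul_eq_div, le_div_iff₀ hκ0]
  exact mul_le_mul hB h1 hκ0.le (by linarith)

lemma sY_good {κ τ η : ℝ} (hη : η ^ 2 ≤ 1) (hκ : κ ≤ exp (-(η ^ 2 * (log N + τ)))) {o i : Fin N} (hi : i ≠ o)
    {c : Fin N → ℝ≥0∞} (hc : Nice o c) (hit : c i ≠ ⊤) (hτ : fc c i ≤ τ) :
    sY κ τ (Complex.exp (η * Complex.I)) o i c = sx o c (fc c i) := by
  have hτ0 : 0 ≤ τ := ENNReal.toReal_nonneg.trans hτ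
  ext u
  rw [sY, Finset.mem_filter, mem_sx, show ofReal (fc c i) = c i from ENNReal.ofReal_toReal hit]
  constructor
  · rintro ⟨_, h1, h2, h3, h4, h5, h6⟩
    refine ⟨h1, lt_of_le_of_ne (not_lt.1 h5) fun h => h3 (hc.inj u i h2 h)⟩
  · rintro ⟨h1, h2⟩
    have hut : c u ≠ ⊤ := (h2.trans_le le_top).ne
    have hfu : fc c u ≤ τ := (ENNReal.toReal_mono hit h2.le).trans hτ
    refine ⟨Finset.mem_univ _, h1, fun h => by subst h; exact lt_irrefl _ h2, hut, hfu, not_lt.2 h2.le, ?_⟩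
    refine hκ.trans ?_
    have hl0 : Low o c (insert u (sx o c (fc c u))) := by
      refine ⟨fun v hv => ?_, fun v hv => ?_, fun v hv w hw hwv => ?_⟩
      · rcases Finset.mem_insert.1 hv with rfl | h
        · exact h1
        · exact (mem_sx.1 h).1
      · rcases Finset.mem_insert.1 hv with rfl | h
        · exact hut
        · exact ((mem_sx.1 h).2.trans_le le_top).ne
      · refine Finset.mem_insert_of_mem (mem_sx.2 ⟨hw, ?_⟩)
        rcases Finset.mem_insert.1 hv with rfl | h
        · rwa [fc, ENNReal.ofReal_toReal hut]
        · exact hwv.trans (mem_sx.1 h).2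
    have hlog := log_Aa_le hl0 hτ0 (fun v hv => by
      rcases Finset.mem_insert.1 hv with rfl | h
      · exact hfu
      · refine le_trans ?_ hfu
        have := (mem_sx.1 h).2.le
        rw [fc, ENNReal.ofReal_toReal hut] at this
        exact ENNReal.toReal_mono hut this)
    have hsum := hl0.sum_pq hc
    have hge := prod_fct_ge hη (insert u (sx o c (fc c u))) (fun v => pq c (fc c v)) (fun v _ => (pq_pos c _).le) (fun v _ => pq_le c _)
    have hR : RP (Complex.exp (η * Complex.I)) o c (fc c u) =
      ∏ w ∈ insert u (sx o c (fc c u)), fct (Complex.exp (η * Complex.I)) (pq c (fc c w)) := by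
      rw [Finset.prod_insert, RP, RR, mul_comm]
      rw [mem_sx, fc, ENNReal.ofReal_toReal hut]; simp
    rw [hR]
    refine le_trans (Real.exp_le_exp.2 ?_) hge
    apply neg_le_neg
    exact mul_le_mul_of_nonneg_left (hsum.trans hlog) (sq_nonneg _)
end FPP

namespace FPP
variable (p : ℝ) [hp : Fact (0 ≤ p ∧ p ≤ 1)] {N : ℕ}

lemma measurable_pq2 {X : Type*} [MeasurableSpace X] (c : X → Fin N → ℝ≥0∞) (hc : ∀ v, Measurable fun x => c x v)
    (t : X → ℝ) (ht : Measurable t) : Measurable fun x => pq (c x) (t x) := by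
  unfold pq
  exact (Real.measurable_exp.comp ht).div ((measurable_aa2 c hc t ht).add (Real.measurable_exp.comp ht))

lemma measurable_fct2 {X : Type*} [MeasurableSpace X] (ζ : ℂ) (q : X → ℝ) (hq : Measurable q) : Measurable fun x => fct ζ (q x) := by
  unfold fct
  exact (measurable_const.mul (Complex.measurable_ofReal.comp hq)).const_add 1

lemma measurable_RP2 {X : Type*} [MeasurableSpace X] (ζ : ℂ) (o : Fin N) (c : X → Fin N → ℝ≥0∞) (hc : ∀ v, Measurable fun x => c x v)
    (t : X → ℝ) (ht : Measurable t) : Measurable fun x => RP ζ o (c x) (t x) := by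
  unfold RP
  refine Measurable.mul ?_ (measurable_fct2 ζ _ (measurable_pq2 c hc t ht))
  have : (fun x => RR ζ o (c x) (t x)) = fun x => ∏ v : Fin N, if v ≠ o ∧ c x v < ofReal (t x) then
      fct ζ (pq (c x) (c x v).toReal) else 1 := by
    funext x
    rw [← Finset.prod_filter]
    unfold RR
    refine Finset.prod_congr ?_ fun v _ => rfl
    ext v; rw [mem_sx]; simp
  rw [this]
  refine Finset.measurable_prod _ fun v _ => ?_
  have h1 : Measurable fun x => (c x v).toReal := (hc v).ennreal_toReal
  refine Measurable.ite ?_ (measurable_fct2 ζ _ (measurable_pq2 c hc _ h1)) measurable_const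
  have h2 : MeasurableSet {x | c x v < ofReal (t x)} := measurableSet_lt (hc v) ht.ennreal_ofReal
  by_cases hv : v = o
  · simp [hv]
  · simpa [hv] using h2

lemma pq_cav_lt {o u v : Fin N} {z : Cf N} (hz : Pos z) (h : tt o z v < tt o z u) :
    pq (tt o (cavz u z)) (fc (tt o (cavz u z)) v) = pq (tt o z) (fc (tt o z) v) := by
  have hvt : tt o z v ≠ ⊤ := (h.trans_le le_top).ne
  unfold pq fc
  rw [tt_cav_eq hz h]
  have hac : ac (tt o (cavz u z)) (tt o z v).toReal = ac (tt o z) (tt o z v).toReal := by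
    apply ac_congr
    intro w
    rw [ENNReal.ofReal_toReal hvt]
    exact ⟨fun h' => (tt_le_cavz o u z w).trans_lt h', fun h' => by rwa [tt_cav_eq hz (h'.trans h)]⟩
  have : aa (tt o (cavz u z)) (tt o z v).toReal = aa (tt o z) (tt o z v).toReal := by
    unfold aa
    rw [hac]
    refine Finset.sum_congr rfl fun w hw => ?_
    rw [tt_cav_eq hz (((mem_ac_tt hvt).1 hw).trans h)]
  rw [this]

lemma pq_cav {o u : Fin N} (hu : u ≠ o) {z : Cf N} (hz : Pos z) (ht : tt o z u ≠ ⊤) :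
    pq (tt o (cavz u z)) (tt o z u).toReal = pq (tt o z) (tt o z u).toReal := by
  unfold pq; rw [aa_cav hu hz ht]

lemma RP_cav (ζ : ℂ) {o u : Fin N} (hu : u ≠ o) {z : Cf N} (hz : Pos z) (ht : tt o z u ≠ ⊤) :
    RP ζ o (tt o (cavz u z)) (tt o z u).toReal = RP ζ o (tt o z) (tt o z u).toReal := by
  unfold RP RR
  rw [pq_cav hu hz ht]
  congr 1
  unfold sx
  rw [ac_cav hu hz ht]
  refine Finset.prod_congr rfl fun v hv => ?_
  rw [pq_cav_lt hz ((mem_ac_tt ht).1 (Finset.mem_of_mem_erase hv))]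

def FF (κ τ : ℝ) (ζ : ℂ) (o i : Fin N) (z : Cf N) (t : ℝ) : ℂ :=
  if t ≤ τ ∧ ¬ tt o z i < ofReal t ∧ κ ≤ ‖RP ζ o (tt o z) t‖ then pq (tt o z) t / RP ζ o (tt o z) t else 0

lemma measurable_FF (κ τ : ℝ) (ζ : ℂ) (o i : Fin N) : Measurable (Function.uncurry (FF κ τ ζ o i)) := by
  unfold FF Function.uncurry
  have hc : ∀ v, Measurable fun x : Cf N × ℝ => tt o x.1 v := fun v => (measurable_tt o v).comp measurable_fst
  have hR := measurable_RP2 ζ o (fun x : Cf N × ℝ => tt o x.1) hc (fun x => x.2) measurable_snd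
  have hq := measurable_pq2 (fun x : Cf N × ℝ => tt o x.1) hc (fun x => x.2) measurable_snd
  refine Measurable.ite ?_ ((Complex.measurable_ofReal.comp hq).div hR) measurable_const
  have h1 : MeasurableSet {x : Cf N × ℝ | x.2 ≤ τ} := measurableSet_le measurable_snd measurable_const
  have h2 : MeasurableSet {x : Cf N × ℝ | tt o x.1 i < ofReal x.2} := measurableSet_lt (hc i) measurable_snd.ennreal_ofReal
  have h3 : MeasurableSet {x : Cf N × ℝ | κ ≤ ‖RP ζ o (tt o x.1) x.2‖} := measurableSet_le measurable_const hR.norm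
  exact h1.inter (h2.compl.inter h3)

lemma FF_norm {κ : ℝ} (hκ : 0 < κ) (τ : ℝ) (ζ : ℂ) (o i : Fin N) (z : Cf N) (t : ℝ) :
    ‖FF κ τ ζ o i z t‖ ≤ κ⁻¹ * pq (tt o z) t := by
  unfold FF
  have hq := pq_pos (tt o z) t
  split_ifs with h
  · rw [norm_div, Complex.norm_real, Real.norm_of_nonneg hq.le, div_eq_mul_inv, mul_comm]
    exact mul_le_mul_of_nonneg_right (inv_anti₀ hκ h.2.2) hq.le
  · simp; positivity

lemma FF_cav (κ τ : ℝ) (ζ : ℂ) {o u i : Fin N} (hu : u ≠ o) (hui : u ≠ i) {z : Cf N} (hz : Pos z) (ht : tt o z u ≠ ⊤) :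
    FF κ τ ζ o i (cavz u z) (tt o z u).toReal =
      if u ∈ sY κ τ ζ o i (tt o z) then pq (tt o z) (fc (tt o z) u) / RP ζ o (tt o z) (fc (tt o z) u) else 0 := by
  unfold FF
  rw [RP_cav ζ hu hz ht, pq_cav hu hz ht, ENNReal.ofReal_toReal ht]
  refine if_congr ?_ rfl rfl
  rw [sY, Finset.mem_filter, tt_cav_lt hu hz]
  constructor
  · rintro ⟨h1, h2, h3⟩
    exact ⟨Finset.mem_univ _, hu, hui, ht, h1, h2, h3⟩
  · rintro ⟨_, _, _, _, h1, h2, h3⟩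
    exact ⟨h1, h2, h3⟩

lemma sY_sum {κ τ η : ℝ} (hτ : 0 ≤ τ) {o i : Fin N} {c : Fin N → ℝ≥0∞} (hc : Nice o c) :
    ∑ u ∈ sY κ τ (Complex.exp (η * Complex.I)) o i c, pq c (fc c u) ≤ log N + τ := by
  have hl := low_sY κ τ η o i c
  exact (hl.sum_pq hc).trans (log_Aa_le hl hτ fun u hu => (Finset.mem_filter.1 hu).2.2.2.2.1)

def YY (κ τ η : ℝ) (o i : Fin N) (z : Cf N) : ℂ :=
  ∑ u ∈ sY κ τ (Complex.exp (η * Complex.I)) o i (tt o z), MM (Complex.exp (η * Complex.I)) o u z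

set_option maxHeartbeats 1000000 in
lemma EY {κ : ℝ} (hκ : 0 < κ) {τ : ℝ} (hτ : 0 ≤ τ) (η : ℝ) (o i : Fin N) :
    Integrable (YY κ τ η o i) (PP N p) ∧
    ‖∫ z, YY κ τ η o i z ∂(PP N p)‖ ≤ 2 * (p * τ) * (κ⁻¹ * (log N + τ)) := by
  set ζ := Complex.exp (η * Complex.I) with hζd
  have hζ : ‖ζ‖ = 1 := by rw [hζd, Complex.norm_exp_ofReal_mul_I]
  obtain ⟨G, hG⟩ : ∃ G : Fin N → Cf N → ℂ, G = fun u z => if tt o z u ≠ ⊤ then FF κ τ ζ o i (cavz u z) (tt o z u).toReal else 0 := ⟨_, rfl⟩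
  have hmG : ∀ u, Measurable (G u) := by
    intro u
    rw [hG]
    have h1 : Measurable fun z : Cf N => (cavz u z, (tt o z u).toReal) :=
      (measurable_cavz u).prodMk (measurable_tt o u).ennreal_toReal
    have h2 : Measurable fun z : Cf N => FF κ τ ζ o i (cavz u z) (tt o z u).toReal := (measurable_FF κ τ ζ o i).comp h1
    exact Measurable.ite ((measurable_tt o u) (measurableSet_singleton ⊤)).compl h2 measurable_const
  have hGn : ∀ u z, ‖G u z‖ ≤ κ⁻¹ := by
    intro u z
    rw [hG]
    dsimp only
    split_ifs
    · exact (FF_norm hκ τ ζ o i _ _).trans (mul_le_of_le_one_right (by positivity) (pq_le _ _))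
    · simp; positivity
  have hiG : ∀ u, Integrable (G u) (PP N p) := fun u =>
    Integrable.of_bound (hmG u).aestronglyMeasurable _ (Eventually.of_forall (hGn u))
  have hiG2 : ∀ u, Integrable (fun z => inc ζ o u z * G u z) (PP N p) := fun u =>
    Integrable.of_bound ((measurable_inc ζ o u).mul (hmG u)).aestronglyMeasurable (2 * κ⁻¹) (Eventually.of_forall fun z => by
      rw [norm_mul]; exact mul_le_mul (inc_norm hζ o u z) (hGn u z) (norm_nonneg _) (by norm_num))
  set S : Finset (Fin N) := Finset.univ.filter fun u => u ≠ o ∧ u ≠ i with hS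
  have hGv : ∀ᵐ z ∂(PP N p), ∀ u ∈ S, G u z = if u ∈ sY κ τ ζ o i (tt o z) then ((pq (tt o z) (fc (tt o z) u) : ℝ) : ℂ) / RP ζ o (tt o z) (fc (tt o z) u) else 0 := by
    filter_upwards [ae_Pos p] with z hz u hu
    obtain ⟨_, hu1, hu2⟩ := Finset.mem_filter.1 hu
    rw [hG]
    dsimp only
    by_cases ht : tt o z u ≠ ⊤
    · rw [if_pos ht, FF_cav κ τ ζ hu1 hu2 hz ht]
    · rw [if_neg ht, if_neg]
      intro h
      exact ht (Finset.mem_filter.1 h).2.2.2.1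
  have hsub : ∀ c : Fin N → ℝ≥0∞, sY κ τ ζ o i c ⊆ S := by
    intro c u hu
    have := (Finset.mem_filter.1 hu).2
    exact Finset.mem_filter.2 ⟨Finset.mem_univ _, this.1, this.2.1⟩
  have hYG : YY κ τ η o i =ᵐ[PP N p] fun z => ∑ u ∈ S, inc ζ o u z * G u z := by
    filter_upwards [hGv] with z hz
    rw [Finset.sum_congr rfl fun u hu => by rw [hz u hu]]
    simp only [mul_ite, mul_zero]
    rw [← Finset.sum_filter]
    unfold YY
    refine Finset.sum_congr ?_ fun u _ => rfl
    ext u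
    rw [Finset.mem_filter]
    exact ⟨fun h => ⟨hsub _ h, h⟩, fun h => h.2⟩
  refine ⟨(integrable_finsetSum _ fun u _ => hiG2 u).congr hYG.symm, ?_⟩
  rw [integral_congr_ae hYG, integral_finsetSum _ fun u _ => hiG2 u]
  have h1 : ∀ u ∈ S, ‖∫ z, inc ζ o u z * G u z ∂(PP N p)‖ ≤ 2 * (p * τ) * ∫ z, ‖G u z‖ ∂(PP N p) := by
    intro u hu
    obtain ⟨_, hu1, hu2⟩ := Finset.mem_filter.1 hu
    have hMI := MI p hζ hu1 τ (FF κ τ ζ o i) (measurable_FF κ τ ζ o i) κ⁻¹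
      (fun z t => (FF_norm hκ τ ζ o i z t).trans (mul_le_of_le_one_right (by positivity) (pq_le _ _)))
      (fun z t ht => by unfold FF; rw [if_neg]; intro h; linarith [h.1])
    convert hMI using 3
    · congr 1; funext z; rw [hG]; simp only [mul_ite, mul_zero]
    · funext z; rw [hG]; dsimp only; split_ifs <;> simp
  refine (norm_sum_le _ _).trans ((Finset.sum_le_sum h1).trans ?_)
  rw [← Finset.mul_sum]
  refine mul_le_mul_of_nonneg_left ?_ (by have := hp.out.1; positivity)
  rw [← integral_finsetSum _ fun u _ => (hiG u).norm]
  have h2 : ∫ z, ∑ u ∈ S, ‖G u z‖ ∂(PP N p) ≤ ∫ z, κ⁻¹ * (log N + τ) ∂(PP N p) := by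
    refine integral_mono_ae (integrable_finsetSum _ fun u _ => (hiG u).norm) (integrable_const _) ?_
    filter_upwards [hGv, ae_Nice p o] with z hz hc
    rw [Finset.sum_congr rfl fun u hu => by rw [hz u hu]]
    have e1 : ∀ u ∈ S, ‖(if u ∈ sY κ τ ζ o i (tt o z) then ((pq (tt o z) (fc (tt o z) u) : ℝ) : ℂ) / RP ζ o (tt o z) (fc (tt o z) u) else 0)‖
        ≤ if u ∈ sY κ τ ζ o i (tt o z) then κ⁻¹ * pq (tt o z) (fc (tt o z) u) else 0 := by
      intro u _
      have hq := pq_pos (tt o z) (fc (tt o z) u)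
      split_ifs with h
      · rw [norm_div, Complex.norm_real, Real.norm_of_nonneg hq.le, div_eq_mul_inv, mul_comm]
        exact mul_le_mul_of_nonneg_right (inv_anti₀ hκ (Finset.mem_filter.1 h).2.2.2.2.2.2) hq.le
      · simp
    refine (Finset.sum_le_sum e1).trans ?_
    rw [← Finset.sum_filter]
    have : S.filter (fun u => u ∈ sY κ τ ζ o i (tt o z)) = sY κ τ ζ o i (tt o z) := by
      ext u
      rw [Finset.mem_filter]
      exact ⟨fun h => h.2, fun h => ⟨hsub _ h, h⟩⟩
    rw [this, ← Finset.mul_sum]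
    exact mul_le_mul_of_nonneg_left (sY_sum hτ hc) (by positivity)
  rw [integral_const] at h2
  simpa using h2
end FPP

namespace FPP
variable (p : ℝ) [hp : Fact (0 ≤ p ∧ p ≤ 1)] {N : ℕ}

lemma zeta_third {η : ℝ} (hη : |η| ≤ 1) :
    ‖Complex.exp (η * Complex.I) - 1 - (η * Complex.I - (η : ℂ) ^ 2 / 2)‖ ≤ |η| ^ 3 := by
  have hn : ‖(η : ℂ) * Complex.I‖ = |η| := by simp
  have h := Complex.exp_bound (x := (η : ℂ) * Complex.I) (by rw [hn]; exact hη) (n := 3) (by norm_num)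
  rw [hn] at h
  have e : ∑ m ∈ Finset.range 3, ((η : ℂ) * Complex.I) ^ m / (m.factorial : ℂ) = 1 + (η * Complex.I - (η : ℂ) ^ 2 / 2) := by
    simp [Finset.sum_range_succ, Nat.factorial, mul_pow]
    ring
  rw [e, ← sub_sub] at h
  refine h.trans (mul_le_of_le_one_right (by positivity) ?_)
  norm_num [Nat.factorial]

lemma exp_cmp {a b : ℂ} {δ : ℝ} (hb : b.re ≤ 0) (h : ‖a - b‖ ≤ δ) (hδ : δ ≤ 1) :
    ‖Complex.exp a - Complex.exp b‖ ≤ 2 * δ := by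
  have : Complex.exp a - Complex.exp b = Complex.exp b * (Complex.exp (a - b) - 1) := by
    rw [mul_sub, ← Complex.exp_add]; ring_nf
  rw [this, norm_mul]
  have h1 := Complex.norm_exp_sub_one_le (h.trans hδ)
  have h2 : ‖Complex.exp b‖ ≤ 1 := by rw [Complex.norm_exp]; exact Real.exp_le_one_iff.2 hb
  calc _ ≤ 1 * (2 * ‖a - b‖) := mul_le_mul h2 h1 (norm_nonneg _) zero_le_one
    _ ≤ _ := by linarith

def C0 (η L : ℝ) : ℂ := Complex.exp (((η * L : ℝ) : ℂ) * Complex.I - ((η ^ 2 * L / 2 : ℝ) : ℂ))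

lemma C0_norm {η L : ℝ} (hL : 0 ≤ L) : ‖C0 η L‖ ≤ 1 := by
  unfold C0
  rw [Complex.norm_exp]
  apply Real.exp_le_one_iff.2
  simp
  rw [← Complex.ofReal_pow, Complex.ofReal_re]
  positivity

lemma exponent {η L T τ E1 P δ : ℝ} (hη : η ^ 2 ≤ 1) (hL : 0 ≤ L) (hT : 0 ≤ T) (hTτ : T ≤ τ) (hP0 : 0 ≤ P)
    (hP1 : P ≤ L + T) (hP2 : L + T - E1 ≤ P) (hδ : |η| ^ 3 * (L + τ) + |η| * E1 + η ^ 2 / 2 * (E1 + τ) ≤ δ) (hδ1 : δ ≤ 1) :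
    ‖Complex.exp (-(((η * T : ℝ) : ℂ) * Complex.I)) * Complex.exp ((Complex.exp (η * Complex.I) - 1) * (P : ℂ)) - C0 η L‖ ≤ 2 * δ := by
  have hη1 : |η| ≤ 1 := by rw [← sq_le_one_iff_abs_le_one]; exact hη
  rw [← Complex.exp_add]
  unfold C0
  refine exp_cmp ?_ ?_ hδ1
  · simp
    rw [← Complex.ofReal_pow, Complex.ofReal_re]
    positivity
  refine le_trans ?_ hδ
  set w := Complex.exp (η * Complex.I) - 1 - (η * Complex.I - (η : ℂ) ^ 2 / 2) with hw
  have e : -(((η * T : ℝ) : ℂ) * Complex.I) + (Complex.exp (η * Complex.I) - 1) * (P : ℂ) -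
      (((η * L : ℝ) : ℂ) * Complex.I - ((η ^ 2 * L / 2 : ℝ) : ℂ)) =
      w * (P : ℂ) + ((η * (P - T - L) : ℝ) : ℂ) * Complex.I + ((-(η ^ 2 / 2 * (P - L)) : ℝ) : ℂ) := by
    rw [hw]; push_cast; ring
  rw [e]
  refine (norm_add₃_le).trans ?_
  have h1 : ‖w * (P : ℂ)‖ ≤ |η| ^ 3 * (L + τ) := by
    rw [norm_mul, Complex.norm_real, Real.norm_of_nonneg hP0]
    exact mul_le_mul (zeta_third hη1) (by linarith) hP0 (by positivity)
  have h2 : ‖((η * (P - T - L) : ℝ) : ℂ) * Complex.I‖ ≤ |η| * E1 := by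
    rw [norm_mul, Complex.norm_I, mul_one, Complex.norm_real, Real.norm_eq_abs, abs_mul]
    refine mul_le_mul_of_nonneg_left ?_ (abs_nonneg _)
    rw [abs_le]; constructor <;> linarith
  have h3 : ‖((-(η ^ 2 / 2 * (P - L)) : ℝ) : ℂ)‖ ≤ η ^ 2 / 2 * (E1 + τ) := by
    rw [Complex.norm_real, Real.norm_eq_abs, abs_neg, abs_mul, abs_of_nonneg (by positivity : 0 ≤ η ^ 2 / 2)]
    refine mul_le_mul_of_nonneg_left ?_ (by positivity)
    rw [abs_le]; constructor <;> linarith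
  linarith

def Bad (o i : Fin N) (τ ε : ℝ) : Set (Cf N) :=
  {z | ¬ (tt o z i ≤ ofReal τ ∧ Fresh o i z)} ∪
    {z | tt o z i ≠ ⊤ ∧ (tt o z i).toReal ≤ τ ∧ aa (tt o z) (tt o z i).toReal ≤ (ε * N) * exp (tt o z i).toReal}

lemma good_est {o i : Fin N} (hi : i ≠ o) {η τ κ E1 ε δ : ℝ} (hη : η ^ 2 ≤ 1) (hτ : 0 ≤ τ)
    (hκ0 : 0 < κ) (hκ : κ ≤ exp (-(η ^ 2 * (log N + τ)))) (hε : 0 < ε) (hE : 42 - log ε ≤ E1)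
    (hδ : |η| ^ 3 * (log N + τ) + |η| * E1 + η ^ 2 / 2 * (E1 + τ) ≤ δ) (hδ1 : δ ≤ 1)
    {z : Cf N} (hc : Nice o (tt o z)) (hz : z ∉ Bad o i τ ε) :
    ‖Complex.exp (-(((η * (tt o z i).toReal : ℝ) : ℂ) * Complex.I)) *
      (bb (tt o z) (xi (Complex.exp (η * Complex.I)) o z) (tt o z i).toReal / (aa (tt o z) (tt o z i).toReal : ℂ)) -
      C0 η (log N) * (1 + YY κ τ η o i z)‖ ≤ (6 * η ^ 2 + 2 * δ) * κ⁻¹ := by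
  have hN : 1 ≤ N := o.pos
  have hNr : (1 : ℝ) ≤ N := by exact_mod_cast hN
  have hL : 0 ≤ log N := Real.log_nonneg hNr
  have hκ1 : κ ≤ 1 := hκ.trans (Real.exp_le_one_iff.2 (by have : 0 ≤ η ^ 2 * (log N + τ) := by positivity
                                                          linarith))
  have hz1 : tt o z i ≤ ofReal τ ∧ Fresh o i z := by
    by_contra h; exact hz (Or.inl h)
  obtain ⟨hTle, hF⟩ := hz1
  have hit : tt o z i ≠ ⊤ := ne_top_of_le_ne_top ENNReal.ofReal_ne_top hTle
  have hTτ : (tt o z i).toReal ≤ τ := ENNReal.toReal_le_of_le_ofReal hτ hTle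
  have ha : (ε * N) * exp (tt o z i).toReal < aa (tt o z) (tt o z i).toReal := by
    by_contra h; exact hz (Or.inr ⟨hit, hTτ, not_lt.1 h⟩)
  have hT0 : 0 < (tt o z i).toReal := ENNReal.toReal_pos (hc.pos i hi).ne' hit
  have hY := sY_MM (i := i) hκ0 hκ1 τ η hc
  have hsg := sY_good hη hκ hi hc hit hTτ
  have hYY : YY κ τ η o i z = ∑ u ∈ sY κ τ (Complex.exp (η * Complex.I)) o i (tt o z), MM (Complex.exp (η * Complex.I)) o u z := rfl
  rw [← hYY] at hY
  have hprod := sY_prod (i := i) hκ1 τ η hc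
  rw [hsg] at hYY hprod
  have hfs := fresh_sums hc hF hit
  dsimp only at hfs
  obtain ⟨hs1, hs2⟩ := hfs
  have hl := low_sx o (tt o z) (fc (tt o z) i)
  have hne : ∏ v ∈ sx o (tt o z) (fc (tt o z) i), fct (Complex.exp (η * Complex.I)) (pq (tt o z) (fc (tt o z) v)) ≠ 0 := by
    rw [← norm_pos_iff]; linarith
  have hid := hl.MM_sum hc (Finset.prod_ne_zero_iff.1 hne)
  rw [← hYY] at hid
  have hap := aa_Aa hc hT0
  have hbp := bb_Bb hc hT0 (xi (Complex.exp (η * Complex.I)) o z) (by simp [xi])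
  rw [hap] at ha
  rw [hap, hbp]
  change (ε * N) * exp (fc (tt o z) i) < Aa (fc (tt o z)) (sx o (tt o z) (fc (tt o z) i)) at ha
  change ‖Complex.exp (-(((η * fc (tt o z) i : ℝ) : ℂ) * Complex.I)) *
    (Bb (fc (tt o z)) (xi (Complex.exp (η * Complex.I)) o z) (sx o (tt o z) (fc (tt o z) i)) /
      (Aa (fc (tt o z)) (sx o (tt o z) (fc (tt o z) i)) : ℂ)) - _‖ ≤ _
  change fc (tt o z) i ≤ τ at hTτ
  change 0 < fc (tt o z) i at hT0
  have hPsum := hl.sum_pq hc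
  have hlog := log_Aa_le hl hT0.le (fun u hu => by
    have := (mem_sx.1 hu).2.le
    rw [fc, ENNReal.ofReal_toReal hit] at this
    exact ENNReal.toReal_mono hit this)
  have hpe := prod_fct_exp hη (sx o (tt o z) (fc (tt o z) i)) (fun v => pq (tt o z) (fc (tt o z) v))
    (fun v _ => (pq_pos _ _).le) (fun v _ => pq_le _ _)
  have hP0 : 0 ≤ ∑ u ∈ sx o (tt o z) (fc (tt o z) i), pq (tt o z) (fc (tt o z) u) :=
    Finset.sum_nonneg fun v _ => (pq_pos _ _).le
  have hA1 := Aa_ge (fc (tt o z)) (sx o (tt o z) (fc (tt o z) i))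
  generalize fc (tt o z) i = T at *
  generalize sx o (tt o z) T = s at *
  generalize ∑ u ∈ s, pq (tt o z) (fc (tt o z) u) = P at *
  generalize ∏ v ∈ s, fct (Complex.exp (η * Complex.I)) (pq (tt o z) (fc (tt o z) v)) = R at *
  generalize Bb (fc (tt o z)) (xi (Complex.exp (η * Complex.I)) o z) s = B at *
  generalize Aa (fc (tt o z)) s = A at *
  have hlogA : log ε + log N + T ≤ log A := by
    have : log ((ε * N) * exp T) ≤ log A := Real.log_le_log (by positivity) ha.le
    rwa [Real.log_mul (by positivity) (Real.exp_pos _).ne', Real.log_mul hε.ne' (by positivity), Real.log_exp] at this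
  have hex := exponent hη hL hT0.le hTτ hP0 (hPsum.trans hlog) (by linarith) hδ hδ1
  have hAne : (A : ℂ) ≠ 0 := by exact_mod_cast (by linarith : A ≠ 0)
  have hBA : B / A = R * (1 + YY κ τ η o i z) := by
    rw [hid]; field_simp
  rw [hBA]
  set e1 := Complex.exp (-(((η * T : ℝ) : ℂ) * Complex.I)) with he1
  have he1n : ‖e1‖ = 1 := by
    rw [he1, ← neg_mul, ← Complex.ofReal_neg, Complex.norm_exp_ofReal_mul_I]
  set X := Complex.exp ((Complex.exp (η * Complex.I) - 1) * (P : ℂ)) with hX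
  have heq : e1 * (R * (1 + YY κ τ η o i z)) - C0 η (log N) * (1 + YY κ τ η o i z) =
    (e1 * (R - X) + (e1 * X - C0 η (log N))) * (1 + YY κ τ η o i z) := by ring
  rw [heq, norm_mul]
  refine mul_le_mul ?_ hY (norm_nonneg _) (by
    have : 0 ≤ δ := by linarith [norm_nonneg (e1 * X - C0 η (log N))]
    positivity)
  refine (norm_add_le _ _).trans ?_
  rw [norm_mul, he1n, one_mul]
  have : η ^ 2 * ∑ u ∈ s, pq (tt o z) (fc (tt o z) u) ^ 2 ≤ η ^ 2 * 6 := mul_le_mul_of_nonneg_left hs1 (sq_nonneg _)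
  linarith

def JJ (τ η : ℝ) (o i : Fin N) (z : Cf N) : ℂ :=
  if tt o z i ≤ ofReal τ then
    xi (Complex.exp (η * Complex.I)) o z i * Complex.exp (-(((η * (tt o z i).toReal : ℝ) : ℂ) * Complex.I)) else 0

set_option maxHeartbeats 1000000 in
lemma main_bound {o i : Fin N} (hi : i ≠ o) {η τ κ E1 ε δ D : ℝ} (hη : η ^ 2 ≤ 1) (hτ : 0 ≤ τ)
    (hκ0 : 0 < κ) (hκ : κ ≤ exp (-(η ^ 2 * (log N + τ)))) (hε : 0 < ε) (hE : 42 - log ε ≤ E1)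
    (hδ : |η| ^ 3 * (log N + τ) + |η| * E1 + η ^ 2 / 2 * (E1 + τ) ≤ δ) (hδ1 : δ ≤ 1) (hδ0 : 0 ≤ δ)
    (hD0 : 0 ≤ D) (hD : PP N p (Bad o i τ ε) ≤ ofReal D) :
    ‖∫ z, JJ τ η o i z ∂(PP N p) - Complex.exp (η * Complex.I) * C0 η (log N)‖ ≤
      2 * (p * τ) + (6 * η ^ 2 + 2 * δ) * κ⁻¹ + (1 + κ⁻¹) * D + 2 * (p * τ) * (κ⁻¹ * (log N + τ)) := by
  have hp0 := hp.out.1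
  have hNr : (1 : ℝ) ≤ N := by exact_mod_cast o.pos
  have hL : 0 ≤ log N := Real.log_nonneg hNr
  have hκ1 : κ ≤ 1 := hκ.trans (Real.exp_le_one_iff.2 (by have : 0 ≤ η ^ 2 * (log N + τ) := by positivity
                                                          linarith))
  set ζ := Complex.exp (η * Complex.I) with hζd
  have hζ : ‖ζ‖ = 1 := by rw [hζd, Complex.norm_exp_ofReal_mul_I]
  obtain ⟨hYi, hYn⟩ := EY p hκ0 hτ η o i
  have hen : ∀ t : ℝ, ‖Complex.exp (-(((η * t : ℝ) : ℂ) * Complex.I))‖ = 1 := fun t => by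
    rw [← neg_mul, ← Complex.ofReal_neg, Complex.norm_exp_ofReal_mul_I]
  obtain ⟨e, he⟩ : ∃ e : ℝ → ℂ, e = fun t => if t ≤ τ then Complex.exp (-(((η * t : ℝ) : ℂ) * Complex.I)) else 0 := ⟨_, rfl⟩
  have hem : Measurable e := by
    rw [he]
    refine Measurable.ite measurableSet_Iic ?_ measurable_const
    exact (by fun_prop : Continuous fun t : ℝ => Complex.exp (-(((η * t : ℝ) : ℂ) * Complex.I))).measurable
  have hen1 : ∀ t, ‖e t‖ ≤ 1 := by
    intro t; rw [he]; dsimp only; split_ifs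
    · rw [hen]
    · simp
  obtain ⟨g, hg⟩ : ∃ g : Cf N → ℂ, g = fun z => if tt o z i ≠ ⊤ then e (tt o z i).toReal else 0 := ⟨_, rfl⟩
  have hgm : Measurable g := by
    rw [hg]
    have h2 : Measurable fun z : Cf N => e (tt o z i).toReal := hem.comp (measurable_tt o i).ennreal_toReal
    exact Measurable.ite ((measurable_tt o i) (measurableSet_singleton ⊤)).compl h2 measurable_const
  have hgn : ∀ z, ‖g z‖ ≤ 1 := by
    intro z; rw [hg]; dsimp only; split_ifs
    · exact hen1 _
    · simp
  obtain ⟨r, hr⟩ : ∃ r : Cf N → ℂ, r = fun z => bb (tt o z) (xi ζ o z) (tt o z i).toReal / (aa (tt o z) (tt o z i).toReal : ℂ) := ⟨_, rfl⟩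
  have hrm : Measurable r := by
    rw [hr]
    refine Measurable.div ?_ ?_
    · exact measurable_bb2 _ (measurable_tt o) _ (measurable_xi ζ o) _ (measurable_tt o i).ennreal_toReal
    · exact Complex.measurable_ofReal.comp (measurable_aa2 _ (measurable_tt o) _ (measurable_tt o i).ennreal_toReal)
  have hrn : ∀ z, ‖r z‖ ≤ 1 := fun z => by rw [hr]; exact avg_norm _ _ (xi_norm hζ o z) _
  have hJ : ∀ z, JJ τ η o i z = inc ζ o i z * g z + ζ * (g z * r z) := by
    intro z
    have h1 : g z = if tt o z i ≤ ofReal τ then Complex.exp (-(((η * (tt o z i).toReal : ℝ) : ℂ) * Complex.I)) else 0 := by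
      rw [hg, he]
      dsimp only
      by_cases ht : tt o z i = ⊤
      · rw [if_neg (by simp [ht]), if_neg (by simp [ht])]
      · rw [if_pos ht]
        exact if_congr (by rw [ENNReal.le_ofReal_iff_toReal_le ht hτ]) rfl rfl
    have h2 : JJ τ η o i z = xi ζ o z i * g z := by
      unfold JJ; rw [h1]; split_ifs <;> simp [hζd]
    rw [h2, hr]; unfold inc; ring
  have i1 : Integrable (fun z => inc ζ o i z * g z) (PP N p) :=
    Integrable.of_bound ((measurable_inc ζ o i).mul hgm).aestronglyMeasurable (2 * 1) (Eventually.of_forall fun z => by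
      rw [norm_mul]; exact mul_le_mul (inc_norm hζ o i z) (hgn z) (norm_nonneg _) (by norm_num))
  have hgrn : ∀ z, ‖g z * r z‖ ≤ 1 := fun z => by
    rw [norm_mul]; exact mul_le_one₀ (hgn z) (norm_nonneg _) (hrn z)
  have i2 : Integrable (fun z => g z * r z) (PP N p) :=
    Integrable.of_bound (hgm.mul hrm).aestronglyMeasurable 1 (Eventually.of_forall hgrn)
  have hint : ∫ z, JJ τ η o i z ∂(PP N p) = ∫ z, inc ζ o i z * g z ∂(PP N p) + ζ * ∫ z, g z * r z ∂(PP N p) := by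
    rw [← integral_const_mul, ← integral_add i1 (i2.const_mul ζ)]
    exact integral_congr_ae (Eventually.of_forall hJ)
  have t1 : ‖∫ z, inc ζ o i z * g z ∂(PP N p)‖ ≤ 2 * (p * τ) := by
    have hMI := MI p hζ hi τ (fun _ t => e t) (hem.comp measurable_snd) 1 (fun _ t => hen1 t)
      (fun _ t ht => by rw [he]; dsimp only; rw [if_neg (not_le.2 ht)])
    have e1 : (fun z => if tt o z i ≠ ⊤ then inc ζ o i z * e (tt o z i).toReal else 0) = fun z => inc ζ o i z * g z := by
      funext z; rw [hg]; simp only [mul_ite, mul_zero]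
    have e2 : (fun z => if tt o z i ≠ ⊤ then ‖e (tt o z i).toReal‖ else 0) = fun z => ‖g z‖ := by
      funext z; rw [hg]; dsimp only; split_ifs <;> simp
    rw [e1, e2] at hMI
    refine hMI.trans (mul_le_of_le_one_right (by positivity) ?_)
    have : ∫ z, ‖g z‖ ∂(PP N p) ≤ ∫ z, (1 : ℝ) ∂(PP N p) :=
      integral_mono (Integrable.of_bound hgm.norm.aestronglyMeasurable 1 (Eventually.of_forall fun z => by simpa using hgn z)) (integrable_const _) hgn
    simpa using this
  obtain ⟨B', hB'1, hB'2, hB'3⟩ : ∃ B', Bad o i τ ε ⊆ B' ∧ MeasurableSet B' ∧ PP N p B' = PP N p (Bad o i τ ε) :=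
    exists_measurable_superset _ _
  have t2 : ‖∫ z, g z * r z ∂(PP N p) - C0 η (log N) * (1 + ∫ z, YY κ τ η o i z ∂(PP N p))‖ ≤
      (6 * η ^ 2 + 2 * δ) * κ⁻¹ + (1 + κ⁻¹) * D := by
    have i3 : Integrable (fun z => C0 η (log N) * (1 + YY κ τ η o i z)) (PP N p) := ((integrable_const (1 : ℂ)).add hYi).const_mul _
    have e1 : C0 η (log N) * (1 + ∫ z, YY κ τ η o i z ∂(PP N p)) = ∫ z, C0 η (log N) * (1 + YY κ τ η o i z) ∂(PP N p) := by
      rw [integral_const_mul, integral_add (integrable_const _) hYi]; simp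
    rw [e1, ← integral_sub i2 i3]
    have hbd : ∀ᵐ z ∂(PP N p), ‖g z * r z - C0 η (log N) * (1 + YY κ τ η o i z)‖ ≤
        (6 * η ^ 2 + 2 * δ) * κ⁻¹ + B'.indicator (fun _ => 1 + κ⁻¹) z := by
      filter_upwards [ae_Nice p o] with z hc
      by_cases hz : z ∈ B'
      · rw [Set.indicator_of_mem hz]
        have h1 := sY_MM (i := i) hκ0 hκ1 τ η hc
        have h2 : ‖C0 η (log N) * (1 + YY κ τ η o i z)‖ ≤ κ⁻¹ := by
          rw [norm_mul]
          exact (mul_le_of_le_one_left (norm_nonneg _) (C0_norm hL)).trans h1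
        have h3 : 0 ≤ (6 * η ^ 2 + 2 * δ) * κ⁻¹ := by positivity
        linarith [norm_sub_le (g z * r z) (C0 η (log N) * (1 + YY κ τ η o i z)), hgrn z]
      · rw [Set.indicator_of_notMem hz, add_zero]
        have hzB : z ∉ Bad o i τ ε := fun h => hz (hB'1 h)
        have h1 := good_est hi hη hτ hκ0 hκ hε hE hδ hδ1 hc hzB
        have hTle : tt o z i ≤ ofReal τ := by
          by_contra h; exact hzB (Or.inl fun h' => h h'.1)
        have hit : tt o z i ≠ ⊤ := ne_top_of_le_ne_top ENNReal.ofReal_ne_top hTle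
        have h2 : g z = Complex.exp (-(((η * (tt o z i).toReal : ℝ) : ℂ) * Complex.I)) := by
          rw [hg, he]; dsimp only
          rw [if_pos hit, if_pos (ENNReal.toReal_le_of_le_ofReal hτ hTle)]
        rw [h2, hr]; exact h1
    have i4 : Integrable (B'.indicator (fun _ => 1 + κ⁻¹) : Cf N → ℝ) (PP N p) := (integrable_const _).indicator hB'2
    refine (norm_integral_le_integral_norm _).trans ((integral_mono_ae (i2.sub i3).norm ((integrable_const _).add i4) hbd).trans ?_)
    rw [integral_add' (integrable_const _) i4, integral_const, integral_indicator_const _ hB'2]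
    have hDr : (PP N p).real B' ≤ D := by
      rw [Measure.real, hB'3]; exact ENNReal.toReal_le_of_le_ofReal hD0 hD
    simp only [probReal_univ, one_smul, smul_eq_mul]
    have : 0 ≤ 1 + κ⁻¹ := by positivity
    nlinarith
  rw [hint]
  have heq : ∫ z, inc ζ o i z * g z ∂(PP N p) + ζ * ∫ z, g z * r z ∂(PP N p) - ζ * C0 η (log N) =
     ∫ z, inc ζ o i z * g z ∂(PP N p) + ζ * (∫ z, g z * r z ∂(PP N p) - C0 η (log N) * (1 + ∫ z, YY κ τ η o i z ∂(PP N p)))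
     + ζ * C0 η (log N) * ∫ z, YY κ τ η o i z ∂(PP N p) := by ring
  rw [heq]
  refine (norm_add₃_le).trans ?_
  rw [norm_mul, norm_mul, norm_mul, hζ, one_mul, one_mul]
  have : ‖C0 η (log N)‖ * ‖∫ z, YY κ τ η o i z ∂(PP N p)‖ ≤ 2 * (p * τ) * (κ⁻¹ * (log N + τ)) :=
    (mul_le_of_le_one_left (norm_nonneg _) (C0_norm hL)).trans hYn
  linarith
end FPP

namespace FPP

def LL (n : ℕ) : ℝ := log ((n : ℝ) + 2)

lemma tendsto_n2 : Tendsto (fun n : ℕ => (n : ℝ) + 2) atTop atTop :=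
  tendsto_atTop_add_const_right _ _ tendsto_natCast_atTop_atTop
lemma tendsto_LL : Tendsto LL atTop atTop := Real.tendsto_log_atTop.comp tendsto_n2
lemma tendsto_sqrtLL : Tendsto (fun n => sqrt (LL n)) atTop atTop := Real.tendsto_sqrt_atTop.comp tendsto_LL

lemma LLpow (k : ℕ) : Tendsto (fun n => LL n ^ k / ((n : ℝ) + 2)) atTop (nhds 0) := by
  have h := (isLittleO_pow_log_id_atTop (n := k)).tendsto_div_nhds_zero
  exact h.comp tendsto_n2

lemma logLL_sqrt : Tendsto (fun n => log (LL n) / sqrt (LL n)) atTop (nhds 0) := by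
  have h := (isLittleO_log_rpow_atTop (r := 1/2) (by norm_num)).tendsto_div_nhds_zero
  have := h.comp tendsto_LL
  refine this.congr fun n => ?_
  simp [Real.sqrt_eq_rpow]
lemma logLL_LL : Tendsto (fun n => log (LL n) / LL n) atTop (nhds 0) := by
  have h := (Real.isLittleO_log_id_atTop).tendsto_div_nhds_zero
  exact h.comp tendsto_LL

lemma inv_LL : Tendsto (fun n => (LL n)⁻¹) atTop (nhds 0) := tendsto_inv_atTop_zero.comp tendsto_LL
lemma inv_sqrtLL : Tendsto (fun n => (sqrt (LL n))⁻¹) atTop (nhds 0) := tendsto_inv_atTop_zero.comp tendsto_sqrtLL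

variable (p : ℕ → ℝ) [hp : ∀ n, Fact (0 ≤ p n ∧ p n ≤ 1)]

def lam (n : ℕ) : ℝ := ((n : ℝ) + 2) * p n
def tau (a : ℕ → ℝ) (n : ℕ) : ℝ := (1 + 2 * LL n + a n) * (a n / lam p n)

structure AOK (a : ℕ → ℝ) : Prop where
  lim : Tendsto (lam p) atTop atTop
  inf : Tendsto a atTop atTop
  le : ∀ᶠ n in atTop, a n ≤ LL n
  sq : ∀ᶠ n in atTop, (a n + 1) * a n ≤ lam p n

variable {p} {a : ℕ → ℝ}

lemma AOK.div (h : AOK p a) : Tendsto (fun n => a n / lam p n) atTop (nhds 0) := by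
  have h1 : Tendsto (fun n => (a n)⁻¹) atTop (nhds 0) := tendsto_inv_atTop_zero.comp h.inf
  refine squeeze_zero' ?_ ?_ h1
  · filter_upwards [h.lim.eventually_gt_atTop 0, h.inf.eventually_gt_atTop 0] with n h1 h2
    positivity
  · filter_upwards [h.lim.eventually_gt_atTop 0, h.inf.eventually_gt_atTop 0, h.sq] with n h1 h2 h3
    rw [div_le_iff₀ h1, inv_mul_eq_div, le_div_iff₀ h2]
    nlinarith

lemma AOK.tau_div (h : AOK p a) : Tendsto (fun n => tau p a n / LL n) atTop (nhds 0) := by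
  have h1 : Tendsto (fun n => 4 * (a n / lam p n)) atTop (nhds 0) := by simpa using h.div.const_mul 4
  refine squeeze_zero' ?_ ?_ h1
  · filter_upwards [h.lim.eventually_gt_atTop 0, h.inf.eventually_gt_atTop 0, tendsto_LL.eventually_ge_atTop 1] with n h1 h2 h3
    unfold tau; positivity
  · filter_upwards [h.lim.eventually_gt_atTop 0, h.inf.eventually_gt_atTop 0, h.le, tendsto_LL.eventually_ge_atTop 1] with n h1 h2 h3 h4
    have : 0 < a n / lam p n := by positivity
    rw [div_le_iff₀ (by linarith)]
    unfold tau
    nlinarith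

lemma AOK.ptau (h : AOK p a) : ∀ᶠ n in atTop, p n * tau p a n ≤ 4 * LL n ^ 2 / ((n : ℝ) + 2) := by
  filter_upwards [h.lim.eventually_gt_atTop 0, h.inf.eventually_gt_atTop 0, h.le, tendsto_LL.eventually_ge_atTop 1] with n h1 h2 h3 h4
  have hn : (0 : ℝ) < (n : ℝ) + 2 := by positivity
  have hpn : p n ≠ 0 := fun h0 => by simp [lam, h0] at h1
  have : p n * tau p a n = (1 + 2 * LL n + a n) * a n / ((n : ℝ) + 2) := by
    unfold tau lam; field_simp
  rw [this]
  apply div_le_div_of_nonneg_right _ hn.le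
  nlinarith

lemma AOK.D (h : AOK p a) : ∀ᶠ n in atTop,
    PP (n + 2) (p n) (Bad 0 1 (tau p a n) ((LL n ^ 3)⁻¹)) ≤ ofReal (3 * exp (-(a n / 128)) + 8 * (LL n)⁻¹) := by
  have hpt : ∀ᶠ n in atTop, p n * tau p a n ≤ 1 / 2 := by
    have : Tendsto (fun n : ℕ => 4 * LL n ^ 2 / ((n : ℝ) + 2)) atTop (nhds 0) := by
      have := (LLpow 2).const_mul 4
      simpa [mul_div_assoc] using this
    filter_upwards [h.ptau, this.eventually_le_const (show (0:ℝ) < 1/2 by norm_num)] with n h1 h2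
    linarith
  filter_upwards [h.lim.eventually_gt_atTop 0, h.inf.eventually_ge_atTop 128, h.le, h.sq, tendsto_LL.eventually_ge_atTop 1, hpt, h.ptau] with n h1 h2 h3 h4 h5 h6 h7
  have hn : (0 : ℝ) < (n : ℝ) + 2 := by positivity
  have hN : (((n + 2 : ℕ) : ℝ)) = (n : ℝ) + 2 := by push_cast; ring
  have ha0 : 0 < a n := by linarith
  have hτ0 : 0 ≤ tau p a n := by unfold tau; positivity
  have hNp : (((n + 2 : ℕ) : ℝ)) * p n * (a n / lam p n) = a n := by
    rw [hN]; change lam p n * (a n / lam p n) = a n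
    field_simp
  have hg := growth_main (p n) (o := (0 : Fin (n + 2))) (u := 1) (by simp) (Δ := a n / lam p n) (by positivity)
    (by rw [hNp]; exact h2) (by rw [hNp, ← mul_div_assoc, div_le_one h1]; exact h4)
  rw [hNp, hN] at hg
  have hs := SC (p n) (o := (0 : Fin (n + 2))) (u := 1) (by simp) (tau p a n) ((LL n ^ 3)⁻¹ * ((n + 2 : ℕ) : ℝ)) hτ0 (by positivity) h6
  refine (measure_union_le _ _).trans ((add_le_add hg hs).trans ?_)
  rw [← ENNReal.ofReal_add (by positivity) (by have := (hp n).out.1; positivity)]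
  apply ENNReal.ofReal_le_ofReal
  refine add_le_add le_rfl ?_
  rw [hN]
  calc 2 * p n * ((LL n ^ 3)⁻¹ * ((n : ℝ) + 2)) * tau p a n = 2 * ((LL n ^ 3)⁻¹ * ((n : ℝ) + 2)) * (p n * tau p a n) := by ring
    _ ≤ 2 * ((LL n ^ 3)⁻¹ * ((n : ℝ) + 2)) * (4 * LL n ^ 2 / ((n : ℝ) + 2)) := by gcongr
    _ = 8 * (LL n)⁻¹ := by
      have : LL n ≠ 0 := by linarith
      field_simp; norm_num

lemma AOK.P_tau (h : AOK p a) : ∀ᶠ n in atTop,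
    PP (n + 2) (p n) {z | ¬ tt 0 z 1 ≤ ofReal (tau p a n)} ≤ ofReal (3 * exp (-(a n / 128)) + 8 * (LL n)⁻¹) := by
  filter_upwards [h.D] with n hn
  exact (measure_mono (fun z (hz : ¬ tt 0 z 1 ≤ ofReal (tau p a n)) =>
    (Or.inl (fun h => hz h.1) : z ∈ Bad 0 1 (tau p a n) ((LL n ^ 3)⁻¹)))).trans hn

lemma AOK.D_lim (h : AOK p a) : Tendsto (fun n => 3 * exp (-(a n / 128)) + 8 * (LL n)⁻¹) atTop (nhds 0) := by
  have h1 : Tendsto (fun n => exp (-(a n / 128))) atTop (nhds 0) :=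
    Real.tendsto_exp_neg_atTop_nhds_zero.comp (h.inf.atTop_div_const (by norm_num))
  simpa using (h1.const_mul 3).add (inv_LL.const_mul 8)

set_option maxHeartbeats 1000000 in
lemma AOK.clt (h : AOK p a) (θ : ℝ) :
    Tendsto (fun n => ∫ z, JJ (tau p a n) (θ / sqrt (LL n)) (0 : Fin (n + 2)) 1 z ∂(PP (n + 2) (p n)) -
      Complex.exp ((θ / sqrt (LL n) : ℝ) * Complex.I) * C0 (θ / sqrt (LL n)) (LL n)) atTop (nhds 0) := by
  set κ := exp (-(2 * θ ^ 2)) with hκ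
  obtain ⟨δ, hδ⟩ : ∃ δ : ℕ → ℝ, δ = fun n => 2 * |θ| ^ 3 * (sqrt (LL n))⁻¹ + |θ| * (42 * (sqrt (LL n))⁻¹ + 3 * (log (LL n) / sqrt (LL n))) +
    θ ^ 2 / 2 * (42 * (LL n)⁻¹ + 3 * (log (LL n) / LL n) + tau p a n / LL n) := ⟨_, rfl⟩
  have hδl : Tendsto δ atTop (nhds 0) := by
    rw [hδ]
    have := ((inv_sqrtLL.const_mul (2 * |θ| ^ 3)).add (((inv_sqrtLL.const_mul 42).add (logLL_sqrt.const_mul 3)).const_mul |θ|)).add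
      ((((inv_LL.const_mul 42).add (logLL_LL.const_mul 3)).add h.tau_div).const_mul (θ ^ 2 / 2))
    simpa using this
  obtain ⟨D, hD⟩ : ∃ D : ℕ → ℝ, D = fun n => 3 * exp (-(a n / 128)) + 8 * (LL n)⁻¹ := ⟨_, rfl⟩
  have hDl : Tendsto D atTop (nhds 0) := by rw [hD]; exact h.D_lim
  have hDb := h.D
  have hηl : Tendsto (fun n => θ ^ 2 * (LL n)⁻¹) atTop (nhds 0) := by simpa using inv_LL.const_mul (θ ^ 2)
  have hBl : Tendsto (fun n : ℕ => 2 * (4 * (LL n ^ 2 / ((n : ℝ) + 2))) + (6 * (θ ^ 2 * (LL n)⁻¹) + 2 * δ n) * κ⁻¹ + (1 + κ⁻¹) * D n +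
      16 * κ⁻¹ * (LL n ^ 3 / ((n : ℝ) + 2))) atTop (nhds 0) := by
    have := (((((LLpow 2).const_mul 4).const_mul 2).add (((hηl.const_mul 6).add (hδl.const_mul 2)).mul_const κ⁻¹)).add
      (hDl.const_mul (1 + κ⁻¹))).add ((LLpow 3).const_mul (16 * κ⁻¹))
    simpa using this
  refine squeeze_zero_norm' ?_ hBl
  filter_upwards [h.lim.eventually_gt_atTop 0, h.inf.eventually_ge_atTop 128, h.le, h.sq, tendsto_LL.eventually_ge_atTop 1, h.ptau, hDb,
    hδl.eventually_le_const (zero_lt_one), hηl.eventually_le_const zero_lt_one, h.tau_div.eventually_le_const zero_lt_one]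
    with n h1 h2 h3 h4 h5 h6 h7 h8 h9 h10
  have hN : (((n + 2 : ℕ) : ℝ)) = (n : ℝ) + 2 := by push_cast; ring
  have hL : log ((n + 2 : ℕ) : ℝ) = LL n := by rw [hN]; rfl
  have hLp : 0 < LL n := by linarith
  have hs : 0 < sqrt (LL n) := Real.sqrt_pos.2 hLp
  have hss : sqrt (LL n) ^ 2 = LL n := Real.sq_sqrt hLp.le
  have hη2 : (θ / sqrt (LL n)) ^ 2 = θ ^ 2 * (LL n)⁻¹ := by rw [div_pow, hss]; rfl
  have hτL : tau p a n ≤ LL n := by rwa [div_le_one hLp] at h10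
  have ha0 : 0 < a n := by linarith
  have hτ0 : 0 ≤ tau p a n := by unfold tau; positivity
  have hlog0 : 0 ≤ log (LL n) := Real.log_nonneg h5
  have hδ0 : 0 ≤ δ n := by
    rw [hδ]; dsimp only; positivity
  have hD0 : 0 ≤ D n := by rw [hD]; dsimp only; positivity
  have hm := main_bound (p n) (o := (0 : Fin (n + 2))) (i := 1) (by simp) (η := θ / sqrt (LL n)) (τ := tau p a n) (κ := κ)
    (E1 := 42 + 3 * log (LL n)) (ε := (LL n ^ 3)⁻¹) (δ := δ n) (D := D n)
    (by rw [hη2]; exact h9) hτ0 (Real.exp_pos _)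
    (by
      rw [hL, hη2, hκ]
      apply Real.exp_le_exp.2
      apply neg_le_neg
      have : θ ^ 2 * (LL n)⁻¹ * (LL n + tau p a n) ≤ θ ^ 2 * (LL n)⁻¹ * (LL n + LL n) := by gcongr
      refine this.trans (le_of_eq ?_)
      field_simp; ring)
    (by positivity) (by rw [Real.log_inv, Real.log_pow]; push_cast; linarith)
    (by
      rw [hL, hη2, abs_div, abs_of_pos hs, hδ]
      dsimp only
      have e1 : (|θ| / sqrt (LL n)) ^ 3 * (LL n + tau p a n) ≤ 2 * |θ| ^ 3 * (sqrt (LL n))⁻¹ := by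
        have : (|θ| / sqrt (LL n)) ^ 3 * (LL n + tau p a n) ≤ (|θ| / sqrt (LL n)) ^ 3 * (2 * sqrt (LL n) ^ 2) := by
          rw [hss]; gcongr; linarith
        refine this.trans (le_of_eq ?_)
        field_simp
      have e2 : |θ| / sqrt (LL n) * (42 + 3 * log (LL n)) = |θ| * (42 * (sqrt (LL n))⁻¹ + 3 * (log (LL n) / sqrt (LL n))) := by
        field_simp
      have e3 : θ ^ 2 * (LL n)⁻¹ / 2 * (42 + 3 * log (LL n) + tau p a n) = θ ^ 2 / 2 * (42 * (LL n)⁻¹ + 3 * (log (LL n) / LL n) + tau p a n / LL n) := by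
        field_simp
      linarith)
    h8 hδ0 hD0 (by rw [hD]; exact h7)
  rw [hL, hη2] at hm
  refine hm.trans ?_
  have hp0 := (hp n).out.1
  have hκi : 0 < κ⁻¹ := inv_pos.2 (Real.exp_pos _)
  have f1 : 2 * (p n * tau p a n) ≤ 2 * (4 * (LL n ^ 2 / ((n : ℝ) + 2))) := by
    rw [← mul_div_assoc 4]; linarith
  have f2 : 2 * (p n * tau p a n) * (κ⁻¹ * (LL n + tau p a n)) ≤ 16 * κ⁻¹ * (LL n ^ 3 / ((n : ℝ) + 2)) := by
    calc 2 * (p n * tau p a n) * (κ⁻¹ * (LL n + tau p a n)) ≤ 2 * (4 * LL n ^ 2 / ((n : ℝ) + 2)) * (κ⁻¹ * (LL n + LL n)) := by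
          gcongr
      _ = _ := by ring
  linarith
end FPP

namespace FPP

lemma int_close {Ω E : Type*} [MeasurableSpace Ω] (P : Measure Ω) [IsProbabilityMeasure P] [NormedAddCommGroup E] [NormedSpace ℝ E]
    {f g : Ω → E} {B : Set Ω} (hB : MeasurableSet B) {ε K D : ℝ} (hf : Integrable f P) (hg : Integrable g P)
    (hD : P B ≤ ofReal D) (hD0 : 0 ≤ D) (hK : 0 ≤ K) (hε : 0 ≤ ε) (h1 : ∀ z, z ∉ B → ‖f z - g z‖ ≤ ε) (h2 : ∀ z, ‖f z - g z‖ ≤ K) :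
    ‖∫ z, f z ∂P - ∫ z, g z ∂P‖ ≤ ε + K * D := by
  rw [← integral_sub hf hg]
  have hi : Integrable (B.indicator fun _ => K) P := (integrable_const K).indicator hB
  calc ‖∫ z, (f z - g z) ∂P‖ ≤ ∫ z, ‖f z - g z‖ ∂P := norm_integral_le_integral_norm _
    _ ≤ ∫ z, (ε + B.indicator (fun _ => K) z) ∂P := by
      refine integral_mono (hf.sub hg).norm ((integrable_const _).add hi) fun z => ?_
      by_cases hz : z ∈ B
      · simp only [hz, Set.indicator_of_mem]
        linarith [h2 z]
      · simp only [hz, not_false_eq_true, Set.indicator_of_notMem, add_zero]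
        exact h1 z hz
    _ = ε + K * P.real B := by
      rw [integral_add (integrable_const _) hi, integral_indicator hB]
      simp [mul_comm]
    _ ≤ ε + K * D := by
      have : P.real B ≤ D := ENNReal.toReal_le_of_le_ofReal hD0 hD
      gcongr

lemma levy_normal {S : ℕ → Type*} [∀ n, MeasurableSpace (S n)] (P : ∀ n, Measure (S n)) [∀ n, IsProbabilityMeasure (P n)]
    (X : ∀ n, S n → ℝ) (hX : ∀ n, Measurable (X n))
    (h : ∀ θ : ℝ, Tendsto (fun n => ∫ z, Complex.exp (((θ * X n z : ℝ) : ℂ) * Complex.I) ∂(P n)) atTop (nhds (Complex.exp (-(θ : ℂ) ^ 2 / 2))))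
    (g : ℝ → ℝ) (hg : Continuous g) (hb : ∃ C, ∀ x, |g x| ≤ C) :
    Tendsto (fun n => ∫ z, g (X n z) ∂(P n)) atTop (nhds (∫ x, g x ∂(gaussianReal 0 1))) := by
  have hpm : ∀ n, IsProbabilityMeasure ((P n).map (X n)) := fun n => Measure.isProbabilityMeasure_map (hX n).aemeasurable
  have h1 := ProbabilityMeasure.tendsto_of_tendsto_charFun (μ := fun n => (⟨(P n).map (X n), hpm n⟩ : ProbabilityMeasure ℝ))
    (μ₀ := ⟨gaussianReal 0 1, inferInstance⟩) (by
      intro t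
      have := h t
      simp only [ProbabilityMeasure.coe_mk]
      rw [charFun_gaussianReal]
      convert this using 2
      · rename_i n
        rw [charFun_apply_real, integral_map (hX n).aemeasurable (by fun_prop)]
        simp
      · simp; ring_nf)
  obtain ⟨C, hC⟩ := hb
  have h2 := (ProbabilityMeasure.tendsto_iff_forall_integral_tendsto.1 h1) (BoundedContinuousFunction.ofNormedAddCommGroup g hg C (by simpa using hC))
  simp only [ProbabilityMeasure.coe_mk, BoundedContinuousFunction.coe_ofNormedAddCommGroup] at h2
  refine h2.congr fun n => ?_
  rw [integral_map (hX n).aemeasurable hg.aestronglyMeasurable]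

def Yf (n : ℕ) (z : Cf (n + 2)) : ℝ := ((dd 0 z 1 : ℝ) - LL n - (tt 0 z 1).toReal) / sqrt (LL n)
def Xf (n : ℕ) (z : Cf (n + 2)) : ℝ := ((dd 0 z 1 : ℝ) - LL n) / sqrt (LL n)

lemma measurable_ddR (n : ℕ) : Measurable (fun z : Cf (n + 2) => (dd 0 z 1 : ℝ)) := (measurable_of_countable _).comp (measurable_dd 0 1)
lemma measurable_Yf (n : ℕ) : Measurable (Yf n) :=
  (((measurable_ddR n).sub_const _).sub (measurable_tt 0 1).ennreal_toReal).div_const _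
lemma measurable_Xf (n : ℕ) : Measurable (Xf n) := ((measurable_ddR n).sub_const _).div_const _

lemma integrable_eI {Ω : Type*} [MeasurableSpace Ω] (P : Measure Ω) [IsProbabilityMeasure P] (f : Ω → ℝ) (hf : Measurable f) :
    Integrable (fun z => Complex.exp ((f z : ℂ) * Complex.I)) P := by
  refine (integrable_const (1 : ℝ)).mono' (by fun_prop) (Filter.Eventually.of_forall fun z => ?_)
  rw [Complex.norm_exp_ofReal_mul_I]

variable {p : ℕ → ℝ} [hp : ∀ n, Fact (0 ≤ p n ∧ p n ≤ 1)] {a : ℕ → ℝ}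

lemma JJ_eq (n : ℕ) (τ θ : ℝ) (z : Cf (n + 2)) (hz : tt 0 z 1 ≤ ofReal τ) (hL : 0 < LL n) :
    Complex.exp ((-(θ / sqrt (LL n) * LL n) : ℝ) * Complex.I) * JJ τ (θ / sqrt (LL n)) 0 1 z =
      Complex.exp (((θ * Yf n z : ℝ) : ℂ) * Complex.I) := by
  unfold JJ xi Yf
  rw [if_pos hz, ← Complex.exp_nat_mul, ← Complex.exp_add, ← Complex.exp_add]
  congr 1
  push_cast
  ring

lemma C0_eq (n : ℕ) (θ : ℝ) (hL : 0 < LL n) :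
    Complex.exp ((-(θ / sqrt (LL n) * LL n) : ℝ) * Complex.I) * C0 (θ / sqrt (LL n)) (LL n) = Complex.exp (-(θ : ℂ) ^ 2 / 2) := by
  unfold C0
  rw [← Complex.exp_add]
  congr 1
  have : (θ / sqrt (LL n)) ^ 2 * LL n / 2 = θ ^ 2 / 2 := by
    rw [div_pow, Real.sq_sqrt hL.le]; field_simp
  rw [this]
  push_cast
  ring

lemma AOK.charY (h : AOK p a) (θ : ℝ) :
    Tendsto (fun n => ∫ z, Complex.exp (((θ * Yf n z : ℝ) : ℂ) * Complex.I) ∂(PP (n + 2) (p n))) atTop (nhds (Complex.exp (-(θ : ℂ) ^ 2 / 2))) := by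
  obtain ⟨u, hu⟩ : ∃ u : ℕ → ℂ, u = fun n => Complex.exp ((-(θ / sqrt (LL n) * LL n) : ℝ) * Complex.I) := ⟨_, rfl⟩
  have hun : ∀ n, ‖u n‖ = 1 := fun n => by rw [hu]; exact Complex.norm_exp_ofReal_mul_I _
  have h1 : Tendsto (fun n => u n * ∫ z, JJ (tau p a n) (θ / sqrt (LL n)) (0 : Fin (n + 2)) 1 z ∂(PP (n + 2) (p n))) atTop
      (nhds (Complex.exp (-(θ : ℂ) ^ 2 / 2))) := by
    have e1 : Tendsto (fun n => Complex.exp ((θ / sqrt (LL n) : ℝ) * Complex.I)) atTop (nhds 1) := by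
      have : Tendsto (fun n => θ / sqrt (LL n)) atTop (nhds 0) := by
        simpa [div_eq_mul_inv] using inv_sqrtLL.const_mul θ
      have hc : Continuous fun x : ℝ => Complex.exp ((x : ℂ) * Complex.I) := by fun_prop
      have q := (hc.tendsto 0).comp this
      simp only [Complex.ofReal_zero, zero_mul, Complex.exp_zero] at q
      exact q
    have e2 := e1.mul_const (Complex.exp (-(θ : ℂ) ^ 2 / 2))
    rw [one_mul] at e2
    have e3 := (tendsto_zero_iff_norm_tendsto_zero.1 (h.clt θ))
    have e4 : Tendsto (fun n => u n * (∫ z, JJ (tau p a n) (θ / sqrt (LL n)) (0 : Fin (n + 2)) 1 z ∂(PP (n + 2) (p n)) -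
      Complex.exp ((θ / sqrt (LL n) : ℝ) * Complex.I) * C0 (θ / sqrt (LL n)) (LL n))) atTop (nhds 0) := by
      refine tendsto_zero_iff_norm_tendsto_zero.2 (e3.congr fun n => ?_)
      rw [norm_mul, hun, one_mul]
    have e5 := e4.add e2
    rw [zero_add] at e5
    refine e5.congr' ?_
    filter_upwards [tendsto_LL.eventually_gt_atTop 0] with n hn
    rw [← C0_eq n θ hn, hu]
    ring
  have h2 : Tendsto (fun n => ∫ z, Complex.exp (((θ * Yf n z : ℝ) : ℂ) * Complex.I) ∂(PP (n + 2) (p n)) -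
      u n * ∫ z, JJ (tau p a n) (θ / sqrt (LL n)) (0 : Fin (n + 2)) 1 z ∂(PP (n + 2) (p n))) atTop (nhds 0) := by
    refine squeeze_zero_norm' ?_ (by simpa using h.D_lim.const_mul 2)
    filter_upwards [tendsto_LL.eventually_gt_atTop 0, h.P_tau] with n hn hP
    rw [← integral_const_mul]
    have hB : MeasurableSet {z : Cf (n + 2) | ¬ tt 0 z 1 ≤ ofReal (tau p a n)} :=
      (measurableSet_le (measurable_tt 0 1) measurable_const).compl
    have hJn : ∀ z : Cf (n + 2), ‖u n * JJ (tau p a n) (θ / sqrt (LL n)) 0 1 z‖ ≤ 1 := by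
      intro z
      by_cases hz : tt 0 z 1 ≤ ofReal (tau p a n)
      · have := JJ_eq n (tau p a n) θ z hz hn
        rw [hu]; dsimp only; rw [this, Complex.norm_exp_ofReal_mul_I]
      · unfold JJ; rw [if_neg hz]; simp
    have hJm : Measurable fun z : Cf (n + 2) => u n * JJ (tau p a n) (θ / sqrt (LL n)) 0 1 z := by
      have hm : MeasurableSet {z : Cf (n + 2) | tt 0 z 1 ≤ ofReal (tau p a n)} := measurableSet_le (measurable_tt 0 1) measurable_const
      refine Measurable.const_mul ?_ _
      unfold JJ
      refine Measurable.ite hm ?_ measurable_const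
      refine Measurable.mul ?_ ?_
      · unfold xi; exact (measurable_of_countable (fun k : ℕ => Complex.exp ((θ / sqrt (LL n) : ℝ) * Complex.I) ^ k)).comp (measurable_dd 0 1)
      · have := (measurable_tt (0 : Fin (n + 2)) 1).ennreal_toReal
        fun_prop
    have := int_close (PP (n + 2) (p n)) hB (ε := 0) (K := 2) (integrable_eI (PP (n + 2) (p n)) (fun z => θ * Yf n z) ((measurable_Yf n).const_mul θ))
      (f := fun z => Complex.exp (((θ * Yf n z : ℝ) : ℂ) * Complex.I)) (g := fun z => u n * JJ (tau p a n) (θ / sqrt (LL n)) 0 1 z)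
      ((integrable_const (1 : ℝ)).mono' hJm.aestronglyMeasurable (Filter.Eventually.of_forall hJn)) hP (by positivity) (by norm_num) le_rfl
      (fun z hz => by
        have hz : tt 0 z 1 ≤ ofReal (tau p a n) := not_not.1 hz
        rw [hu]; dsimp only; rw [JJ_eq n (tau p a n) θ z hz hn]; simp)
      (fun z => by
        refine (norm_sub_le _ _).trans ?_
        have := hJn z
        rw [Complex.norm_exp_ofReal_mul_I]; linarith)
    rwa [zero_add] at this
  have := h2.add h1
  simpa using this
end FPP

namespace FPP
variable {p : ℕ → ℝ} [hp : ∀ n, Fact (0 ≤ p n ∧ p n ≤ 1)] {a : ℕ → ℝ}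

lemma AOK_of (lim : Tendsto (lam p) atTop atTop) (inf : Tendsto a atTop atTop) (le : ∀ n, a n ≤ LL n) (le' : ∀ n, a n ≤ sqrt (lam p n) / 2) : AOK p a := by
  refine ⟨lim, inf, Eventually.of_forall le, ?_⟩
  filter_upwards [lim.eventually_ge_atTop 1, inf.eventually_ge_atTop 0] with n h1 h2
  have h3 := le' n
  have h4 := Real.sq_sqrt (zero_le_one.trans h1)
  have h5 : 1 ≤ sqrt (lam p n) := Real.one_le_sqrt.2 h1
  nlinarith

lemma sqrt_lam (lim : Tendsto (lam p) atTop atTop) : Tendsto (fun n => sqrt (lam p n) / 2) atTop atTop :=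
  (Real.tendsto_sqrt_atTop.comp lim).atTop_div_const (by norm_num)

lemma min_tendsto {f g : ℕ → ℝ} (hf : Tendsto f atTop atTop) (hg : Tendsto g atTop atTop) : Tendsto (fun n => min (f n) (g n)) atTop atTop := by
  rw [tendsto_atTop] at *
  intro b
  filter_upwards [hf b, hg b] with n h1 h2 using le_min h1 h2

lemma AOK1 (lim : Tendsto (lam p) atTop atTop) : AOK p (fun n => min (sqrt (lam p n) / 2) (LL n)) :=
  AOK_of lim (min_tendsto (sqrt_lam lim) tendsto_LL) (fun n => min_le_right _ _) (fun n => min_le_left _ _)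

lemma AOK2' (h : AOK p a) (hr : Tendsto (fun n => lam p n / sqrt (LL n)) atTop atTop)
    (hl : ∀ n, a n ≤ sqrt (lam p n / sqrt (LL n))) : Tendsto (fun n => tau p a n / sqrt (LL n)) atTop (nhds 0) := by
  have hs := (tendsto_inv_atTop_zero.comp (Real.tendsto_sqrt_atTop.comp hr)).const_mul 4
  rw [mul_zero] at hs
  refine squeeze_zero' ?_ ?_ hs
  · filter_upwards [h.lim.eventually_gt_atTop 0, h.inf.eventually_gt_atTop 0, tendsto_LL.eventually_ge_atTop 1] with n h1 h2 h3
    unfold tau; positivity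
  · filter_upwards [h.lim.eventually_gt_atTop 0, h.inf.eventually_gt_atTop 0, h.le, tendsto_LL.eventually_ge_atTop 1] with n h1 h2 h3 h4
    have hs : 0 < sqrt (LL n) := Real.sqrt_pos.2 (by linarith)
    have hss : sqrt (LL n) ^ 2 = LL n := Real.sq_sqrt (by linarith)
    have hq : 0 < a n / lam p n := by positivity
    have e1 : tau p a n / sqrt (LL n) ≤ 4 * (a n * (sqrt (LL n) / lam p n)) := by
      rw [div_le_iff₀ hs]
      calc tau p a n ≤ (4 * LL n) * (a n / lam p n) := by unfold tau; gcongr; linarith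
        _ = (4 * sqrt (LL n) ^ 2) * (a n / lam p n) := by rw [hss]
        _ = _ := by ring
    refine e1.trans ?_
    simp only [Function.comp]
    have hr0 : 0 < lam p n / sqrt (LL n) := by positivity
    have hrs := Real.sqrt_pos.2 hr0
    have : sqrt (LL n) / lam p n = (lam p n / sqrt (LL n))⁻¹ := (inv_div _ _).symm
    rw [this]
    apply mul_le_mul_of_nonneg_left _ (by norm_num)
    rw [← div_eq_mul_inv, div_le_iff₀ hr0]
    refine (hl n).trans (le_of_eq ?_)
    nth_rewrite 3 [← Real.sq_sqrt hr0.le]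
    field_simp

lemma AOK2 (lim : Tendsto (lam p) atTop atTop) (hr : Tendsto (fun n => lam p n / sqrt (LL n)) atTop atTop) :
    ∃ a, AOK p a ∧ Tendsto (fun n => tau p a n / sqrt (LL n)) atTop (nhds 0) := by
  have hs := Real.tendsto_sqrt_atTop.comp hr
  have h : AOK p (fun n => min (min (sqrt (lam p n) / 2) (LL n)) (sqrt (lam p n / sqrt (LL n)))) :=
    AOK_of lim (min_tendsto (min_tendsto (sqrt_lam lim) tendsto_LL) hs)
      (fun n => (min_le_left _ _).trans (min_le_right _ _)) (fun n => (min_le_left _ _).trans (min_le_left _ _))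
  exact ⟨_, h, AOK2' h hr fun n => min_le_right _ _⟩

lemma exp_diff (x y : ℝ) : ‖Complex.exp ((x : ℂ) * Complex.I) - Complex.exp ((y : ℂ) * Complex.I)‖ ≤ |x - y| := by
  have : Complex.exp ((x : ℂ) * Complex.I) - Complex.exp ((y : ℂ) * Complex.I) =
      Complex.exp ((y : ℂ) * Complex.I) * (Complex.exp (Complex.I * ((x - y : ℝ) : ℂ)) - 1) := by
    rw [mul_sub, ← Complex.exp_add]; push_cast; ring_nf
  rw [this, norm_mul, Complex.norm_exp_ofReal_mul_I, one_mul]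
  exact Real.norm_exp_I_mul_ofReal_sub_one_le

lemma XY (n : ℕ) (z : Cf (n + 2)) : Xf n z = Yf n z + (tt 0 z 1).toReal / sqrt (LL n) := by
  unfold Xf Yf; ring

lemma AOK.charX (h : AOK p a) (ht : Tendsto (fun n => tau p a n / sqrt (LL n)) atTop (nhds 0)) (θ : ℝ) :
    Tendsto (fun n => ∫ z, Complex.exp (((θ * Xf n z : ℝ) : ℂ) * Complex.I) ∂(PP (n + 2) (p n))) atTop (nhds (Complex.exp (-(θ : ℂ) ^ 2 / 2))) := by
  have h2 : Tendsto (fun n => ∫ z, Complex.exp (((θ * Xf n z : ℝ) : ℂ) * Complex.I) ∂(PP (n + 2) (p n)) -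
      ∫ z, Complex.exp (((θ * Yf n z : ℝ) : ℂ) * Complex.I) ∂(PP (n + 2) (p n))) atTop (nhds 0) := by
    refine squeeze_zero_norm' ?_ (by simpa using (ht.const_mul |θ|).add (h.D_lim.const_mul 2))
    filter_upwards [tendsto_LL.eventually_gt_atTop 0, h.P_tau, h.lim.eventually_gt_atTop 0, h.inf.eventually_gt_atTop 0] with n hn hP h1 h2
    have hτ0 : 0 ≤ tau p a n := by unfold tau; positivity
    have hB : MeasurableSet {z : Cf (n + 2) | ¬ tt 0 z 1 ≤ ofReal (tau p a n)} :=
      (measurableSet_le (measurable_tt 0 1) measurable_const).compl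
    exact int_close (PP (n + 2) (p n)) hB (integrable_eI (PP (n + 2) (p n)) (fun z => θ * Xf n z) ((measurable_Xf n).const_mul θ))
      (integrable_eI (PP (n + 2) (p n)) (fun z => θ * Yf n z) ((measurable_Yf n).const_mul θ)) hP (by positivity) (by norm_num) (by positivity)
      (fun z hz => by
        have hz : tt 0 z 1 ≤ ofReal (tau p a n) := not_not.1 hz
        refine (exp_diff _ _).trans ?_
        rw [← mul_sub, abs_mul, XY, add_sub_cancel_left, abs_div, abs_of_nonneg ENNReal.toReal_nonneg, abs_of_nonneg (Real.sqrt_nonneg _)]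
        have := ENNReal.toReal_le_of_le_ofReal hτ0 hz
        gcongr)
      (fun z => by
        refine (norm_sub_le _ _).trans ?_
        rw [Complex.norm_exp_ofReal_mul_I, Complex.norm_exp_ofReal_mul_I]; norm_num)
  have := h2.add (h.charY θ)
  simpa using this

lemma arctan_abs (x : ℝ) : |arctan x| ≤ 2 := by
  have h1 := Real.arctan_lt_pi_div_two x
  have h2 := Real.neg_pi_div_two_lt_arctan x
  have := Real.pi_le_four
  rw [abs_le]; constructor <;> linarith

lemma int_arctan {Ω : Type*} [MeasurableSpace Ω] (P : Measure Ω) [IsProbabilityMeasure P] (f : Ω → ℝ) (hf : Measurable f) :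
    Integrable (fun z => arctan (f z)) P :=
  (integrable_const (2 : ℝ)).mono' (Real.measurable_arctan.comp hf).aestronglyMeasurable (Eventually.of_forall fun _ => arctan_abs _)

lemma arctan_gap {c : ℝ} (hc : 0 < c) : ∫ x, arctan x ∂(gaussianReal 0 1) < ∫ x, arctan (x + c) ∂(gaussianReal 0 1) := by
  have i1 : Integrable (fun x => arctan x) (gaussianReal 0 1) := int_arctan (gaussianReal 0 1) id measurable_id
  have i2 := int_arctan (gaussianReal 0 1) (fun x => x + c) (by fun_prop)
  have hpos : ∀ x : ℝ, 0 < arctan (x + c) - arctan x := fun x => sub_pos.2 (Real.arctan_strictMono (by linarith))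
  rw [← sub_pos, ← integral_sub i2 i1]
  rw [integral_pos_iff_support_of_nonneg (fun x => (hpos x).le) (i2.sub i1)]
  have : Function.support (fun x : ℝ => arctan (x + c) - arctan x) = Set.univ := by
    ext x; simpa using (hpos x).ne'
  rw [this]; simp

lemma arctan_contra (lim : Tendsto (lam p) atTop atTop) (hn : ¬ Tendsto (fun n => lam p n / sqrt (LL n)) atTop atTop) :
    ¬ Tendsto (fun n => ∫ z, arctan (Xf n z) ∂(PP (n + 2) (p n))) atTop (nhds (∫ x, arctan x ∂(gaussianReal 0 1))) := by
  intro hX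
  have h := AOK1 lim
  revert h
  generalize (fun n => min (sqrt (lam p n) / 2) (LL n)) = a
  intro h
  rw [tendsto_atTop] at hn
  push Not at hn
  obtain ⟨b, hb⟩ := hn
  set C := max b 1 with hC
  have hC0 : 0 < C := lt_of_lt_of_le one_pos (le_max_right _ _)
  set c := 1 / (4 * C) with hc
  have hc0 : 0 < c := by positivity
  have hY := levy_normal (fun n => PP (n + 2) (p n)) Yf measurable_Yf h.charY (fun x => arctan (x + c))
    (Real.continuous_arctan.comp (by fun_prop)) ⟨2, fun x => arctan_abs _⟩
  have hgap := arctan_gap hc0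
  have hD : Tendsto (fun n => 4 * (exp (-(LL n / 2)) + (3 * exp (-(a n / 128)) + 8 * (LL n)⁻¹))) atTop (nhds 0) := by
    have h1 : Tendsto (fun n => exp (-(LL n / 2))) atTop (nhds 0) :=
      Real.tendsto_exp_neg_atTop_nhds_zero.comp (tendsto_LL.atTop_div_const (by norm_num))
    simpa using (h1.add h.D_lim).const_mul 4
  have hlim := (hX.sub (hY.sub hD))
  have hneg : ∫ x, arctan x ∂(gaussianReal 0 1) - (∫ x, arctan (x + c) ∂(gaussianReal 0 1) - 0) < 0 := by linarith
  have hev := hlim.eventually_lt_const hneg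
  obtain ⟨n, hbn, hevn, hL, hP, hl0, ha0⟩ := (hb.and_eventually (hev.and ((tendsto_LL.eventually_gt_atTop 0).and (h.P_tau.and
    ((h.lim.eventually_gt_atTop 0).and (h.inf.eventually_gt_atTop 0)))))).exists
  have hN : (((n + 2 : ℕ) : ℝ)) = (n : ℝ) + 2 := by push_cast; ring
  have hs : 0 < sqrt (LL n) := Real.sqrt_pos.2 hL
  have hss : sqrt (LL n) * sqrt (LL n) = LL n := Real.mul_self_sqrt hL.le
  have hlap := lap (p n) (N := n + 2) (by omega) (o := 0) (u := 1) (by simp) (c * sqrt (LL n))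
  have hlap' : PP (n + 2) (p n) {z | tt 0 z 1 ≤ ofReal (c * sqrt (LL n))} ≤ ofReal (exp (-(LL n / 2))) := by
    refine hlap.trans (ENNReal.ofReal_le_ofReal ?_)
    have hNe : (((n + 2 : ℕ) : ℝ)) = exp (LL n) := by rw [hN, LL, Real.exp_log (by positivity)]
    have hlam : ((n + 2 : ℕ) : ℝ) * p n = lam p n := by rw [hN]; rfl
    rw [hlam, hNe, ← Real.exp_sub]
    apply Real.exp_le_exp.2
    have : lam p n ≤ C * sqrt (LL n) := by
      rw [div_lt_iff₀ hs] at hbn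
      refine hbn.le.trans ?_
      gcongr; exact le_max_left _ _
    have e : 2 * lam p n * (c * sqrt (LL n)) ≤ 2 * (C * sqrt (LL n)) * (c * sqrt (LL n)) := by gcongr
    have e2 : 2 * (C * sqrt (LL n)) * (c * sqrt (LL n)) = LL n / 2 := by
      rw [show 2 * (C * sqrt (LL n)) * (c * sqrt (LL n)) = 2 * (C * c) * (sqrt (LL n) * sqrt (LL n)) by ring, hss, hc]
      field_simp; norm_num
    linarith
  have hB : MeasurableSet ({z : Cf (n + 2) | tt 0 z 1 ≤ ofReal (c * sqrt (LL n))} ∪ {z | ¬ tt 0 z 1 ≤ ofReal (tau p a n)}) :=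
    (measurableSet_le (measurable_tt 0 1) measurable_const).union (measurableSet_le (measurable_tt 0 1) measurable_const).compl
  have iX := int_arctan (PP (n + 2) (p n)) (Xf n) (measurable_Xf n)
  have iY := int_arctan (PP (n + 2) (p n)) (fun z => Yf n z + c) ((measurable_Yf n).add_const c)
  have hcl := int_close (PP (n + 2) (p n)) hB (f := fun z => arctan (Yf n z + c)) (g := fun z => min (arctan (Xf n z)) (arctan (Yf n z + c)))
    (ε := 0) (K := 4) iY (iX.inf iY) (D := exp (-(LL n / 2)) + (3 * exp (-(a n / 128)) + 8 * (LL n)⁻¹))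
    ((measure_union_le _ _).trans (by rw [ENNReal.ofReal_add (by positivity) (by positivity)]; exact add_le_add hlap' hP)) (by positivity)
    (by norm_num) le_rfl
    (fun z hz => by
      have h1 : ¬ tt 0 z 1 ≤ ofReal (c * sqrt (LL n)) := fun h => hz (Or.inl h)
      have h2 : tt 0 z 1 ≤ ofReal (tau p a n) := not_not.1 fun h => hz (Or.inr h)
      have h3 : c * sqrt (LL n) ≤ (tt 0 z 1).toReal :=
        (ENNReal.ofReal_le_iff_le_toReal (ne_top_of_le_ne_top ENNReal.ofReal_ne_top h2)).1 (not_le.1 h1).le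
      have h4 : Yf n z + c ≤ Xf n z := by
        rw [XY]; gcongr; rwa [le_div_iff₀ hs]
      rw [min_eq_right (Real.arctan_strictMono.monotone h4)]; simp)
    (fun z => by
      have h1 := abs_le.1 (arctan_abs (Xf n z))
      have h2 := abs_le.1 (arctan_abs (Yf n z + c))
      rw [Real.norm_eq_abs, abs_le]
      rcases min_choice (arctan (Xf n z)) (arctan (Yf n z + c)) with h | h <;> rw [h] <;> constructor <;> linarith)
  have hmono : ∫ z, min (arctan (Xf n z)) (arctan (Yf n z + c)) ∂(PP (n + 2) (p n)) ≤ ∫ z, arctan (Xf n z) ∂(PP (n + 2) (p n)) :=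
    integral_mono (iX.inf iY) iX fun z => min_le_left _ _
  have := (abs_le.1 (Real.norm_eq_abs _ ▸ hcl)).2
  linarith
end FPP

namespace FPP

lemma reach_TT {n : ℕ} (z : Sym2 (Fin n) → Bool × ℝ) (o v : Fin n) (h : (theGraph z).Reachable o v) : TT o (effWeight z) v ≠ ⊤ := by
  rw [SimpleGraph.reachable_iff_reflTransGen] at h
  induction h with
  | refl => simp
  | tail _ hab ih =>
    refine ne_top_of_le_ne_top (ENNReal.add_ne_top.2 ⟨ih, ?_⟩) (TT_step o (effWeight z) _ _)
    unfold effWeight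
    split_ifs with hc
    · exact ENNReal.ofReal_ne_top
    · exact absurd hab hc

lemma cond_lim {S : ℕ → Type*} [∀ n, MeasurableSpace (S n)] (P : ∀ n, Measure (S n)) [∀ n, IsProbabilityMeasure (P n)]
    (C : ∀ n, Set (S n)) (hC : ∀ n, MeasurableSet (C n)) (hl : Tendsto (fun n => (P n).real (C n)ᶜ) atTop (nhds 0))
    (f : ∀ n, S n → ℝ) (hf : ∀ n, Measurable (f n)) (K : ℝ) (hK : ∀ n z, |f n z| ≤ K) :
    Tendsto (fun n => ∫ z, f n z ∂((P n)[|C n]) - ∫ z, f n z ∂(P n)) atTop (nhds 0) := by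
  have hi : ∀ n, Integrable (f n) (P n) := fun n => (integrable_const K).mono' (hf n).aestronglyMeasurable (Eventually.of_forall (hK n))
  have hq : Tendsto (fun n => (P n).real (C n)) atTop (nhds 1) := by
    have : Tendsto (fun n => 1 - (P n).real (C n)ᶜ) atTop (nhds (1 - 0)) := tendsto_const_nhds.sub hl
    rw [sub_zero] at this
    refine this.congr fun n => ?_
    rw [probReal_compl_eq_one_sub (hC n)]; ring
  have hq1 : Tendsto (fun n => |((P n).real (C n))⁻¹ - 1| * K + K * (P n).real (C n)ᶜ) atTop (nhds 0) := by
    have h1 := ((hq.inv₀ one_ne_zero).sub_const 1).abs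
    simpa using (h1.mul_const K).add (hl.const_mul K)
  refine squeeze_zero_norm (fun n => ?_) hq1
  have hK0 : 0 ≤ K := by
    haveI := (P n).nonempty_of_neZero
    exact (abs_nonneg _).trans (hK n (Classical.arbitrary _))
  have e1 : ∫ z, f n z ∂((P n)[|C n]) = ((P n).real (C n))⁻¹ * ∫ z in C n, f n z ∂(P n) := by
    rw [ProbabilityTheory.cond, integral_smul_measure, ENNReal.toReal_inv]; rfl
  have e2 := integral_add_compl (hC n) (hi n)
  have b1 : |∫ z in C n, f n z ∂(P n)| ≤ K := by
    have := norm_setIntegral_le_of_norm_le_const (μ := P n) (s := C n) (f := f n) (C := K) (measure_lt_top _ _) (fun z _ => hK n z)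
    refine this.trans ?_
    exact mul_le_of_le_one_right hK0 measureReal_le_one
  have b2 : |∫ z in (C n)ᶜ, f n z ∂(P n)| ≤ K * (P n).real (C n)ᶜ :=
    norm_setIntegral_le_of_norm_le_const (μ := P n) (s := (C n)ᶜ) (f := f n) (C := K) (measure_lt_top _ _) (fun z _ => hK n z)
  rw [e1, ← e2, Real.norm_eq_abs]
  have : ((P n).real (C n))⁻¹ * ∫ z in C n, f n z ∂(P n) - (∫ z in C n, f n z ∂(P n) + ∫ z in (C n)ᶜ, f n z ∂(P n)) =
    (((P n).real (C n))⁻¹ - 1) * ∫ z in C n, f n z ∂(P n) + -∫ z in (C n)ᶜ, f n z ∂(P n) := by ring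
  rw [this]
  refine (abs_add_le _ _).trans (add_le_add ?_ (by rwa [abs_neg]))
  rw [abs_mul]
  gcongr

theorem final
    (p : ℕ → ℝ) (hp : ∀ n, 0 ≤ p n ∧ p n ≤ 1)
    (hlim : Tendsto (fun n : ℕ => ((n : ℝ) + 2) * p n) atTop atTop)
    (Ω : ℕ → Type) (mΩ : ∀ n, MeasurableSpace (Ω n)) (μ : ∀ n, Measure (Ω n))
    (hμ : ∀ n, IsProbabilityMeasure (μ n))
    (Z : ∀ n, Sym2 (Fin (n + 2)) → Ω n → Bool × ℝ)
    (hZmeas : ∀ n e, Measurable (Z n e))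
    (hindep : ∀ n, iIndepFun (m := fun _ => inferInstance) (Z n) (μ n))
    (hlaw : ∀ n e, (μ n).map (Z n e) = (bernoulliDist (p n)).prod expDist)
    (H : ∀ n, Ω n → ℕ)
    (hH : ∀ n ω, H n ω = hopCount (effWeight (fun e => Z n e ω)) 0 1)
    (Conn : ∀ n, Set (Ω n))
    (hConn : ∀ n, Conn n = {ω | (theGraph (fun e => Z n e ω)).Reachable 0 1}) :
    ((∀ g : ℝ → ℝ, Continuous g → (∃ C, ∀ x, |g x| ≤ C) →
      Tendsto (fun n : ℕ =>
          ∫ ω, g (((H n ω : ℝ) - log ((n : ℝ) + 2)) /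
            sqrt (log ((n : ℝ) + 2))) ∂((μ n)[|Conn n]))
        atTop (nhds (∫ x, g x ∂(gaussianReal 0 1))))
      ↔ Tendsto (fun n : ℕ => (((n : ℝ) + 2) * p n) / sqrt (log ((n : ℝ) + 2)))
          atTop atTop) := by
  haveI : ∀ n, Fact (0 ≤ p n ∧ p n ≤ 1) := fun n => ⟨hp n⟩
  have lim : Tendsto (lam p) atTop atTop := hlim
  obtain ⟨F, hF⟩ : ∃ F : ∀ n, Ω n → Cf (n + 2), F = fun n ω e => Z n e ω := ⟨_, rfl⟩
  have hFm : ∀ n, Measurable (F n) := fun n => by rw [hF]; exact measurable_pi_lambda _ (hZmeas n)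
  have hmap : ∀ n, (μ n).map (F n) = PP (n + 2) (p n) := fun n => by
    have h1 := (iIndepFun_iff_map_fun_eq_pi_map (fun e => (hZmeas n e).aemeasurable)).1 (hindep n)
    rw [hF]; refine h1.trans ?_
    unfold PP nu
    simp only [hlaw]
  have hCm : ∀ n, Conn n = F n ⁻¹' {z | tt 0 z 1 ≠ ⊤} := fun n => by
    rw [hConn, hF]
    ext ω
    exact ⟨fun h => reach_TT _ _ _ h, fun h => TT_reach _ _ _ h⟩
  have hfin : ∀ n, MeasurableSet {z : Cf (n + 2) | tt 0 z 1 ≠ ⊤} := fun n =>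
    (measurable_tt 0 1) (MeasurableSet.singleton ⊤).compl
  have hCmeas : ∀ n, MeasurableSet (Conn n) := fun n => by rw [hCm]; exact hFm n (hfin n)
  have hC0 : Tendsto (fun n => (μ n).real (Conn n)ᶜ) atTop (nhds 0) := by
    have h := AOK1 lim
    refine squeeze_zero' (Eventually.of_forall fun n => measureReal_nonneg) ?_ h.D_lim
    filter_upwards [h.P_tau, tendsto_LL.eventually_gt_atTop 0] with n hn hL
    refine ENNReal.toReal_le_of_le_ofReal (by positivity) (le_trans ?_ hn)
    have hB : MeasurableSet {z : Cf (n + 2) | ¬ tt 0 z 1 ≤ ofReal (tau p (fun n => min (sqrt (lam p n) / 2) (LL n)) n)} :=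
      (measurableSet_le (measurable_tt 0 1) measurable_const).compl
    rw [← hmap, Measure.map_apply (hFm n) hB, hCm, ← Set.preimage_compl]
    refine measure_mono (Set.preimage_mono fun z hz => ?_)
    have hz : tt 0 z 1 = ⊤ := not_not.1 hz
    show ¬ tt 0 z 1 ≤ _
    rw [hz, top_le_iff]
    exact ENNReal.ofReal_ne_top
  have key : ∀ g : ℝ → ℝ, Continuous g → (∃ C, ∀ x, |g x| ≤ C) →
      Tendsto (fun n : ℕ =>
          ∫ ω, g (((H n ω : ℝ) - log ((n : ℝ) + 2)) /
            sqrt (log ((n : ℝ) + 2))) ∂((μ n)[|Conn n]) - ∫ z, g (Xf n z) ∂(PP (n + 2) (p n))) atTop (nhds 0) := by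
    rintro g hg ⟨C, hC⟩
    refine (cond_lim μ Conn hCmeas hC0 (fun n ω => g (Xf n (F n ω))) (fun n => hg.measurable.comp ((measurable_Xf n).comp (hFm n))) C
      (fun n z => hC _)).congr fun n => ?_
    congr 1
    · refine integral_congr_ae (ae_cond_of_forall_mem (hCmeas n) fun ω hω => ?_)
      rw [hCm, hF] at hω
      have hω : TT 0 (effWeight fun e => Z n e ω) 1 ≠ ⊤ := hω
      simp only [hH, hopCount_eq _ _ _ hω, hF]
      rfl
    · rw [← hmap]
      exact (integral_map (hFm n).aemeasurable (hg.measurable.comp (measurable_Xf n)).aestronglyMeasurable).symm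
  constructor
  · intro h
    by_contra hn
    refine arctan_contra lim hn ?_
    have hb : ∃ C, ∀ x, |arctan x| ≤ C := ⟨2, arctan_abs⟩
    have h1 := (h _ Real.continuous_arctan hb).sub (key _ Real.continuous_arctan hb)
    simpa using h1
  · intro hr g hg hb
    obtain ⟨a, ha, hat⟩ := AOK2 lim hr
    have h1 := (key g hg hb).add (levy_normal (fun n => PP (n + 2) (p n)) Xf measurable_Xf (ha.charX hat) g hg hb)
    simpa using h1
end FPP

end

/-- **Centering replacement in the dense-regime CLT** (Remark 1.5(a) of
Bhamidi–van der Hofstad–Hooghiemstra): if `λₙ = n pₙ → ∞`, then the conditional law of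
`(Hₙ - log n)/√(log n)` (given that the two uniformly chosen vertices are connected)
converges weakly to the standard normal distribution **iff** `λₙ/√(log n) → ∞`; i.e., in the
CLT `(Hₙ - βₙ log n)/√(log n) ⇒ N(0,1)`, `βₙ = λₙ/(λₙ-1)`, the centering `βₙ log n` can be
replaced by `log n` precisely when `λₙ/√(log n) → ∞`. -/
theorem hopcount_centering_iff
    (p : ℕ → ℝ) (hp : ∀ n, 0 ≤ p n ∧ p n ≤ 1)
    (hlim : Tendsto (fun n : ℕ => ((n : ℝ) + 2) * p n) atTop atTop)
    (Ω : ℕ → Type) (mΩ : ∀ n, MeasurableSpace (Ω n)) (μ : ∀ n, Measure (Ω n))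
    (hμ : ∀ n, IsProbabilityMeasure (μ n))
    (Z : ∀ n, Sym2 (Fin (n + 2)) → Ω n → Bool × ℝ)
    (hZmeas : ∀ n e, Measurable (Z n e))
    (hindep : ∀ n, iIndepFun (m := fun _ => inferInstance) (Z n) (μ n))
    (hlaw : ∀ n e, (μ n).map (Z n e) = (bernoulliDist (p n)).prod expDist)
    (H : ∀ n, Ω n → ℕ)
    (hH : ∀ n ω, H n ω = hopCount (effWeight (fun e => Z n e ω)) 0 1)
    (Conn : ∀ n, Set (Ω n))
    (hConn : ∀ n, Conn n = {ω | (theGraph (fun e => Z n e ω)).Reachable 0 1}) :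
    ((∀ g : ℝ → ℝ, Continuous g → (∃ C, ∀ x, |g x| ≤ C) →
      Tendsto (fun n : ℕ =>
          ∫ ω, g (((H n ω : ℝ) - Real.log ((n : ℝ) + 2)) /
            Real.sqrt (Real.log ((n : ℝ) + 2))) ∂((μ n)[|Conn n]))
        atTop (nhds (∫ x, g x ∂(gaussianReal 0 1))))
      ↔ Tendsto (fun n : ℕ => (((n : ℝ) + 2) * p n) / Real.sqrt (Real.log ((n : ℝ) + 2)))
          atTop atTop) := by
  exact FPP.final p hp hlim Ω mΩ μ hμ Z hZmeas hindep hlaw H hH Conn hConn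

end
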